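/- arXiv:2505.07092 — 2 statements merged into one kernel-verified Lean document; each statement's English description precedes it below -/
import Mathlib

section
/- Let p, q, s be distinct primes with p ≡ 5 (mod 8), s ≡ 3 (mod 8), q ≡ 7 (mod 8), and Legendre symbols (p/q) = (p/s) = (s/q) = 1. Then the 2-Sylow subgroup of the class group of the ring of integers of L⁺ is isomorphic to ℤ/2ℤ × ℤ/2ℤ; in particular the 2-class number of L⁺ is 4. -/
open Real NumberField IntermediateField

noncomputable section

/-- The totally real multiquadratic field `L⁺ = ℚ(√2, √(pq), √(ps))`, realized as a
subfield of `ℝ`. -/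
def Lplus (p q s : ℕ) : IntermediateField ℚ ℝ :=
  adjoin ℚ {Real.sqrt 2, Real.sqrt (p * q), Real.sqrt (p * s)}

open IsDedekindDomain nonZeroDivisors

/-- The subgroup of squares of a commutative group. -/
def squares (G : Type*) [CommGroup G] : Subgroup G := (powMonoidHom 2 : G →* G).range

theorem mem_squares {G : Type*} [CommGroup G] {x : G} : x ∈ squares G ↔ ∃ y, y ^ 2 = x := by
  simp [squares]

theorem index_squares_of_mulEquiv {G H : Type*} [CommGroup G] [CommGroup H] (e : G ≃* H) :
    (squares G).index = (squares H).index := by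
  have h : squares G = (squares H).comap e.toMonoidHom := by
    ext x
    simp only [mem_squares, Subgroup.mem_comap]
    constructor
    · rintro ⟨y, rfl⟩
      exact ⟨e y, by simp⟩
    · rintro ⟨y, hy⟩
      exact ⟨e.symm y, e.injective (by simpa using hy)⟩
  rw [h, Subgroup.index_comap_of_surjective _ e.surjective]

theorem squares_prod (G H : Type*) [CommGroup G] [CommGroup H] :
    squares (G × H) = (squares G).prod (squares H) := by
  ext ⟨x, y⟩
  simp only [mem_squares, Subgroup.mem_prod, Prod.exists, Prod.pow_mk, Prod.mk.injEq]
  constructor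
  · rintro ⟨a, b, h1, h2⟩
    exact ⟨⟨a, h1⟩, ⟨b, h2⟩⟩
  · rintro ⟨⟨a, h1⟩, ⟨b, h2⟩⟩
    exact ⟨a, b, h1, h2⟩

theorem index_squares_multiplicative_pi_int (n : ℕ) :
    (squares (Multiplicative (Fin n → ℤ))).index = 2 ^ n := by
  let c : (Fin n → ℤ) →+ (Fin n → ZMod 2) := (Int.castAddHom (ZMod 2)).compLeft _
  have hc : Function.Surjective (AddMonoidHom.toMultiplicative c) := by
    intro y
    refine ⟨Multiplicative.ofAdd fun i => (ZMod.intCast_surjective (y.toAdd i)).choose, ?_⟩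
    exact congrArg Multiplicative.ofAdd
      (funext fun i => (ZMod.intCast_surjective (y.toAdd i)).choose_spec)
  have hker : (AddMonoidHom.toMultiplicative c).ker = squares (Multiplicative (Fin n → ℤ)) := by
    ext x
    rw [MonoidHom.mem_ker, mem_squares]
    constructor
    · intro h
      have h2 : ∀ i, ∃ m : ℤ, x.toAdd i = 2 * m := fun i => by
        have h3 : ((x.toAdd i : ℤ) : ZMod 2) = 0 := congrFun (congrArg Multiplicative.toAdd h) i
        exact (ZMod.intCast_zmod_eq_zero_iff_dvd _ _).1 h3
      choose m hm using h2
      refine ⟨Multiplicative.ofAdd m, ?_⟩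
      apply Multiplicative.toAdd.injective
      ext i
      simp [hm i]
    · rintro ⟨y, rfl⟩
      rw [map_pow]
      apply Multiplicative.toAdd.injective
      ext i
      simp only [toAdd_pow, toAdd_one, Pi.smul_apply, Pi.zero_apply]
      rw [two_nsmul]; exact CharTwo.add_self_eq_zero _
  rw [← hker, Subgroup.index_ker, MonoidHom.range_eq_top.2 hc]
  simp

theorem index_squares_torsion (K : Type*) [Field K] [NumberField K] :
    (squares (Units.torsion K)).index = 2 := by
  have h1 : (squares (Units.torsion K)).index =
      Nat.card (powMonoidHom 2 : Units.torsion K →* Units.torsion K).ker := by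
    have h := Subgroup.index_ker (powMonoidHom 2 : Units.torsion K →* Units.torsion K)
    have h2 := Subgroup.card_mul_index (powMonoidHom 2 : Units.torsion K →* Units.torsion K).ker
    have h3 := Subgroup.card_mul_index (squares (Units.torsion K))
    rw [h] at h2
    have h4 : 0 < Nat.card (squares (Units.torsion K)) := Nat.card_pos
    unfold squares at *
    nlinarith
  rw [h1, Nat.card_eq_two_iff]
  let m : Units.torsion K := ⟨-1, (CommGroup.mem_torsion _).2
    (isOfFinOrder_iff_pow_eq_one.2 ⟨2, by norm_num, by simp⟩)⟩
  have hm : m ∈ (powMonoidHom 2 : Units.torsion K →* Units.torsion K).ker := by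
    rw [MonoidHom.mem_ker]; ext; simp [m]
  refine ⟨1, ⟨m, hm⟩, ?_, ?_⟩
  · intro h
    have h' : (1 : Units.torsion K) = m := congrArg Subtype.val h
    have := congrArg (fun x : Units.torsion K => ((x : (𝓞 K)ˣ) : 𝓞 K)) h'
    simp [m] at this
    exact (by norm_num : (1 : 𝓞 K) ≠ -1) this
  · ext ⟨x, hx⟩
    simp only [Set.mem_insert_iff, Set.mem_singleton_iff, Set.mem_univ, iff_true]
    rw [MonoidHom.mem_ker] at hx
    have h5 : (((x : (𝓞 K)ˣ) : 𝓞 K)) * ((x : (𝓞 K)ˣ) : 𝓞 K) = 1 := by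
      have := congrArg (fun x : Units.torsion K => ((x : (𝓞 K)ˣ) : 𝓞 K)) hx
      simpa [sq] using this
    rcases mul_self_eq_one_iff.1 h5 with h | h
    · left
      exact Subtype.ext (Subtype.ext (Units.ext (by simpa using h)))
    · right
      exact Subtype.ext (Subtype.ext (Units.ext (by simpa [m] using h)))

theorem index_squares_units (K : Type*) [Field K] [NumberField K] :
    (squares (𝓞 K)ˣ).index = 2 ^ (Units.rank K + 1) := by
  let f : Units.torsion K × Multiplicative (Fin (Units.rank K) → ℤ) →* (𝓞 K)ˣ :=
    { toFun := fun x => x.1 * ∏ i, (Units.fundSystem K i) ^ (x.2.toAdd i)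
      map_one' := by simp
      map_mul' := fun x y => by
        simp only [Prod.fst_mul, Subgroup.coe_mul, Prod.snd_mul, toAdd_mul, Pi.add_apply, zpow_add,
          Finset.prod_mul_distrib]
        exact mul_mul_mul_comm _ _ _ _ }
  have hf : Function.Bijective f := by
    constructor
    · rintro ⟨x1, x2⟩ ⟨y1, y2⟩ h
      have := (Units.exist_unique_eq_mul_prod K (f (x1, x2))).unique (y₁ := (x1, x2.toAdd))
        (y₂ := (y1, y2.toAdd)) rfl h
      simpa using this
    · intro x
      obtain ⟨⟨z, e⟩, h, -⟩ := Units.exist_unique_eq_mul_prod K x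
      exact ⟨(z, Multiplicative.ofAdd e), h.symm⟩
  rw [← index_squares_of_mulEquiv (MulEquiv.ofBijective f hf), squares_prod, Subgroup.index_prod,
    index_squares_torsion, index_squares_multiplicative_pi_int]
  ring

theorem index_squares_units_of_isTotallyReal (K : Type*) [Field K] [NumberField K]
    [IsTotallyReal K] : (squares (𝓞 K)ˣ).index = 2 ^ Module.finrank ℚ K := by
  have h := IsTotallyReal.finrank (K := K)
  have h2 := IsTotallyReal.nrComplexPlaces_eq_zero (K := K)
  have h3 := InfinitePlace.card_eq_nrRealPlaces_add_nrComplexPlaces K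
  have h4 : 0 < Module.finrank ℚ K := Module.finrank_pos
  rw [index_squares_units, Units.rank]
  congr 1
  omega

/-- The normalised additive valuation (up to sign) of a nonzero element of a number field. -/
def ordAt {K : Type*} [Field K] [NumberField K] (v : HeightOneSpectrum (𝓞 K)) (x : Kˣ) : ℤ :=
  WithZero.log (v.valuation K (x : K))

theorem ordAt_mul {K : Type*} [Field K] [NumberField K] (v : HeightOneSpectrum (𝓞 K)) (x y : Kˣ) :
    ordAt v (x * y) = ordAt v x + ordAt v y := by
  simp [ordAt, WithZero.log_mul]

/-- The 2-Selmer group of a number field relative to a set of primes. -/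
def selmer {K : Type*} [Field K] [NumberField K] (S : Set (HeightOneSpectrum (𝓞 K))) :
    Subgroup Kˣ where
  carrier := {x | ∀ v ∉ S, Even (ordAt v x)}
  mul_mem' := fun {x y} hx hy v hv => by
    rw [ordAt_mul]; exact (hx v hv).add (hy v hv)
  one_mem' := fun v hv => by simp [ordAt]
  inv_mem' := fun {x} hx v hv => by
    have := hx v hv
    simpa [ordAt, WithZero.log_inv] using this

theorem mem_selmer {K : Type*} [Field K] [NumberField K] {S : Set (HeightOneSpectrum (𝓞 K))}
    {x : Kˣ} : x ∈ selmer S ↔ ∀ v ∉ S, Even (ordAt v x) := Iff.rfl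

theorem squares_le_selmer {K : Type*} [Field K] [NumberField K]
    (S : Set (HeightOneSpectrum (𝓞 K))) : squares Kˣ ≤ selmer S := by
  intro x hx v _
  obtain ⟨y, rfl⟩ := mem_squares.1 hx
  rw [sq, ordAt_mul]
  exact ⟨_, rfl⟩

theorem selmer_mono {K : Type*} [Field K] [NumberField K] {S T : Set (HeightOneSpectrum (𝓞 K))}
    (h : S ⊆ T) : selmer S ≤ selmer T :=
  fun _ hx v hv => hx v fun h' => hv (h h')

theorem ramificationIdx_eq_one_of_aeval_derivative_dvd {k K : Type*} [Field k] [NumberField k]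
    [Field K] [NumberField K] [Algebra k K] (v : HeightOneSpectrum (𝓞 k))
    (w : HeightOneSpectrum (𝓞 K)) [w.asIdeal.LiesOver v.asIdeal] {θ : 𝓞 K}
    (hθ : k⟮(θ : K)⟯ = ⊤) {f : Polynomial (𝓞 k)} (hf : Polynomial.aeval θ f = 0)
    {δ : 𝓞 k} (hδ : Polynomial.aeval θ (Polynomial.derivative f) ∣ algebraMap (𝓞 k) (𝓞 K) δ)
    (hv : δ ∉ v.asIdeal) : v.asIdeal.ramificationIdx' w.asIdeal = 1 := by
  have hint : IsIntegral (𝓞 k) θ := Algebra.IsIntegral.isIntegral θ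
  have hadj : Algebra.adjoin k {(algebraMap (𝓞 K) K θ)} = ⊤ := by
    have h1 := IntermediateField.adjoin_simple_toSubalgebra_of_isAlgebraic
      (F := k) (α := (θ : K)) (Algebra.IsAlgebraic.isAlgebraic _)
    rw [hθ] at h1
    simpa using h1.symm
  have h1 := aeval_derivative_mem_differentIdeal (𝓞 k) k K θ hadj
  obtain ⟨g, hg⟩ := minpoly.isIntegrallyClosed_dvd hint hf
  have h2 : Polynomial.aeval θ (Polynomial.derivative f) ∈ differentIdeal (𝓞 k) (𝓞 K) := by
    rw [hg, Polynomial.derivative_mul, map_add, map_mul, map_mul, minpoly.aeval, zero_mul, add_zero]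
    exact Ideal.mul_mem_right _ _ h1
  have h3 : ¬ w.asIdeal ∣ differentIdeal (𝓞 k) (𝓞 K) := by
    intro h
    have h4 := Ideal.dvd_iff_le.1 h h2
    have h5 := Ideal.mem_of_dvd _ hδ h4
    exact hv ((Ideal.mem_of_liesOver w.asIdeal v.asIdeal δ).2 h5)
  have h4 := not_dvd_differentIdeal_iff.1 h3
  rw [Ideal.ramificationIdx'_eq_ramificationIdx _ _ v.ne_bot]
  exact Ideal.ramificationIdx_eq_one _ _

theorem even_ordAt_of_mem_selmer {k K : Type*} [Field k] [NumberField k]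
    [Field K] [NumberField K] [Algebra k K] (v : HeightOneSpectrum (𝓞 k)) {θ : 𝓞 K}
    (hθ : k⟮(θ : K)⟯ = ⊤) {f : Polynomial (𝓞 k)} (hf : Polynomial.aeval θ f = 0)
    {δ : 𝓞 k} (hδ : Polynomial.aeval θ (Polynomial.derivative f) ∣ algebraMap (𝓞 k) (𝓞 K) δ)
    (hv : δ ∉ v.asIdeal) {x : kˣ}
    (hx : Units.map (algebraMap k K).toMonoidHom x ∈ selmer (K := K) ∅) : Even (ordAt v x) := by
  obtain ⟨P, hP, hPv⟩ := 
    Ideal.exists_maximal_ideal_liesOver_of_isIntegral v.asIdeal (S := 𝓞 K)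
  have hP0 : P ≠ ⊥ := Ideal.ne_bot_of_liesOver_of_ne_bot v.ne_bot P
  let w : HeightOneSpectrum (𝓞 K) := ⟨P, hP.isPrime, hP0⟩
  haveI : w.asIdeal.LiesOver v.asIdeal := hPv
  have h1 := ramificationIdx_eq_one_of_aeval_derivative_dvd v w hθ hf hδ hv
  have h2 := HeightOneSpectrum.valuation_liesOver K v w (x : k)
  rw [h1, pow_one] at h2
  have h3 := hx w (by simp)
  unfold ordAt at h3 ⊢
  rw [h2]
  exact h3

/-- The group of units of the ring of integers, seen inside the multiplicative group. -/
def integerUnits (K : Type*) [Field K] [NumberField K] : Subgroup Kˣ :=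
  (Units.map (algebraMap (𝓞 K) K).toMonoidHom).range

theorem comap_squares_integerUnits (K : Type*) [Field K] [NumberField K] :
    (squares Kˣ).comap (Units.map (algebraMap (𝓞 K) K).toMonoidHom) = squares (𝓞 K)ˣ := by
  ext u
  rw [Subgroup.mem_comap, mem_squares, mem_squares]
  constructor
  · rintro ⟨y, hy⟩
    have hy' : (y : K) ^ 2 = algebraMap (𝓞 K) K u := congrArg Units.val hy
    obtain ⟨z, hz⟩ := IsIntegrallyClosed.exists_algebraMap_eq_of_isIntegral_pow
      (R := 𝓞 K) (K := K) (x := (y : K)) (n := 2) (by norm_num)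
      (by rw [hy']; exact isIntegral_algebraMap)
    have hz2 : z ^ 2 = u := by
      apply FaithfulSMul.algebraMap_injective (𝓞 K) K
      rw [map_pow, hz, hy']
    have hzu : IsUnit z := (isUnit_pow_iff (n := 2) (by norm_num)).1 (hz2 ▸ u.isUnit)
    exact ⟨hzu.unit, Units.ext (by simpa using hz2)⟩
  · rintro ⟨y, rfl⟩
    exact ⟨Units.map (algebraMap (𝓞 K) K).toMonoidHom y, by rw [map_pow]⟩

theorem relIndex_squares_integerUnits (K : Type*) [Field K] [NumberField K] [IsTotallyReal K] :
    (squares Kˣ).relIndex (integerUnits K) = 2 ^ Module.finrank ℚ K := by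
  rw [integerUnits, MonoidHom.range_eq_map, ← Subgroup.relIndex_comap, Subgroup.relIndex_top_right,
    comap_squares_integerUnits, index_squares_units_of_isTotallyReal]

theorem Multiset.exists_eq_add_self_of_even_count {α : Type*} [DecidableEq α] (s : Multiset α)
    (h : ∀ a, Even (s.count a)) : ∃ t : Multiset α, s = t + t := by
  refine ⟨∑ a ∈ s.toFinset, (s.count a / 2) • {a}, ?_⟩
  ext a
  rw [Multiset.count_add, Multiset.count_sum']
  simp only [Multiset.count_nsmul, Multiset.count_singleton, mul_ite, mul_one, mul_zero,
    Finset.sum_ite_eq, Multiset.mem_toFinset]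
  split_ifs with ha
  · have := Nat.div_two_mul_two_of_even (h a); omega
  · simp [Multiset.count_eq_zero_of_notMem ha]

theorem Ideal.exists_eq_sq_of_even_multiplicity {R : Type*} [CommRing R] [IsDedekindDomain R]
    {I : Ideal R} (hI : I ≠ ⊥) (h : ∀ v : HeightOneSpectrum R, Even (multiplicity v.asIdeal I)) :
    ∃ J : Ideal R, I = J ^ 2 := by
  classical
  have hc : ∀ P : Ideal R, Even ((UniqueFactorizationMonoid.normalizedFactors I).count P) := by
    intro P
    by_cases hP : P ∈ UniqueFactorizationMonoid.normalizedFactors I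
    · have hPp := UniqueFactorizationMonoid.prime_of_normalized_factor P hP
      have h1 := h ⟨P, Ideal.isPrime_of_prime hPp, hPp.ne_zero⟩
      have h2 := UniqueFactorizationMonoid.emultiplicity_eq_count_normalizedFactors
        hPp.irreducible hI
      rw [normalize_eq] at h2
      rwa [multiplicity_eq_of_emultiplicity_eq_some h2] at h1
    · simp [Multiset.count_eq_zero_of_notMem hP]
  obtain ⟨t, ht⟩ := Multiset.exists_eq_add_self_of_even_count _ hc
  refine ⟨t.prod, ?_⟩
  rw [sq, ← Multiset.prod_add, ← ht]
  exact (associated_iff_eq.1 (UniqueFactorizationMonoid.prod_normalizedFactors hI)).symm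

theorem mem_selmer_empty_of_span_eq_sq {K : Type*} [Field K] [NumberField K] {x : Kˣ} {y : 𝓞 K}
    (hy : y ≠ 0) {I : Ideal (𝓞 K)} (hI : Ideal.span {y} = I ^ 2) (hx : (x : K) = y) :
    x ∈ selmer (K := K) ∅ := by
  intro v _
  have hI0 : I ≠ ⊥ := by
    rintro rfl
    rw [← Ideal.zero_eq_bot, zero_pow two_ne_zero, Ideal.zero_eq_bot,
      Ideal.span_singleton_eq_bot] at hI
    exact hy hI
  rw [ordAt, hx, HeightOneSpectrum.valuation_of_algebraMap,
    HeightOneSpectrum.intValuation_eq_exp_neg_multiplicity v hy, hI, WithZero.log_exp, even_neg,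
    (FiniteMultiplicity.of_not_isUnit v.prime.not_isUnit hI0).multiplicity_pow v.prime]
  simp

theorem exists_of_mem_selmer_empty {K : Type*} [Field K] [NumberField K] {x : Kˣ}
    (hx : x ∈ selmer (K := K) ∅) : ∃ (y : 𝓞 K) (I : Ideal (𝓞 K)) (z : Kˣ), y ≠ 0 ∧
      Ideal.span {y} = I ^ 2 ∧ (x : K) = y * (z : K) ^ 2 := by
  obtain ⟨n, d, hd, hnd⟩ := IsFractionRing.div_surjective (A := 𝓞 K) (x : K)
  have hd0 : (algebraMap (𝓞 K) K d) ≠ 0 := by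
    simpa using nonZeroDivisors.ne_zero hd
  have hn0 : (algebraMap (𝓞 K) K n) ≠ 0 := by
    intro h; rw [h, zero_div] at hnd; exact x.ne_zero hnd.symm
  have hxy : (x : K) = (n * d : 𝓞 K) * (((Units.mk0 _ hd0)⁻¹ : Kˣ) : K) ^ 2 := by
    rw [← hnd]
    push_cast
    rw [Units.val_mk0]
    field_simp
  have hy : n * d ≠ 0 := mul_ne_zero (by simpa using hn0) (by simpa using hd0)
  obtain ⟨J, hJ⟩ := Ideal.exists_eq_sq_of_even_multiplicity (I := Ideal.span {n * d})
    (by simpa using hy) (fun v => by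
      have h1 := hx v (by simp)
      have h2 : x = (Units.mk0 ((n * d : 𝓞 K) : K) (by simpa using hy)) * (Units.mk0 _ hd0)⁻¹ ^ 2 :=
        Units.ext (by simpa using hxy)
      rw [h2, ordAt_mul, sq, ordAt_mul, Int.even_add] at h1
      have h3 := h1.2 ⟨_, rfl⟩
      rw [ordAt, Units.val_mk0, HeightOneSpectrum.valuation_of_algebraMap,
        HeightOneSpectrum.intValuation_eq_exp_neg_multiplicity v hy, WithZero.log_exp,
        even_neg] at h3
      simpa using h3)
  exact ⟨n * d, J, _, hy, hJ, hxy⟩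

theorem ideal_eq_span_mul_of_sq {R : Type*} [CommRing R] [IsDedekindDomain R] {I J : Ideal R}
    {x y : R} (h : Ideal.span {x} ^ 2 * I ^ 2 = Ideal.span {y} ^ 2 * J ^ 2) :
    Ideal.span {x} * I = Ideal.span {y} * J := by
  rw [← mul_pow, ← mul_pow] at h
  exact (pow_left_injective two_ne_zero) h

theorem integerUnits_le_selmer (K : Type*) [Field K] [NumberField K]
    (S : Set (HeightOneSpectrum (𝓞 K))) : integerUnits K ≤ selmer S := by
  refine le_trans ?_ (selmer_mono (Set.empty_subset S))
  rintro _ ⟨u, rfl⟩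
  exact mem_selmer_empty_of_span_eq_sq (y := (u : 𝓞 K)) (I := ⊤) u.ne_zero
    (by rw [Ideal.span_singleton_eq_top.2 u.isUnit, ← Ideal.one_eq_top, one_pow]) rfl

theorem ideal_ne_bot_of_span_eq_sq {R : Type*} [CommRing R] {y : R} {I : Ideal R}
    (hy : y ≠ 0) (hI : Ideal.span {y} = I ^ 2) : I ≠ ⊥ := by
  rintro rfl
  rw [← Ideal.zero_eq_bot, zero_pow two_ne_zero, Ideal.zero_eq_bot,
    Ideal.span_singleton_eq_bot] at hI
  exact hy hI

theorem mk0_sq_eq_one_iff {R : Type*} [CommRing R] [IsDedekindDomain R] (I : (Ideal R)⁰) :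
    ClassGroup.mk0 I ^ 2 = 1 ↔ ∃ y : R, y ≠ 0 ∧ Ideal.span {y} = (I : Ideal R) ^ 2 := by
  rw [← map_pow, ClassGroup.mk0_eq_one_iff]
  have h0 : (I : Ideal R) ≠ ⊥ := nonZeroDivisors.coe_ne_zero I
  constructor
  · rintro ⟨⟨y, hy⟩⟩
    have hy' : Ideal.span {y} = (I : Ideal R) ^ 2 := by simpa using hy.symm
    refine ⟨y, ?_, hy'⟩
    rintro rfl
    have : (I : Ideal R) ^ 2 = 0 := by rw [← hy']; simp
    exact h0 (pow_eq_zero_iff (two_ne_zero) |>.1 this)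
  · rintro ⟨y, -, hy⟩
    exact ⟨⟨y, by simpa using hy.symm⟩⟩

theorem selmer_empty_le {K : Type*} [Field K] [NumberField K]
    (h : ∀ c : ClassGroup (𝓞 K), c ^ 2 = 1 → c = 1) :
    selmer (K := K) ∅ ≤ integerUnits K ⊔ squares Kˣ := by
  intro x hx
  obtain ⟨y, I, z, hy, hI, hxy⟩ := exists_of_mem_selmer_empty hx
  have hI0 := ideal_ne_bot_of_span_eq_sq hy hI
  let I' : (Ideal (𝓞 K))⁰ := ⟨I, mem_nonZeroDivisors_of_ne_zero hI0⟩
  have h1 := h (ClassGroup.mk0 I') ((mk0_sq_eq_one_iff I').2 ⟨y, hy, hI⟩)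
  rw [ClassGroup.mk0_eq_one_iff] at h1
  obtain ⟨⟨a, ha⟩⟩ := h1
  have ha' : I = Ideal.span {a} := ha
  rw [ha', Ideal.span_singleton_pow, Ideal.span_singleton_eq_span_singleton] at hI
  obtain ⟨u, hu⟩ := hI.symm
  have ha0 : (a : K) ≠ 0 := by
    intro h
    have : a = 0 := by simpa using h
    rw [this] at hu
    exact hy (by simpa using hu.symm)
  have : x = (Units.map (algebraMap (𝓞 K) K).toMonoidHom u) * (Units.mk0 (a : K) ha0 * z) ^ 2 := by
    apply Units.ext
    rw [hxy, ← hu]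
    simp
    ring
  rw [this]
  exact Subgroup.mul_mem_sup ⟨u, rfl⟩ (mem_squares.2 ⟨_, rfl⟩)

theorem card_classGroup_two_torsion_le {K : Type*} [Field K] [NumberField K]
    (hfin : (integerUnits K ⊔ squares Kˣ).relIndex (selmer ∅) ≠ 0) :
    Nat.card (powMonoidHom 2 : ClassGroup (𝓞 K) →* ClassGroup (𝓞 K)).ker ≤
      (integerUnits K ⊔ squares Kˣ).relIndex (selmer ∅) := by
  have hrep : ∀ c : (powMonoidHom 2 : ClassGroup (𝓞 K) →* ClassGroup (𝓞 K)).ker,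
      ∃ (I : (Ideal (𝓞 K))⁰) (y : 𝓞 K), y ≠ 0 ∧ ClassGroup.mk0 I = c ∧
        Ideal.span {y} = (I : Ideal (𝓞 K)) ^ 2 := by
    rintro ⟨c, hc⟩
    obtain ⟨I, rfl⟩ := ClassGroup.mk0_surjective c
    obtain ⟨y, hy, hI⟩ := (mk0_sq_eq_one_iff I).1 hc
    exact ⟨I, y, hy, rfl, hI⟩
  choose I y hy hI hIy using hrep
  let f : (powMonoidHom 2 : ClassGroup (𝓞 K) →* ClassGroup (𝓞 K)).ker → selmer (K := K) ∅ :=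
    fun c => ⟨Units.mk0 (y c : K) (by simpa using hy c),
      mem_selmer_empty_of_span_eq_sq (hy c) (hIy c) rfl⟩
  have : Finite (selmer (K := K) ∅ ⧸ (integerUnits K ⊔ squares Kˣ).subgroupOf (selmer ∅)) :=
    Nat.finite_of_card_ne_zero hfin
  refine Nat.card_le_card_of_injective (fun c => QuotientGroup.mk (f c)) ?_
  intro c d hcd
  rw [QuotientGroup.eq, Subgroup.mem_subgroupOf, Subgroup.mem_sup] at hcd
  obtain ⟨_, ⟨u, rfl⟩, b, hb, hub⟩ := hcd
  obtain ⟨z, rfl⟩ := mem_squares.1 hb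
  obtain ⟨m, n, hn, hmn⟩ := IsFractionRing.div_surjective (A := 𝓞 K) (z : K)
  have hn0 : n ≠ 0 := nonZeroDivisors.ne_zero hn
  have hn0' : (n : K) ≠ 0 := by simpa using hn0
  have hm0 : m ≠ 0 := by
    rintro rfl
    rw [map_zero, zero_div] at hmn
    exact z.ne_zero hmn.symm
  have h1 : (u : 𝓞 K) * m ^ 2 * y c = n ^ 2 * y d := by
    apply FaithfulSMul.algebraMap_injective (𝓞 K) K
    have h2 := congrArg Units.val hub
    simp [f] at h2
    rw [← hmn] at h2
    have hyc : (y c : K) ≠ 0 := by simpa using hy c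
    field_simp at h2
    push_cast
    rw [← h2]
  apply Subtype.ext
  rw [← hI c, ← hI d, ClassGroup.mk0_eq_mk0_iff]
  refine ⟨m, n, hm0, hn0, ideal_eq_span_mul_of_sq ?_⟩
  rw [← hIy, ← hIy, Ideal.span_singleton_pow, Ideal.span_singleton_pow,
    Ideal.span_singleton_mul_span_singleton, Ideal.span_singleton_mul_span_singleton, ← h1,
    Ideal.span_singleton_eq_span_singleton]
  exact ⟨u, by ring⟩

theorem relIndex_ne_zero_of_le_right {G : Type*} [Group G] {H A B : Subgroup G} (h : A ≤ B)
    (hB : H.relIndex B ≠ 0) : H.relIndex A ≠ 0 :=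
  fun h0 => hB (Subgroup.relIndex_eq_zero_of_le_right h h0)

theorem relIndex_selmer_empty_le {k : Type*} [Field k] [NumberField k]
    {S : Set (HeightOneSpectrum (𝓞 k))} (hS : S.Finite) :
    (selmer (K := k) ∅).relIndex (selmer S) ≤ 2 ^ S.ncard ∧
      (selmer (K := k) ∅).relIndex (selmer S) ≠ 0 := by
  have : Finite S := hS
  let f : selmer S →* Multiplicative (S → ZMod 2) :=
    { toFun := fun x => Multiplicative.ofAdd fun v => ((ordAt v.1 (x : kˣ) : ℤ) : ZMod 2)
      map_one' := by
        apply Multiplicative.toAdd.injective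
        ext v
        simp [ordAt]
      map_mul' := fun x y => by
        apply Multiplicative.toAdd.injective
        ext v
        simp [ordAt_mul] }
  have hker : f.ker = (selmer (K := k) ∅).subgroupOf (selmer S) := by
    ext ⟨x, hx⟩
    rw [MonoidHom.mem_ker, Subgroup.mem_subgroupOf, mem_selmer]
    constructor
    · intro h v _
      by_cases hv : v ∈ S
      · have h1 : ((ordAt v x : ℤ) : ZMod 2) = 0 :=
          congrFun (congrArg Multiplicative.toAdd h) ⟨v, hv⟩
        rw [ZMod.intCast_zmod_eq_zero_iff_dvd] at h1
        exact even_iff_two_dvd.2 h1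
      · exact hx v hv
    · intro h
      apply Multiplicative.toAdd.injective
      ext v
      change ((ordAt v.1 x : ℤ) : ZMod 2) = 0
      rw [ZMod.intCast_zmod_eq_zero_iff_dvd]
      exact even_iff_two_dvd.1 (h v.1 (by simp))
  rw [Subgroup.relIndex, ← hker, Subgroup.index_ker]
  refine ⟨?_, Nat.card_pos.ne'⟩
  calc Nat.card f.range ≤ Nat.card (Multiplicative (S → ZMod 2)) := Subgroup.card_le_card_group _
    _ = 2 ^ S.ncard := by
      rw [Nat.card_congr Multiplicative.toAdd, Nat.card_fun, Nat.card_zmod, Nat.card_coe_set_eq]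

theorem relIndex_squares_selmer_empty_le {k : Type*} [Field k] [NumberField k] [IsTotallyReal k]
    (h : ∀ c : ClassGroup (𝓞 k), c ^ 2 = 1 → c = 1) :
    (squares kˣ).relIndex (selmer ∅) = 2 ^ Module.finrank ℚ k := by
  have h1 : selmer (K := k) ∅ = integerUnits k ⊔ squares kˣ :=
    le_antisymm (selmer_empty_le h) (sup_le (integerUnits_le_selmer k _) (squares_le_selmer _))
  rw [h1, Subgroup.relIndex_sup_right, relIndex_squares_integerUnits]

/-- The inclusion of multiplicative groups of a field extension. -/
abbrev unitsIncl (k K : Type*) [Field k] [Field K] [Algebra k K] : kˣ →* Kˣ :=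
  Units.map (algebraMap k K).toMonoidHom

/-- The norm on multiplicative groups of a field extension. -/
abbrev unitsNorm (k K : Type*) [Field k] [Field K] [Algebra k K] : Kˣ →* kˣ :=
  Units.map (Algebra.norm k)

theorem map_unitsNorm_selmer_le (k K : Type*) [Field k] [NumberField k] [Field K] [NumberField K]
    [Algebra k K] : (selmer (K := K) ∅).map (unitsNorm k K) ≤ selmer ∅ := by
  rintro _ ⟨x, hx, rfl⟩
  obtain ⟨y, I, z, hy, hI, hxy⟩ := exists_of_mem_selmer_empty hx
  have hy' : (y : K) ≠ 0 := by simpa using hy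
  have h1 : x = Units.mk0 (y : K) hy' * z ^ 2 := Units.ext (by simpa using hxy)
  rw [h1, map_mul, map_pow]
  refine Subgroup.mul_mem _ ?_ (squares_le_selmer _ (mem_squares.2 ⟨_, rfl⟩))
  have h2 : algebraMap (𝓞 k) k (Algebra.intNorm (𝓞 k) (𝓞 K) y) = Algebra.norm k (y : K) :=
    Algebra.algebraMap_intNorm (A := 𝓞 k) (K := k) (L := K) (B := 𝓞 K) y
  refine mem_selmer_empty_of_span_eq_sq (y := Algebra.intNorm (𝓞 k) (𝓞 K) y)
    (I := Ideal.relNorm (𝓞 k) I) ?_ ?_ ?_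
  · intro h
    rw [h, map_zero] at h2
    exact hy' (Algebra.norm_eq_zero_iff.1 h2.symm)
  · rw [← Ideal.relNorm_singleton, hI, map_pow]
  · exact h2.symm

theorem sq_eq_trace_mul_sub_norm {k K : Type*} [Field k] [Field K] [Algebra k K]
    (h2 : Module.finrank k K = 2) (x : K) :
    x ^ 2 = algebraMap k K (Algebra.trace k K x) * x - algebraMap k K (Algebra.norm k x) := by
  have : FiniteDimensional k K := Module.finite_of_finrank_pos (by omega)
  let b := Module.finBasisOfFinrankEq k K h2
  have h := Matrix.aeval_self_charpoly (Algebra.leftMulMatrix b x)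
  rw [Matrix.charpoly_fin_two, ← Algebra.norm_eq_matrix_det, ← Algebra.trace_eq_matrix_trace] at h
  apply Algebra.leftMulMatrix_injective b
  simp only [map_add, map_sub, map_mul, map_pow, Polynomial.aeval_X, Polynomial.aeval_C] at h ⊢
  rw [AlgHom.commutes, AlgHom.commutes]
  rw [sub_add, sub_eq_zero] at h
  exact h

theorem mem_range_sup_squares_of_norm {k K : Type*} [Field k] [Field K] [CharZero k] [Algebra k K]
    (h2 : Module.finrank k K = 2) {x : Kˣ} (hx : unitsNorm k K x ∈ squares kˣ) :
    ∃ (b : kˣ) (y : Kˣ), x = unitsIncl k K b * y ^ 2 := by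
  obtain ⟨α, hα⟩ := mem_squares.1 hx
  have hα' : (α : k) ^ 2 = Algebra.norm k (x : K) := congrArg Units.val hα
  by_cases hxα : (x : K) + algebraMap k K α = 0
  · refine ⟨-α, 1, Units.ext ?_⟩
    simpa using eq_neg_of_add_eq_zero_left hxα
  · set T := Algebra.trace k K (x : K) + 2 * (α : k) with hT
    have h1 : ((x : K) + algebraMap k K α) ^ 2 = x * algebraMap k K T := by
      have h3 := sq_eq_trace_mul_sub_norm h2 (x : K)
      rw [← hα'] at h3
      rw [hT]
      simp only [map_add, map_mul, map_pow, map_ofNat] at h3 ⊢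
      linear_combination h3
    have hT0 : T ≠ 0 := by
      intro h
      rw [h, map_zero, mul_zero] at h1
      exact hxα (pow_eq_zero_iff two_ne_zero |>.1 h1)
    have hT0' : algebraMap k K T ≠ 0 := by simpa using hT0
    refine ⟨Units.mk0 T hT0, Units.mk0 _ hxα * (unitsIncl k K (Units.mk0 T hT0))⁻¹, Units.ext ?_⟩
    simp only [Units.val_mul, Units.val_pow_eq_pow_val, Units.val_mk0, Units.coe_map,
      Units.val_inv_eq_inv_val, RingHom.toMonoidHom_eq_coe, MonoidHom.coe_coe, mul_pow, h1]
    field_simp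

theorem card_two_torsion_le_of_quadratic {k K : Type*} [Field k] [NumberField k] [IsTotallyReal k]
    [Field K] [NumberField K] [IsTotallyReal K] [Algebra k K] (h2 : Module.finrank k K = 2)
    (hk : ∀ c : ClassGroup (𝓞 k), c ^ 2 = 1 → c = 1)
    {S : Set (HeightOneSpectrum (𝓞 k))} (hS : S.Finite)
    (hB : (selmer (K := K) ∅).comap (unitsIncl k K) ≤ selmer S)
    {r : K} {d : k} (hrd : r ^ 2 = algebraMap k K d) (hd : ¬ IsSquare d) :
    Nat.card (powMonoidHom 2 : ClassGroup (𝓞 K) →* ClassGroup (𝓞 K)).ker *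
        2 ^ Module.finrank ℚ K * 2 ≤
      2 ^ S.ncard * 2 ^ Module.finrank ℚ k *
        (squares kˣ).relIndex ((selmer (K := K) ∅).map (unitsNorm k K)) := by
  set Sel := selmer (K := K) ∅
  set j := unitsIncl k K
  set N := unitsNorm k K
  set B := Sel.comap j
  have hselk := relIndex_squares_selmer_empty_le hk
  obtain ⟨hS1, hS2⟩ := relIndex_selmer_empty_le hS
  have hkS : (squares kˣ).relIndex (selmer S) =
      2 ^ Module.finrank ℚ k * (selmer (K := k) ∅).relIndex (selmer S) := by
    rw [← hselk, Subgroup.relIndex_mul_relIndex _ _ _ (squares_le_selmer _)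
      (selmer_mono (Set.empty_subset S))]
  have hkS0 : (squares kˣ).relIndex (selmer S) ≠ 0 := by
    rw [hkS]; exact mul_ne_zero (by positivity) hS2
  have hsqj : squares kˣ ≤ (squares Kˣ).comap j := by
    intro x hx
    obtain ⟨y, rfl⟩ := mem_squares.1 hx
    exact mem_squares.2 ⟨j y, by rw [map_pow]⟩
  have hcB : (squares Kˣ).comap j ≤ B := Subgroup.comap_mono (squares_le_selmer _)
  have hB1 : (squares kˣ).relIndex B ≤ 2 ^ S.ncard * 2 ^ Module.finrank ℚ k := by
    refine (Subgroup.relIndex_le_of_le_right hB hkS0).trans ?_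
    rw [hkS, mul_comm]
    exact Nat.mul_le_mul_right _ hS1
  have hB0 : (squares kˣ).relIndex B ≠ 0 := relIndex_ne_zero_of_le_right hB hkS0
  have hB2 := Subgroup.relIndex_mul_relIndex _ _ _ hsqj hcB
  have hge : 2 ≤ (squares kˣ).relIndex ((squares Kˣ).comap j) := by
    have h0 : (squares kˣ).relIndex ((squares Kˣ).comap j) ≠ 0 := by
      intro h; rw [h, zero_mul] at hB2; exact hB0 hB2.symm
    have h1 : (squares kˣ).relIndex ((squares Kˣ).comap j) ≠ 1 := by
      rw [Ne, Subgroup.relIndex_eq_one]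
      intro h
      have hd0 : d ≠ 0 := by rintro rfl; exact hd ⟨0, by simp⟩
      have hr0 : r ≠ 0 := by
        rintro rfl
        rw [zero_pow two_ne_zero] at hrd
        exact hd0 ((map_eq_zero _).1 hrd.symm)
      obtain ⟨y, hy⟩ := mem_squares.1 (h (x := Units.mk0 d hd0)
        (mem_squares.2 ⟨Units.mk0 r hr0, Units.ext (by simpa [j] using hrd)⟩))
      exact hd ⟨y, by rw [← sq]; exact (congrArg Units.val hy).symm⟩
    omega
  have hA : (squares Kˣ).relIndex (Sel ⊓ (squares kˣ).comap N) ≤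
      ((squares Kˣ).comap j).relIndex B ∧
      (squares Kˣ).relIndex (Sel ⊓ (squares kˣ).comap N) ≠ 0 := by
    rw [Subgroup.relIndex_comap, ← Subgroup.relIndex_sup_right (B.map j)]
    have hle : Sel ⊓ (squares kˣ).comap N ≤ B.map j ⊔ squares Kˣ := by
      rintro x ⟨hx, hxN⟩
      obtain ⟨b, y, rfl⟩ := mem_range_sup_squares_of_norm h2 hxN
      refine Subgroup.mul_mem_sup (Subgroup.mem_map_of_mem _ ?_) (mem_squares.2 ⟨y, rfl⟩)
      exact (Subgroup.mul_mem_cancel_right _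
        (squares_le_selmer _ (mem_squares.2 ⟨y, rfl⟩))).1 hx
    have h0 : (squares Kˣ).relIndex (B.map j ⊔ squares Kˣ) ≠ 0 := by
      rw [Subgroup.relIndex_sup_right, ← Subgroup.relIndex_comap]
      intro h; rw [h, mul_zero] at hB2; exact hB0 hB2.symm
    exact ⟨Subgroup.relIndex_le_of_le_right hle h0, relIndex_ne_zero_of_le_right hle h0⟩
  obtain ⟨hA, hA0⟩ := hA
  have hK1 : (squares Kˣ).relIndex (Sel ⊓ (squares kˣ).comap N) *
      (squares kˣ).relIndex (Sel.map N) = (squares Kˣ).relIndex Sel := by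
    rw [← Subgroup.relIndex_comap, ← Subgroup.inf_relIndex_left Sel]
    refine Subgroup.relIndex_mul_relIndex _ _ _ (le_inf (squares_le_selmer _) ?_) inf_le_left
    intro x hx
    obtain ⟨y, rfl⟩ := mem_squares.1 hx
    exact mem_squares.2 ⟨N y, by rw [map_pow]⟩
  have hK2 : 2 ^ Module.finrank ℚ K * (integerUnits K ⊔ squares Kˣ).relIndex Sel =
      (squares Kˣ).relIndex Sel := by
    rw [← relIndex_squares_integerUnits K, ← Subgroup.relIndex_sup_right (integerUnits K)]
    exact Subgroup.relIndex_mul_relIndex _ _ _ le_sup_right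
      (sup_le (integerUnits_le_selmer K _) (squares_le_selmer _))
  have hm0 : (squares kˣ).relIndex (Sel.map N) ≠ 0 :=
    relIndex_ne_zero_of_le_right (map_unitsNorm_selmer_le k K)
      (by rw [hselk]; positivity)
  have hcard := card_classGroup_two_torsion_le (K := K) (by
    intro h
    rw [show (integerUnits K ⊔ squares Kˣ).relIndex Sel = 0 from h, mul_zero, ← hK1] at hK2
    exact mul_ne_zero hA0 hm0 hK2.symm)
  set a := (squares Kˣ).relIndex (Sel ⊓ (squares kˣ).comap N)
  set m := (squares kˣ).relIndex (Sel.map N)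
  calc _ ≤ (integerUnits K ⊔ squares Kˣ).relIndex Sel * 2 ^ Module.finrank ℚ K * 2 := by gcongr
    _ = a * 2 * m := by rw [mul_comm _ (2 ^ _), hK2, ← hK1]; ring
    _ ≤ ((squares Kˣ).comap j).relIndex B * (squares kˣ).relIndex ((squares Kˣ).comap j) * m := by
      gcongr
    _ = (squares kˣ).relIndex B * m := by rw [← hB2, mul_comm (Subgroup.relIndex _ B)]
    _ ≤ _ := by gcongr

/-- If `u y² = a² - d b²` over `ℚ_p`, with `u` prime to `p` and `p` exactly dividing `d`, then `u`
is a square modulo `p`. -/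
theorem legendreSym_eq_one_of_padic {p : ℕ} [Fact p.Prime] {u d : ℤ} (hu : ¬ (p : ℤ) ∣ u)
    (hd : ¬ (p : ℤ) ∣ d) {a b y : ℚ_[p]} (hy : y ≠ 0)
    (h : (u : ℚ_[p]) * y ^ 2 = a ^ 2 - (p * d : ℤ) * b ^ 2) : legendreSym p u = 1 := by
  have hp1 : (1 : ℝ) < p := by exact_mod_cast (Fact.out : p.Prime).one_lt
  have hp0 : (0 : ℝ) < p := by linarith
  have hnu : ‖(u : ℚ_[p])‖ = 1 := by
    refine le_antisymm (Padic.norm_int_le_one _) (not_lt.1 fun h' => hu ?_)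
    exact Padic.norm_intCast_lt_one_iff.1 h'
  have hnd : ‖(d : ℚ_[p])‖ = 1 := by
    refine le_antisymm (Padic.norm_int_le_one _) (not_lt.1 fun h' => hd ?_)
    exact Padic.norm_intCast_lt_one_iff.1 h'
  have hnp : ‖((p * d : ℤ) : ℚ_[p])‖ = (p : ℝ) ^ (-1 : ℤ) := by
    push_cast
    rw [norm_mul, hnd, mul_one, Padic.norm_p, zpow_neg_one]
  have hlt : ‖((p * d : ℤ) : ℚ_[p]) * b ^ 2‖ < ‖a ^ 2‖ := by
    by_contra hle
    rw [not_lt] at hle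
    by_cases hb : b = 0
    · rw [hb, zero_pow two_ne_zero, mul_zero, norm_zero] at hle
      have ha : a = 0 := by
        have := le_antisymm hle (norm_nonneg _)
        simpa using this
      rw [ha, hb] at h
      have hu0 : (u : ℚ_[p]) ≠ 0 := by
        intro h0; rw [h0, norm_zero] at hnu; exact zero_ne_one hnu
      simp [hu0, hy] at h
    have hpd : ((p * d : ℤ) : ℚ_[p]) * b ^ 2 ≠ 0 := by
      have : ((p * d : ℤ) : ℚ_[p]) ≠ 0 := by
        intro h0; rw [h0, norm_zero] at hnp; exact (zpow_pos hp0 _).ne hnp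
      exact mul_ne_zero this (pow_ne_zero _ hb)
    have hodd : ∀ c : ℚ_[p], c ≠ 0 → ‖c ^ 2‖ ≠ ‖((p * d : ℤ) : ℚ_[p]) * b ^ 2‖ := by
      intro c hc heq
      rw [norm_pow, norm_mul, norm_pow, hnp, Padic.norm_eq_zpow_neg_valuation hc,
        Padic.norm_eq_zpow_neg_valuation hb, ← zpow_natCast, ← zpow_natCast, ← zpow_mul,
        ← zpow_mul, ← zpow_add₀ hp0.ne'] at heq
      have := zpow_right_injective₀ hp0 hp1.ne' heq
      push_cast at this
      omega
    have hlt : ‖a ^ 2‖ < ‖((p * d : ℤ) : ℚ_[p]) * b ^ 2‖ := by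
      refine lt_of_le_of_ne hle ?_
      by_cases ha : a = 0
      · rw [ha, zero_pow two_ne_zero, norm_zero]
        exact (norm_pos_iff.2 hpd).ne
      · exact hodd a ha
    have h1 : ‖(u : ℚ_[p]) * y ^ 2‖ = ‖((p * d : ℤ) : ℚ_[p]) * b ^ 2‖ := by
      rw [h, sub_eq_add_neg, Padic.add_eq_max_of_ne (by rw [norm_neg]; exact hlt.ne), norm_neg,
        max_eq_right hlt.le]
    rw [norm_mul, hnu, one_mul] at h1
    exact hodd y hy h1
  have ha : a ≠ 0 := by
    rintro rfl
    rw [zero_pow two_ne_zero, norm_zero] at hlt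
    exact absurd hlt (not_lt.2 (norm_nonneg _))
  have h1 : ‖y ^ 2‖ = ‖a ^ 2‖ := by
    have : ‖(u : ℚ_[p]) * y ^ 2‖ = ‖a ^ 2‖ := by
      rw [h, sub_eq_add_neg, Padic.add_eq_max_of_ne (by rw [norm_neg]; exact hlt.ne'), norm_neg,
        max_eq_left hlt.le]
    rwa [norm_mul, hnu, one_mul] at this
  have ht : ‖y / a‖ ≤ 1 := by
    rw [norm_pow, norm_pow] at h1
    have := (pow_left_inj₀ (norm_nonneg _) (norm_nonneg _) two_ne_zero).1 h1
    rw [norm_div, this, div_self (norm_ne_zero_iff.2 ha)]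
  let t : ℤ_[p] := ⟨y / a, ht⟩
  have h2 : ‖(u : ℤ_[p]) * t ^ 2 - 1‖ < 1 := by
    rw [PadicInt.norm_def]
    have : (((u : ℤ_[p]) * t ^ 2 - 1 : ℤ_[p]) : ℚ_[p]) =
        -(((p * d : ℤ) : ℚ_[p]) * b ^ 2 / a ^ 2) := by
      push_cast
      change (u : ℚ_[p]) * (y / a) ^ 2 - 1 = _
      field_simp
      push_cast at h
      linear_combination h
    rw [this, norm_neg, norm_div, div_lt_one (norm_pos_iff.2 (pow_ne_zero _ ha))]
    exact hlt
  have h3 : ((u : ℤ) : ZMod p) * (PadicInt.toZMod t) ^ 2 = 1 := by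
    have : (u : ℤ_[p]) * t ^ 2 - 1 ∈ RingHom.ker (PadicInt.toZMod (p := p)) := by
      rw [PadicInt.ker_toZMod, IsLocalRing.mem_maximalIdeal, PadicInt.mem_nonunits]
      exact h2
    rw [RingHom.mem_ker] at this
    simpa [sub_eq_zero] using this
  have hu' : ((u : ℤ) : ZMod p) ≠ 0 := by
    rwa [Ne, ZMod.intCast_zmod_eq_zero_iff_dvd]
  rw [legendreSym.eq_one_iff p hu']
  have ht0 : PadicInt.toZMod t ≠ 0 := by
    intro h0; rw [h0, zero_pow two_ne_zero, mul_zero] at h3; exact zero_ne_one h3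
  refine ⟨(PadicInt.toZMod t)⁻¹, ?_⟩
  field_simp
  exact h3

theorem legendreSym_eq_one_of_rat {p : ℕ} [Fact p.Prime] {u d : ℤ} (hu : ¬ (p : ℤ) ∣ u)
    (hd : ¬ (p : ℤ) ∣ d) {a b y : ℚ} (hy : y ≠ 0)
    (h : (u : ℚ) * y ^ 2 = a ^ 2 - (p * d : ℤ) * b ^ 2) : legendreSym p u = 1 := by
  refine legendreSym_eq_one_of_padic (a := (a : ℚ_[p])) (b := (b : ℚ_[p])) (y := (y : ℚ_[p])) hu hd
    (by exact_mod_cast hy) ?_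
  have := congrArg (fun z : ℚ => (z : ℚ_[p])) h
  push_cast at this ⊢
  exact this

theorem exists_padic_sqrt {p : ℕ} [Fact p.Prime] (hp2 : p ≠ 2) {u : ℤ} (hu : legendreSym p u = 1) :
    ∃ t : ℤ_[p], t ^ 2 = u := by
  have hu0 : ((u : ℤ) : ZMod p) ≠ 0 := by
    intro h
    rw [(legendreSym.eq_zero_iff p u).2 h] at hu
    exact zero_ne_one hu
  obtain ⟨c, hc⟩ := (legendreSym.eq_one_iff p hu0).1 hu
  obtain ⟨n, rfl⟩ := ZMod.intCast_surjective c
  have hn : ¬ (p : ℤ) ∣ n := by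
    intro h
    rw [← ZMod.intCast_zmod_eq_zero_iff_dvd] at h
    rw [h, mul_zero] at hc
    exact hu0 hc
  have h2n : ‖((2 * n : ℤ) : ℤ_[p])‖ = 1 := by
    refine le_antisymm (PadicInt.norm_le_one _) (not_lt.1 fun h => ?_)
    rw [PadicInt.norm_int_lt_one_iff_dvd] at h
    rcases (Nat.prime_iff_prime_int.1 Fact.out).dvd_or_dvd h with h | h
    · have h' : p ∣ 2 := by exact_mod_cast h
      exact hp2 ((Nat.prime_dvd_prime_iff_eq Fact.out Nat.prime_two).1 h')
    · exact hn h
  obtain ⟨z, hz, -⟩ := hensels_lemma (p := p) (R := ℤ_[p])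
    (F := Polynomial.X ^ 2 - Polynomial.C (u : ℤ_[p])) (a := (n : ℤ_[p])) (by
      simp only [Polynomial.derivative_X_pow, Polynomial.derivative_C,
        map_sub, map_mul, map_pow, Polynomial.aeval_X, Polynomial.aeval_C]
      have h1 : ((n : ℤ_[p]) ^ 2 - (u : ℤ_[p])) = ((n ^ 2 - u : ℤ) : ℤ_[p]) := by push_cast; ring
      have h3 : ‖((n ^ 2 - u : ℤ) : ℤ_[p])‖ < 1 := by
        rw [PadicInt.norm_int_lt_one_iff_dvd, ← ZMod.intCast_zmod_eq_zero_iff_dvd]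
        push_cast
        rw [hc]; ring
      push_cast at h2n
      simp only [Algebra.algebraMap_self, RingHom.id_apply, h1]
      norm_num
      rw [← norm_mul, h2n]
      push_cast at h3
      simpa using h3)
  refine ⟨z, ?_⟩
  simpa [sub_eq_zero] using hz

theorem isIntegral_of_sq_eq {k K : Type*} [Field k] [Field K] [Algebra k K] {r : K} {d : k}
    (hr : r ^ 2 = algebraMap k K d) : IsIntegral k r :=
  ⟨Polynomial.X ^ 2 - Polynomial.C d, Polynomial.monic_X_pow_sub_C _ two_ne_zero, by simp [hr]⟩

theorem minpoly_of_sq_eq {k K : Type*} [Field k] [Field K] [Algebra k K] {r : K} {d : k}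
    (hr : r ^ 2 = algebraMap k K d) (hd : ¬ IsSquare d) :
    minpoly k r = Polynomial.X ^ 2 - Polynomial.C d := by
  refine (minpoly.eq_of_irreducible_of_monic ?_ (by simp [hr])
    (Polynomial.monic_X_pow_sub_C _ two_ne_zero)).symm
  exact X_pow_sub_C_irreducible_of_prime Nat.prime_two fun b hb => hd ⟨b, by rw [← hb, sq]⟩

theorem finrank_adjoin_of_sq_eq {k K : Type*} [Field k] [Field K] [Algebra k K] {r : K} {d : k}
    (hr : r ^ 2 = algebraMap k K d) (hd : ¬ IsSquare d) : Module.finrank k k⟮r⟯ = 2 := by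
  rw [IntermediateField.adjoin.finrank (isIntegral_of_sq_eq hr), minpoly_of_sq_eq hr hd,
    Polynomial.natDegree_X_pow_sub_C]

theorem finrank_of_sq_eq {k K : Type*} [Field k] [Field K] [Algebra k K] {r : K} {d : k}
    (hr : r ^ 2 = algebraMap k K d) (hd : ¬ IsSquare d) (htop : k⟮r⟯ = ⊤) :
    Module.finrank k K = 2 := by
  rw [← finrank_adjoin_of_sq_eq hr hd, htop, IntermediateField.finrank_top']

theorem exists_eq_add_mul_of_mem_adjoin {k K : Type*} [Field k] [Field K] [Algebra k K] {r : K}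
    {d : k} (hr : r ^ 2 = algebraMap k K d) {x : K} (hx : x ∈ k⟮r⟯) :
    ∃ a b : k, x = algebraMap k K a + algebraMap k K b * r := by
  have hx' : x ∈ Algebra.adjoin k {r} := by
    rw [← IntermediateField.mem_toSubalgebra,
      adjoin_simple_toSubalgebra_of_isAlgebraic (isIntegral_of_sq_eq hr).isAlgebraic] at hx
    exact hx
  clear hx
  induction hx' using Algebra.adjoin_induction with
  | mem x hx => exact ⟨0, 1, by simpa using hx⟩
  | algebraMap c => exact ⟨c, 0, by simp⟩
  | add x y _ _ h1 h2 =>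
    obtain ⟨a, b, rfl⟩ := h1
    obtain ⟨c, e, rfl⟩ := h2
    exact ⟨a + c, b + e, by simp only [map_add]; ring⟩
  | mul x y _ _ h1 h2 =>
    obtain ⟨a, b, rfl⟩ := h1
    obtain ⟨c, e, rfl⟩ := h2
    refine ⟨a * c + d * (b * e), a * e + b * c, ?_⟩
    simp only [map_add, map_mul, ← hr]
    ring

theorem eq_zero_of_add_mul_eq_zero {k K : Type*} [Field k] [Field K] [Algebra k K] {r : K} {d : k}
    (hr : r ^ 2 = algebraMap k K d) (hd : ¬ IsSquare d) {a b : k}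
    (h : algebraMap k K a + algebraMap k K b * r = 0) : b = 0 := by
  by_contra hb
  apply hd
  have hb' : algebraMap k K b ≠ 0 := by simpa using hb
  refine ⟨-a / b, (algebraMap k K).injective ?_⟩
  have h1 : r = algebraMap k K (-a / b) := by
    rw [map_div₀, map_neg, eq_div_iff hb']
    linear_combination h
  rw [map_mul, ← h1, ← hr, sq]

theorem isSquare_or_isSquare_mul {k K : Type*} [Field k] [CharZero k] [Field K] [Algebra k K]
    {r : K} {d e : k} (hr : r ^ 2 = algebraMap k K d) (hd : ¬ IsSquare d) (htop : k⟮r⟯ = ⊤)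
    (he : IsSquare (algebraMap k K e)) : IsSquare e ∨ IsSquare (e * d) := by
  obtain ⟨z, hz⟩ := he
  obtain ⟨a, b, rfl⟩ := exists_eq_add_mul_of_mem_adjoin hr (x := z) (by rw [htop]; trivial)
  have h1 : algebraMap k K (a ^ 2 + d * b ^ 2 - e) + algebraMap k K (2 * a * b) * r = 0 := by
    rw [map_sub, hz]
    simp only [map_add, map_mul, map_pow, map_ofNat, ← hr]
    ring
  have h2 := eq_zero_of_add_mul_eq_zero hr hd h1
  rw [h2, map_zero, zero_mul, add_zero, map_eq_zero] at h1
  rcases mul_eq_zero.1 h2 with h | h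
  · have ha : a = 0 := by simpa using h
    right
    exact ⟨d * b, by rw [ha] at h1; linear_combination (-d) * h1⟩
  · left
    exact ⟨a, by rw [h] at h1; linear_combination (-1 : k) * h1⟩

theorem exists_norm_eq_of_finrank {k K : Type*} [Field k] [Field K] [Algebra k K] {r : K} {d : k}
    (hr : r ^ 2 = algebraMap k K d) (hd : ¬ IsSquare d) (htop : k⟮r⟯ = ⊤) (x : K) :
    ∃ a b : k, Algebra.norm k x = a ^ 2 - d * b ^ 2 := by
  have h2 := finrank_of_sq_eq hr hd htop
  obtain ⟨a, b, rfl⟩ := exists_eq_add_mul_of_mem_adjoin hr (x := x) (by rw [htop]; trivial)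
  refine ⟨a, b, ?_⟩
  by_cases hb : b = 0
  · simp [hb, Algebra.norm_algebraMap, h2]
  have h3 := sq_eq_trace_mul_sub_norm h2 (algebraMap k K a + algebraMap k K b * r)
  set T := Algebra.trace k K (algebraMap k K a + algebraMap k K b * r)
  set n := Algebra.norm k (algebraMap k K a + algebraMap k K b * r)
  have h4 : algebraMap k K (a ^ 2 + d * b ^ 2 - T * a + n) +
      algebraMap k K (2 * a * b - T * b) * r = 0 := by
    simp only [map_add, map_mul, map_pow, map_ofNat, map_sub, ← hr]
    linear_combination h3
  have h5 := eq_zero_of_add_mul_eq_zero hr hd h4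
  rw [h5, map_zero, zero_mul, add_zero, map_eq_zero] at h4
  have h6 : T = 2 * a := by
    have : b * (2 * a - T) = 0 := by linear_combination h5
    rcases mul_eq_zero.1 this with h | h
    · exact absurd h hb
    · linear_combination -h
  rw [h6] at h4
  linear_combination h4

theorem exists_norm_eq_sq_sub_mul_sq {k K : Type*} [Field k] [CharZero k] [Field K] [Algebra k K]
    [FiniteDimensional k K] {r : K} {d : k}
    (hr : r ^ 2 = algebraMap k K d) (hd : ¬ IsSquare d) (x : K) :
    ∃ a b : k, Algebra.norm k x = a ^ 2 - d * b ^ 2 := by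
  have hr' : (AdjoinSimple.gen k r) ^ 2 = algebraMap k k⟮r⟯ d := Subtype.ext (by simpa using hr)
  rw [← Algebra.norm_norm (R := k) (S := k⟮r⟯)]
  refine exists_norm_eq_of_finrank hr' hd ?_ _
  have h2 := finrank_adjoin_of_sq_eq hr hd
  exact IntermediateField.eq_of_le_of_finrank_eq le_top (by
    rw [finrank_adjoin_of_sq_eq hr' hd, IntermediateField.finrank_top', h2])

theorem nonempty_ringHom_of_adjoin_eq_top {K E : Type*} [Field K] [CharZero K] [Field E]
    [CharZero E] {S : Set K} (htop : adjoin ℚ S = ⊤)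
    (hS : ∀ r ∈ S, ∃ d : ℤ, r ^ 2 = d ∧ ∃ t : E, t ^ 2 = d) : Nonempty (K →+* E) := by
  obtain ⟨f⟩ := IntermediateField.nonempty_algHom_adjoin_of_splits (F := ℚ) (K := E)
    (S := S) (by
      intro r hr
      obtain ⟨d, hd, t, ht⟩ := hS r hr
      refine ⟨isIntegral_of_sq_eq (d := (d : ℚ)) (by simpa using hd), ?_⟩
      have h1 : minpoly ℚ r ∣ Polynomial.X ^ 2 - Polynomial.C (d : ℚ) :=
        minpoly.dvd _ _ (by simp [hd])
      have h2 : (Polynomial.X ^ 2 - Polynomial.C (d : ℚ)).map (algebraMap ℚ E) =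
          (Polynomial.X - Polynomial.C t) * (Polynomial.X - Polynomial.C (-t)) := by
        rw [Polynomial.map_sub, Polynomial.map_pow, Polynomial.map_X, Polynomial.map_C,
          map_intCast, ← ht, map_pow, map_neg]
        ring
      refine Polynomial.Splits.of_dvd ?_ ?_ (Polynomial.map_dvd _ h1)
      · rw [h2]
        exact (Polynomial.Splits.X_sub_C _).mul (Polynomial.Splits.X_sub_C _)
      · rw [h2]
        exact mul_ne_zero (Polynomial.X_sub_C_ne_zero _) (Polynomial.X_sub_C_ne_zero _))
  rw [htop] at f
  exact ⟨f.toRingHom.comp IntermediateField.topEquiv.symm.toAlgHom.toRingHom⟩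

theorem norm_eq_of_mem_selmer_empty {k : Type*} [Field k] [NumberField k] {x : kˣ}
    (hx : x ∈ selmer ∅) :
    ∃ y : ℚ, Algebra.norm ℚ (x : k) = y ^ 2 ∨ Algebra.norm ℚ (x : k) = -y ^ 2 := by
  obtain ⟨y, I, z, -, hI, hxy⟩ := exists_of_mem_selmer_empty hx
  have h1 : ((Algebra.norm ℤ y).natAbs : ℚ) = (Ideal.absNorm I : ℚ) ^ 2 := by
    rw [← Ideal.absNorm_span_singleton, hI, map_pow]
    push_cast
    rfl
  have h2 : Algebra.norm ℚ (y : k) = ((Algebra.norm ℤ y : ℤ) : ℚ) := (Algebra.coe_norm_int y).symm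
  refine ⟨Ideal.absNorm I * Algebra.norm ℚ (z : k), ?_⟩
  rw [hxy, map_mul, map_pow, h2]
  rcases Int.natAbs_eq (Algebra.norm ℤ y) with h | h
  · left
    rw [h, Int.cast_natCast, h1]
    ring
  · right
    rw [h, Int.cast_neg, Int.cast_natCast, h1]
    ring

/-- The finite place of `ℚ` attached to a prime number. -/
def ratPlace (l : ℕ) (hl : l.Prime) : HeightOneSpectrum (𝓞 ℚ) where
  asIdeal := Ideal.span {(l : 𝓞 ℚ)}
  isPrime := by
    rw [Ideal.span_singleton_prime (by exact_mod_cast hl.ne_zero)]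
    rw [← MulEquiv.prime_iff Rat.ringOfIntegersEquiv.toMulEquiv]
    simpa using Nat.prime_iff_prime_int.1 hl
  ne_bot := by
    simpa using hl.ne_zero

theorem intCast_mem_ratPlace {l : ℕ} (hl : l.Prime) (n : ℤ) :
    (n : 𝓞 ℚ) ∈ (ratPlace l hl).asIdeal ↔ (l : ℤ) ∣ n := by
  rw [ratPlace, Ideal.mem_span_singleton, ← map_dvd_iff Rat.ringOfIntegersEquiv]
  simp

theorem ordAt_ratPlace {l : ℕ} (hl : l.Prime) {x : ℚˣ} (hx : (x : ℚ) = l) :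
    ordAt (ratPlace l hl) x = -1 := by
  have h : (x : ℚ) = algebraMap (𝓞 ℚ) ℚ (l : 𝓞 ℚ) := by rw [hx]; simp
  rw [ordAt, h, HeightOneSpectrum.valuation_of_algebraMap,
    HeightOneSpectrum.intValuation_singleton _ (by exact_mod_cast hl.ne_zero) rfl]
  simp

theorem ordAt_eq_zero_of_notMem {K : Type*} [Field K] [NumberField K]
    (v : HeightOneSpectrum (𝓞 K)) {x : Kˣ} {y : 𝓞 K} (hx : (x : K) = y) (hy : y ∉ v.asIdeal) :
    ordAt v x = 0 := by
  have h : (x : K) = algebraMap (𝓞 K) K y := hx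
  rw [ordAt, h, HeightOneSpectrum.valuation_of_algebraMap,
    HeightOneSpectrum.intValuation_eq_one_iff.2 hy]
  simp

theorem exists_squarefree_of_mem_selmer {K : Type*} [Field K] [NumberField K] {θ : 𝓞 K}
    (hθ : ℚ⟮(θ : K)⟯ = ⊤) {f : Polynomial (𝓞 ℚ)} (hf : Polynomial.aeval θ f = 0) {δ : ℤ}
    (hδ : Polynomial.aeval θ (Polynomial.derivative f) ∣ (δ : 𝓞 K)) {x : ℚˣ}
    (hx : unitsIncl ℚ K x ∈ selmer ∅) :
    ∃ n : ℕ, ∃ y : ℚ, Squarefree n ∧ (∀ l : ℕ, l.Prime → l ∣ n → (l : ℤ) ∣ δ) ∧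
      ((x : ℚ) = n * y ^ 2 ∨ (x : ℚ) = -(n * y ^ 2)) := by
  have hx0 : (x : ℚ) ≠ 0 := x.ne_zero
  obtain ⟨n, b, hnb, hn⟩ := Nat.sq_mul_squarefree ((x : ℚ).num.natAbs * (x : ℚ).den)
  have hden : ((x : ℚ).den : ℚ) ≠ 0 := by exact_mod_cast (x : ℚ).den_nz
  have hxn : (x : ℚ) = n * (b / (x : ℚ).den) ^ 2 ∨ (x : ℚ) = -(n * (b / (x : ℚ).den) ^ 2) := by
    have h1 : (b : ℚ) ^ 2 * n = ((x : ℚ).num.natAbs : ℚ) * (x : ℚ).den := by exact_mod_cast hnb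
    have h2 : (x : ℚ) * (x : ℚ).den = (x : ℚ).num := Rat.mul_den_eq_num _
    have h3 : (n : ℚ) * (b / (x : ℚ).den) ^ 2 = (x : ℚ).num.natAbs / (x : ℚ).den := by
      field_simp
      linear_combination h1
    rw [h3]
    have h4 : (x : ℚ) = (x : ℚ).num / (x : ℚ).den := by rw [← h2]; field_simp
    rcases Int.natAbs_eq (x : ℚ).num with h | h
    · left
      have h5 : ((x : ℚ).num.natAbs : ℚ) = (x : ℚ).num := by
        rw [← Int.cast_natCast, ← h]
      rw [h5]; exact h4
    · right
      have h5 : ((x : ℚ).num.natAbs : ℚ) = -(x : ℚ).num := by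
        rw [← Int.cast_natCast, ← Int.cast_neg]
        congr 1
        omega
      rw [h5, neg_div, neg_neg]; exact h4
  refine ⟨n, b / (x : ℚ).den, hn, fun l hl hln => ?_, hxn⟩
  by_contra hlδ
  have hev := even_ordAt_of_mem_selmer (ratPlace l hl) hθ hf (δ := (δ : 𝓞 ℚ)) (by simpa using hδ)
    (by rwa [intCast_mem_ratPlace]) hx
  obtain ⟨n', rfl⟩ := hln
  have hln' : ¬ l ∣ n' := fun h => hl.one_lt.ne' (by
    have := hn l (mul_dvd_mul_left l h)
    simpa using this)
  have hl0 : (l : ℚ) ≠ 0 := by exact_mod_cast hl.ne_zero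
  have hn0 : (n' : ℚ) ≠ 0 := by
    rintro h
    have : n' = 0 := by exact_mod_cast h
    exact hln' (this ▸ dvd_zero l)
  have hy0 : (b / (x : ℚ).den : ℚ) ≠ 0 := by
    intro h
    rw [h] at hxn
    simp [hx0] at hxn
  have hnot : (n' : 𝓞 ℚ) ∉ (ratPlace l hl).asIdeal := by
    have := intCast_mem_ratPlace hl (n' : ℤ)
    rw [Int.cast_natCast] at this
    rw [this]
    exact_mod_cast hln'
  have key : ∃ u : ℚˣ, ordAt (ratPlace l hl) u = 0 ∧
      x = u * (Units.mk0 _ hl0 * (Units.mk0 _ hy0 * Units.mk0 _ hy0)) := by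
    rcases hxn with h | h
    · refine ⟨Units.mk0 _ hn0, ordAt_eq_zero_of_notMem _ (y := n') (by simp) hnot,
        Units.ext ?_⟩
      simp only [Units.val_mul, Units.val_mk0]
      refine h.trans ?_
      push_cast; ring
    · refine ⟨-Units.mk0 _ hn0, ordAt_eq_zero_of_notMem _ (y := -n') (by simp)
        (by rwa [neg_mem_iff]), Units.ext ?_⟩
      simp only [Units.val_mul, Units.val_mk0, Units.val_neg]
      refine h.trans ?_
      push_cast; ring
  obtain ⟨u, hu, hxu⟩ := key
  rw [hxu, ordAt_mul, hu, ordAt_mul, ordAt_mul, ordAt_ratPlace hl rfl] at hev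
  obtain ⟨c, hc⟩ := hev
  omega

/-- The set of finite places of a number field above an integer. -/
def placesAbove (K : Type*) [Field K] [NumberField K] (l : ℕ) : Set (HeightOneSpectrum (𝓞 K)) :=
  {v | (l : 𝓞 K) ∈ v.asIdeal}

theorem placesAbove_finite (K : Type*) [Field K] [NumberField K] {l : ℕ} (hl : l ≠ 0) :
    (placesAbove K l).Finite := by
  have h := Ideal.finite_factors (R := 𝓞 K) (I := Ideal.span {(l : 𝓞 K)}) (by simpa using hl)
  refine h.subset fun v hv => ?_
  rw [Set.mem_ofPred_eq, Ideal.dvd_span_singleton]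
  exact hv

theorem absNorm_eq_pow_of_mem {K : Type*} [Field K] [NumberField K] {l : ℕ} (hl : l.Prime)
    (v : HeightOneSpectrum (𝓞 K)) (hv : (l : 𝓞 K) ∈ v.asIdeal) :
    ∃ f, f ≠ 0 ∧ Ideal.absNorm v.asIdeal = l ^ f := by
  have h1 : Ideal.absNorm v.asIdeal ∣ l ^ Module.finrank ℤ (𝓞 K) := by
    have h2 := Ideal.absNorm_dvd_absNorm_of_le ((Ideal.span_singleton_le_iff_mem _).2 hv)
    rw [Ideal.absNorm_span_singleton] at h2
    have h3 : Algebra.norm ℤ (l : 𝓞 K) = (l : ℤ) ^ Module.finrank ℤ (𝓞 K) := by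
      have := Algebra.norm_algebraMap_of_basis (RingOfIntegers.basis K) (l : ℤ)
      rw [Module.finrank_eq_card_basis (RingOfIntegers.basis K), ← this]
      simp
    rw [h3] at h2
    simpa [Int.natAbs_pow] using h2
  obtain ⟨f, -, hf⟩ := (Nat.dvd_prime_pow hl).1 h1
  refine ⟨f, ?_, hf⟩
  rintro rfl
  exact v.isPrime.ne_top (Ideal.absNorm_eq_one_iff.1 (by simpa using hf))

theorem le_absNorm_of_mem {K : Type*} [Field K] [NumberField K] {l : ℕ} (hl : l.Prime)
    (v : HeightOneSpectrum (𝓞 K)) (hv : (l : 𝓞 K) ∈ v.asIdeal) :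
    l ^ 1 ≤ Ideal.absNorm v.asIdeal := by
  obtain ⟨f, hf0, hf⟩ := absNorm_eq_pow_of_mem hl v hv
  rw [hf]
  exact Nat.pow_le_pow_right hl.pos (Nat.one_le_iff_ne_zero.2 hf0)

theorem sq_le_absNorm_of_mem {K : Type*} [Field K] [NumberField K] {l : ℕ} (hl : l.Prime)
    (h : IsEmpty (𝓞 K →+* ZMod l)) (v : HeightOneSpectrum (𝓞 K)) (hv : (l : 𝓞 K) ∈ v.asIdeal) :
    l ^ 2 ≤ Ideal.absNorm v.asIdeal := by
  obtain ⟨f, hf0, hf⟩ := absNorm_eq_pow_of_mem hl v hv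
  rw [hf]
  refine Nat.pow_le_pow_right hl.pos ?_
  by_contra hlt
  obtain rfl : f = 1 := by omega
  have hc : Nat.card (𝓞 K ⧸ v.asIdeal) = l := by
    rw [pow_one, Ideal.absNorm_apply, Submodule.cardQuot_apply] at hf
    exact hf
  have := Nat.finite_of_card_ne_zero (hc ▸ hl.ne_zero)
  have := Fintype.ofFinite (𝓞 K ⧸ v.asIdeal)
  rw [Nat.card_eq_fintype_card] at hc
  exact h.false ((ZMod.ringEquivOfPrime (𝓞 K ⧸ v.asIdeal) hl hc).symm.toRingHom.comp
    (Ideal.Quotient.mk _))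

theorem ncard_placesAbove_mul_le {K : Type*} [Field K] [NumberField K] {l : ℕ} (hl : l.Prime)
    (e f : ℕ) (he : ∀ v ∈ placesAbove K l, v.asIdeal ^ e ∣ Ideal.span {(l : 𝓞 K)})
    (hf : ∀ v ∈ placesAbove K l, l ^ f ≤ Ideal.absNorm v.asIdeal) :
    (placesAbove K l).ncard * (e * f) ≤ Module.finrank ℚ K := by
  classical
  have hfin := placesAbove_finite K hl.ne_zero
  have h1 : ∏ v ∈ hfin.toFinset, v.asIdeal ^ e ∣ Ideal.span {(l : 𝓞 K)} := by
    refine Finset.prod_dvd_of_coprime (fun v _ w _ hvw => ?_)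
      (fun v hv => he v (by simpa using hv))
    refine IsCoprime.pow ?_
    have := v.isMaximal
    have := w.isMaximal
    exact Ideal.isCoprime_of_isMaximal fun h => hvw (HeightOneSpectrum.ext h)
  have h2 := map_dvd Ideal.absNorm h1
  have h3 : Ideal.absNorm (Ideal.span {(l : 𝓞 K)}) = l ^ Module.finrank ℚ K := by
    rw [Ideal.absNorm_span_singleton, ← RingOfIntegers.rank K]
    have := Algebra.norm_algebraMap_of_basis (RingOfIntegers.basis K) (l : ℤ)
    rw [← Module.finrank_eq_card_basis (RingOfIntegers.basis K)] at this
    have h4 : Algebra.norm ℤ (l : 𝓞 K) = (l : ℤ) ^ Module.finrank ℤ (𝓞 K) := by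
      rw [← this]; simp
    rw [h4]
    simp [Int.natAbs_pow]
  rw [h3, map_prod] at h2
  have h5 : l ^ ((placesAbove K l).ncard * (e * f)) ≤
      ∏ v ∈ hfin.toFinset, Ideal.absNorm (v.asIdeal ^ e) := by
    rw [Set.ncard_eq_toFinset_card _ hfin, mul_comm, pow_mul, ← Finset.prod_const]
    refine Finset.prod_le_prod' fun v hv => ?_
    rw [map_pow, mul_comm e, pow_mul]
    exact Nat.pow_le_pow_left (hf v (by simpa using hv)) e
  exact (Nat.pow_le_pow_iff_right hl.one_lt).1
    (h5.trans (Nat.le_of_dvd (pow_pos hl.pos _) h2))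

theorem sq_dvd_span_of_sq_eq {K : Type*} [Field K] [NumberField K] {l : ℕ} {w : 𝓞 K}
    (hw : w ^ 2 = l) : ∀ v ∈ placesAbove K l, v.asIdeal ^ 2 ∣ Ideal.span {(l : 𝓞 K)} := by
  intro v hv
  rw [← hw, ← Ideal.span_singleton_pow]
  refine pow_dvd_pow_of_dvd (Ideal.dvd_span_singleton.2 ?_) 2
  refine v.isPrime.mem_of_pow_mem 2 ?_
  rw [hw]
  exact hv

theorem placesAbove_mul (K : Type*) [Field K] [NumberField K] (m n : ℕ) :
    placesAbove K (m * n) = placesAbove K m ∪ placesAbove K n := by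
  ext v
  simp only [placesAbove, Set.mem_ofPred_eq, Set.mem_union, Nat.cast_mul]
  exact v.isPrime.mul_mem_iff_mem_or_mem

theorem comap_selmer_le_of_sq {k K : Type*} [Field k] [NumberField k] [Field K] [NumberField K]
    [Algebra k K] {θ : 𝓞 K} (hθ : k⟮(θ : K)⟯ = ⊤) {d : ℕ} (h : θ ^ 2 = d) :
    (selmer (K := K) ∅).comap (unitsIncl k K) ≤ selmer (placesAbove k (4 * d)) := by
  intro x hx v hv
  refine even_ordAt_of_mem_selmer v hθ (f := Polynomial.X ^ 2 - Polynomial.C (d : 𝓞 k))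
    (δ := ((4 * d : ℕ) : 𝓞 k)) (by simp [h]) ⟨2 * θ, ?_⟩ hv hx
  rw [map_natCast]
  push_cast
  simp
  linear_combination (-4 : 𝓞 K) * h

theorem comap_selmer_le_of_sq_eq_add {k K : Type*} [Field k] [NumberField k] [Field K]
    [NumberField K] [Algebra k K] {θ : 𝓞 K} (hθ : k⟮(θ : K)⟯ = ⊤) {m : ℕ} (h : θ ^ 2 = θ + m) :
    (selmer (K := K) ∅).comap (unitsIncl k K) ≤ selmer (placesAbove k (4 * m + 1)) := by
  intro x hx v hv
  refine even_ordAt_of_mem_selmer v hθ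
    (f := Polynomial.X ^ 2 - Polynomial.X - Polynomial.C (m : 𝓞 k))
    (δ := ((4 * m + 1 : ℕ) : 𝓞 k)) (by simp [h]) ⟨2 * θ - 1, ?_⟩ hv hx
  rw [map_natCast]
  push_cast
  simp
  linear_combination (-4 : 𝓞 K) * h

theorem isEmpty_ringHom_zmod_of_sq_eq_two {R : Type*} [CommRing R] {w : R} (hw : w ^ 2 = 2) {l : ℕ}
    (hl : l.Prime) (h8 : l % 8 = 3 ∨ l % 8 = 5) : IsEmpty (R →+* ZMod l) := by
  refine ⟨fun f => ?_⟩
  have : Fact l.Prime := ⟨hl⟩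
  have h1 : IsSquare (2 : ZMod l) := ⟨f w, by rw [← map_mul, ← sq, hw, map_ofNat]⟩
  rw [ZMod.exists_sq_eq_two_iff (by omega)] at h1
  omega

theorem isEmpty_ringHom_zmod_two {R : Type*} [CommRing R] {θ : R} {m : ℕ} (hm : Odd m)
    (hθ : θ ^ 2 = θ + m) : IsEmpty (R →+* ZMod 2) := by
  refine ⟨fun f => ?_⟩
  obtain ⟨j, rfl⟩ := hm
  have h1 : f θ ^ 2 = f θ + 1 := by
    rw [← map_pow, hθ, map_add, map_natCast]
    have : (2 : ZMod 2) = 0 := rfl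
    push_cast
    rw [this]; ring
  revert h1
  generalize f θ = y
  revert y
  decide

theorem ncard_placesAbove_two_le {K : Type*} [Field K] [NumberField K] {w : 𝓞 K} (hw : w ^ 2 = 2) :
    (placesAbove K 2).ncard * 2 ≤ Module.finrank ℚ K :=
  ncard_placesAbove_mul_le Nat.prime_two 2 1 (sq_dvd_span_of_sq_eq (by simpa using hw))
    fun v hv => le_absNorm_of_mem Nat.prime_two v hv

theorem ncard_placesAbove_le_of_inert {K : Type*} [Field K] [NumberField K] {w : 𝓞 K}
    (hw : w ^ 2 = 2) {l : ℕ} (hl : l.Prime) (h8 : l % 8 = 3 ∨ l % 8 = 5) :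
    (placesAbove K l).ncard * 2 ≤ Module.finrank ℚ K :=
  ncard_placesAbove_mul_le hl 1 2 (fun v hv => by
      rw [pow_one]; exact Ideal.dvd_span_singleton.2 hv)
    fun v hv => sq_le_absNorm_of_mem hl (isEmpty_ringHom_zmod_of_sq_eq_two hw hl h8) v hv

theorem ncard_placesAbove_le {K : Type*} [Field K] [NumberField K] {l : ℕ} (hl : l.Prime) :
    (placesAbove K l).ncard ≤ Module.finrank ℚ K := by
  simpa using ncard_placesAbove_mul_le hl 1 1 (fun v (hv : (l : 𝓞 K) ∈ v.asIdeal) => by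
      rw [pow_one]; exact Ideal.dvd_span_singleton.2 hv)
    fun v hv => le_absNorm_of_mem hl v hv

theorem ncard_placesAbove_two_le_of_inert {K : Type*} [Field K] [NumberField K] {w : 𝓞 K}
    (hw : w ^ 2 = 2) {θ : 𝓞 K} {m : ℕ} (hm : Odd m) (hθ : θ ^ 2 = θ + m) :
    (placesAbove K 2).ncard * 4 ≤ Module.finrank ℚ K :=
  ncard_placesAbove_mul_le Nat.prime_two 2 2 (sq_dvd_span_of_sq_eq (by simpa using hw))
    fun v hv => sq_le_absNorm_of_mem Nat.prime_two (isEmpty_ringHom_zmod_two hm hθ) v hv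

theorem relIndex_squares_le_two {k : Type*} [Field k] {H : Subgroup kˣ}
    (h : ∀ x ∈ H, x ∈ squares kˣ ∨ -x ∈ squares kˣ) : (squares kˣ).relIndex H ≤ 2 := by
  have h1 : H ≤ Subgroup.zpowers (-1 : kˣ) ⊔ squares kˣ := by
    intro x hx
    rcases h x hx with h | h
    · exact Subgroup.mem_sup_right h
    · rw [show x = (-1) * (-x) by simp]
      exact Subgroup.mul_mem _ (Subgroup.mem_sup_left (Subgroup.mem_zpowers _))
        (Subgroup.mem_sup_right h)
  have h2 : (squares kˣ).relIndex (Subgroup.zpowers (-1 : kˣ)) ∣ 2 := by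
    refine (Subgroup.relIndex_dvd_card _ _).trans ?_
    rw [Nat.card_zpowers]
    exact orderOf_dvd_of_pow_eq_one (by simp)
  have h3 : (squares kˣ).relIndex (Subgroup.zpowers (-1 : kˣ) ⊔ squares kˣ) ∣ 2 := by
    rwa [Subgroup.relIndex_sup_right]
  have h4 : (squares kˣ).relIndex (Subgroup.zpowers (-1 : kˣ) ⊔ squares kˣ) ≠ 0 := by
    intro h0
    rw [h0] at h3
    omega
  exact (Subgroup.relIndex_le_of_le_right h1 h4).trans (Nat.le_of_dvd two_pos h3)

theorem classGroup_rat_eq_one (c : ClassGroup (𝓞 ℚ)) : c = 1 := by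
  have : Fintype.card (ClassGroup (𝓞 ℚ)) = 1 := Rat.classNumber_eq
  have := Fintype.card_le_one_iff_subsingleton.1 this.le
  exact Subsingleton.elim _ _

theorem forall_sq_eq_one_imp_of_card_le_one {G : Type*} [CommGroup G] [Finite G]
    (h : Nat.card (powMonoidHom 2 : G →* G).ker ≤ 1) (c : G) (hc : c ^ 2 = 1) : c = 1 := by
  have := (Finite.card_le_one_iff_subsingleton).1 h
  have h1 := Subsingleton.elim (⟨c, hc⟩ : (powMonoidHom 2 : G →* G).ker) 1
  exact congrArg Subtype.val h1

theorem mem_squares_of_eq_sq {k : Type*} [Field k] {x : kˣ} {y : k} (h : (x : k) = y ^ 2) :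
    x ∈ squares kˣ := by
  have hy : y ≠ 0 := by
    rintro rfl
    simp at h
  exact mem_squares.2 ⟨Units.mk0 y hy, Units.ext (by simpa using h.symm)⟩

theorem classGroup_sqrt_two_two_torsion {k : Type*} [Field k] [NumberField k] [IsTotallyReal k]
    {w : 𝓞 k} (hw : w ^ 2 = 2) (hk : ℚ⟮(w : k)⟯ = ⊤) (h2 : ¬ IsSquare (2 : ℚ))
    (c : ClassGroup (𝓞 k)) (hc : c ^ 2 = 1) : c = 1 := by
  have hw' : (w : k) ^ 2 = algebraMap ℚ k 2 := by
    rw [map_ofNat]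
    exact congrArg (algebraMap (𝓞 k) k) hw |>.trans (map_ofNat _ _) |> fun h => by simpa using h
  have hr := finrank_of_sq_eq hw' h2 hk
  have hB := comap_selmer_le_of_sq hk (d := 2) (by simpa using hw)
  have hS : placesAbove ℚ (4 * 2) = placesAbove ℚ 2 := by
    rw [show 4 * 2 = 2 * 2 * 2 by norm_num]
    simp only [placesAbove_mul, Set.union_self]
  rw [hS] at hB
  have h3 := card_two_torsion_le_of_quadratic hr (fun c _ => classGroup_rat_eq_one c)
    (placesAbove_finite ℚ two_ne_zero) hB hw' h2
  have h4 : (squares ℚˣ).relIndex ((selmer (K := k) ∅).map (unitsNorm ℚ k)) ≤ 2 := by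
    refine relIndex_squares_le_two ?_
    rintro _ ⟨x, hx, rfl⟩
    obtain ⟨y, hy | hy⟩ := norm_eq_of_mem_selmer_empty hx
    · exact Or.inl (mem_squares_of_eq_sq (y := y) hy)
    · exact Or.inr (mem_squares_of_eq_sq (y := y) (by
        have : ((-unitsNorm ℚ k x : ℚˣ) : ℚ) = -Algebra.norm ℚ (x : k) := rfl
        rw [this, hy, neg_neg]))
  have h5 := ncard_placesAbove_le (K := ℚ) Nat.prime_two
  rw [Module.finrank_self] at h5 h3
  rw [hr] at h3
  have h6 : 2 ^ (placesAbove ℚ 2).ncard ≤ 2 ^ 1 := Nat.pow_le_pow_right two_pos h5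
  have h7 := Nat.mul_le_mul (Nat.mul_le_mul h6 (le_refl (2 ^ 1))) h4
  exact forall_sq_eq_one_imp_of_card_le_one (by omega) c hc

theorem coe_sq_eq_natCast {K : Type*} [Field K] {x : 𝓞 K} {n : ℕ} (h : x ^ 2 = n) :
    (x : K) ^ 2 = n := by
  have := congrArg (algebraMap (𝓞 K) K) h
  simpa using this

theorem eq_one_or_eq_two_of_squarefree {n : ℕ} (hn : Squarefree n)
    (h : ∀ l : ℕ, l.Prime → l ∣ n → l = 2) : n = 1 ∨ n = 2 := by
  have hn0 : n ≠ 0 := hn.ne_zero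
  have h1 := Nat.eq_prime_pow_of_unique_prime_dvd hn0 (p := 2) (fun {d} hd hdn => h d hd hdn)
  set e := n.primeFactorsList.length
  have h2 : e ≤ 1 := by
    by_contra hlt
    have h3 : 2 * 2 ∣ n := by
      rw [h1, ← sq]
      exact pow_dvd_pow 2 (by omega)
    have := hn 2 h3
    simp at this
  interval_cases e
  · left; simpa using h1
  · right; simpa using h1

theorem exists_squarefree_of_sq_eq {K : Type*} [Field K] [NumberField K] {θ : 𝓞 K}
    (hθ : ℚ⟮(θ : K)⟯ = ⊤) {d : ℕ} (h : θ ^ 2 = d) {x : ℚˣ} (hx : unitsIncl ℚ K x ∈ selmer ∅) :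
    ∃ n : ℕ, ∃ y : ℚ, Squarefree n ∧ (∀ l : ℕ, l.Prime → l ∣ n → l ∣ 4 * d) ∧
      ((x : ℚ) = n * y ^ 2 ∨ (x : ℚ) = -(n * y ^ 2)) := by
  obtain ⟨n, y, hn, hdvd, hxy⟩ := exists_squarefree_of_mem_selmer hθ
    (f := Polynomial.X ^ 2 - Polynomial.C (d : 𝓞 ℚ)) (δ := (4 * d : ℕ)) (by simp [h])
    ⟨2 * θ, by push_cast; simp; linear_combination (-4 : 𝓞 K) * h⟩ hx
  exact ⟨n, y, hn, fun l hl hln => by exact_mod_cast hdvd l hl hln, hxy⟩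

theorem exists_squarefree_of_sq_eq_add {K : Type*} [Field K] [NumberField K] {θ : 𝓞 K}
    (hθ : ℚ⟮(θ : K)⟯ = ⊤) {m : ℕ} (h : θ ^ 2 = θ + m) {x : ℚˣ}
    (hx : unitsIncl ℚ K x ∈ selmer ∅) :
    ∃ n : ℕ, ∃ y : ℚ, Squarefree n ∧ (∀ l : ℕ, l.Prime → l ∣ n → l ∣ 4 * m + 1) ∧
      ((x : ℚ) = n * y ^ 2 ∨ (x : ℚ) = -(n * y ^ 2)) := by
  obtain ⟨n, y, hn, hdvd, hxy⟩ := exists_squarefree_of_mem_selmer hθ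
    (f := Polynomial.X ^ 2 - Polynomial.X - Polynomial.C (m : 𝓞 ℚ)) (δ := (4 * m + 1 : ℕ))
    (by simp [h]) ⟨2 * θ - 1, by push_cast; simp; linear_combination (-4 : 𝓞 K) * h⟩ hx
  exact ⟨n, y, hn, fun l hl hln => by exact_mod_cast hdvd l hl hln, hxy⟩

theorem norm_mem_squares_or_neg {k E : Type*} [Field k] [NumberField k] [Field E] [NumberField E]
    [Algebra k E] {w : 𝓞 k} (hw : w ^ 2 = 2) (hk : ℚ⟮(w : k)⟯ = ⊤) (h2 : ¬ IsSquare (2 : ℚ))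
    {l d : ℕ} [Fact l.Prime] (hl : legendreSym l (-1) = -1) (hld : ¬ l ∣ d)
    (hsq : ¬ IsSquare ((l * d : ℕ) : ℚ)) {r : E} (hr : r ^ 2 = (l * d : ℕ)) {y : kˣ}
    (hy : y ∈ (selmer (K := E) ∅).map (unitsNorm k E)) : y ∈ squares kˣ ∨ -y ∈ squares kˣ := by
  have hw' : (w : k) ^ 2 = 2 := coe_sq_eq_natCast (n := 2) hw
  have hyk := map_unitsNorm_selmer_le k E hy
  obtain ⟨x, hx, rfl⟩ := hy
  have hnorm : Algebra.norm ℚ (unitsNorm k E x : k) = Algebra.norm ℚ (x : E) :=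
    Algebra.norm_norm (R := ℚ) (S := k) (A := E)
  obtain ⟨a, b, hab⟩ := exists_norm_eq_sq_sub_mul_sq (k := ℚ) (K := E) (r := r)
    (d := ((l * d : ℕ) : ℚ)) (by rw [hr]; simp) hsq (x : E)
  obtain ⟨z, hz | hz⟩ := norm_eq_of_mem_selmer_empty hyk
  · obtain ⟨c, t, hct⟩ := mem_range_sup_squares_of_norm
      (finrank_of_sq_eq (r := (w : k)) (d := (2 : ℚ)) (by simpa using hw') h2 hk)
      (x := unitsNorm k E x) (mem_squares_of_eq_sq (y := z) hz)
    have hc : unitsIncl ℚ k c ∈ selmer ∅ := by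
      have h3 : unitsIncl ℚ k c = unitsNorm k E x * (t ^ 2)⁻¹ := by rw [hct]; group
      rw [h3]
      exact mul_mem hyk (inv_mem (squares_le_selmer _ (mem_squares.2 ⟨t, rfl⟩)))
    obtain ⟨n, u, hn, hdvd, hcu⟩ := exists_squarefree_of_sq_eq (θ := w) hk (d := 2)
      (by simpa using hw) hc
    have hn2 : (∃ j : k, (n : k) = j ^ 2) := by
      rcases eq_one_or_eq_two_of_squarefree hn (fun l hl hln => by
          have h4 : l ∣ 2 ^ 3 := hdvd l hl hln
          exact (Nat.prime_dvd_prime_iff_eq hl Nat.prime_two).1 (hl.dvd_of_dvd_pow h4)) with h | h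
      · exact ⟨1, by simp [h]⟩
      · exact ⟨w, by rw [hw', h]; simp⟩
    obtain ⟨j, hj⟩ := hn2
    have hval : ((unitsNorm k E x : kˣ) : k) = ((c : ℚ) : k) * (t : k) ^ 2 := by
      rw [hct]; simp
    rcases hcu with h | h
    · left
      refine mem_squares_of_eq_sq (y := j * u * t) ?_
      rw [hval, h]
      push_cast
      rw [hj]; ring
    · right
      refine mem_squares_of_eq_sq (y := j * u * t) ?_
      rw [Units.val_neg, hval, h]
      push_cast
      rw [hj]; ring
  · exfalso
    have hz0 : z ≠ 0 := by
      rintro rfl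
      have : Algebra.norm ℚ (unitsNorm k E x : k) = 0 := by rw [hz]; simp
      rw [Algebra.norm_eq_zero_iff] at this
      exact (unitsNorm k E x).ne_zero this
    have h3 := legendreSym_eq_one_of_rat (p := l) (u := -1) (d := d) (y := z) (a := a) (b := b)
      (by
        intro h
        have := Int.natAbs_dvd_natAbs.2 h
        simp at this
        exact (Fact.out : l.Prime).one_lt.ne' this) (by exact_mod_cast hld) hz0 (by
        push_cast
        rw [hnorm, hab] at hz
        push_cast at hz
        linear_combination -hz)
    rw [hl] at h3
    norm_num at h3

theorem norm_mem_squares {k E : Type*} [Field k] [NumberField k] [Field E] [NumberField E]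
    [Algebra k E] {w : 𝓞 k} (hw : w ^ 2 = 2) (hk : ℚ⟮(w : k)⟯ = ⊤) (h2 : ¬ IsSquare (2 : ℚ))
    {l d : ℕ} [Fact l.Prime] (hl : legendreSym l (-1) = -1) (hl2 : l ≠ 2)
    (hl2' : legendreSym l 2 = 1) (hld : ¬ l ∣ d)
    (hsq : ¬ IsSquare ((l * d : ℕ) : ℚ)) (hsqk : ¬ IsSquare ((l * d : ℕ) : k)) {r : E}
    (hr : r ^ 2 = (l * d : ℕ)) {y : kˣ}
    (hy : y ∈ (selmer (K := E) ∅).map (unitsNorm k E)) : y ∈ squares kˣ := by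
  refine (norm_mem_squares_or_neg hw hk h2 hl hld hsq hr hy).resolve_right fun hneg => ?_
  obtain ⟨t, ht⟩ := exists_padic_sqrt hl2 hl2'
  obtain ⟨φ⟩ := nonempty_ringHom_of_adjoin_eq_top (K := k) (E := ℚ_[l]) hk (by
    rintro _ rfl
    refine ⟨2, by simpa using coe_sq_eq_natCast (n := 2) hw, t, ?_⟩
    have := congrArg (fun z : ℤ_[l] => (z : ℚ_[l])) ht
    exact_mod_cast this)
  obtain ⟨x, hx, rfl⟩ := hy
  obtain ⟨z, hz⟩ := mem_squares.1 hneg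
  obtain ⟨a, b, hab⟩ := exists_norm_eq_sq_sub_mul_sq (k := k) (K := E) (r := r)
    (d := ((l * d : ℕ) : k)) (by rw [hr]; simp) hsqk (x : E)
  have hz' : (z : k) ^ 2 = -Algebra.norm k (x : E) := congrArg Units.val hz
  have h3 := legendreSym_eq_one_of_padic (p := l) (u := -1) (d := d) (y := φ z) (a := φ a)
    (b := φ b) (by
        intro h
        have := Int.natAbs_dvd_natAbs.2 h
        simp at this
        exact (Fact.out : l.Prime).one_lt.ne' this) (by exact_mod_cast hld)
      (by simp) (by
        rw [hab] at hz'
        have h4 := congrArg φ hz'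
        simp only [map_pow, map_neg, map_sub, map_mul, map_natCast] at h4
        push_cast at h4 ⊢
        linear_combination -h4)
  rw [hl] at h3
  norm_num at h3

theorem legendreSym_neg_one_of_mod_four {l : ℕ} [Fact l.Prime] (h : l % 4 = 3) :
    legendreSym l (-1) = -1 := by
  rw [legendreSym.at_neg_one (by omega), ZMod.χ₄_nat_three_mod_four h]

theorem legendreSym_neg_one_of_mod_four_eq_one {l : ℕ} [Fact l.Prime] (h : l % 4 = 1) :
    legendreSym l (-1) = 1 := by
  rw [legendreSym.at_neg_one (by omega), ZMod.χ₄_nat_one_mod_four h]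

theorem legendreSym_two_of_mod_eight {l : ℕ} [Fact l.Prime] (h : l % 8 = 7) :
    legendreSym l 2 = 1 := by
  rw [legendreSym.at_two (by omega), ZMod.χ₈_nat_mod_eight, h]
  rfl

theorem legendreSym_two_of_mod_eight_eq_five {l : ℕ} [Fact l.Prime] (h : l % 8 = 5) :
    legendreSym l 2 = -1 := by
  rw [legendreSym.at_two (by omega), ZMod.χ₈_nat_mod_eight, h]
  rfl

theorem not_isSquare_prime_mul_rat {l d : ℕ} (hl : l.Prime) (hld : ¬ l ∣ d) :
    ¬ IsSquare ((l * d : ℕ) : ℚ) := by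
  rw [Rat.isSquare_natCast_iff]
  rintro ⟨x, hx⟩
  have h1 : l ∣ x := by
    have : l ∣ x * x := ⟨d, hx.symm⟩
    exact (hl.dvd_mul.1 this).elim id id
  obtain ⟨y, rfl⟩ := h1
  refine hld ⟨y * y, Nat.eq_of_mul_eq_mul_left hl.pos ?_⟩
  rw [hx]; ring

theorem not_isSquare_two_rat : ¬ IsSquare (2 : ℚ) := by
  have := not_isSquare_prime_mul_rat (d := 1) Nat.prime_two (by norm_num)
  simpa using this

theorem not_dvd_of_prime_ne {l m : ℕ} (hl : l.Prime) (hm : m.Prime) (h : l ≠ m) : ¬ l ∣ m :=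
  fun h' => h ((Nat.prime_dvd_prime_iff_eq hl hm).1 h')

theorem finrank_rat_of_sqrt_two {k : Type*} [Field k] [NumberField k] {w : 𝓞 k} (hw : w ^ 2 = 2)
    (hk : ℚ⟮(w : k)⟯ = ⊤) : Module.finrank ℚ k = 2 :=
  finrank_of_sq_eq (r := (w : k)) (d := (2 : ℚ)) (by simpa using coe_sq_eq_natCast (n := 2) hw)
    not_isSquare_two_rat hk

theorem finrank_rat_of_quadratic {k E : Type*} [Field k] [NumberField k] [Field E] [NumberField E]
    [Algebra k E] (h : Module.finrank k E = 2) :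
    Module.finrank ℚ E = Module.finrank ℚ k * 2 := by
  rw [← h, Module.finrank_mul_finrank]

theorem ncard_placesAbove_mul_le_add (K : Type*) [Field K] [NumberField K] (m n : ℕ) :
    (placesAbove K (m * n)).ncard ≤ (placesAbove K m).ncard + (placesAbove K n).ncard := by
  rw [placesAbove_mul]
  exact Set.ncard_union_le _ _

theorem placesAbove_four (K : Type*) [Field K] [NumberField K] :
    placesAbove K 4 = placesAbove K 2 := by
  rw [show 4 = 2 * 2 by norm_num, placesAbove_mul, Set.union_self]

section biquadratic

variable {k E : Type*} [Field k] [NumberField k] [IsTotallyReal k] [Field E] [NumberField E]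
  [IsTotallyReal E] [Algebra k E]

theorem classGroup_two_torsion_of_sqrt_mul {w : 𝓞 k} (hw : w ^ 2 = 2) (hk : ℚ⟮(w : k)⟯ = ⊤)
    {q s : ℕ} (hq : q.Prime) (hs : s.Prime) (hq8 : q % 8 = 7) (hs8 : s % 8 = 3)
    (hsq : ¬ IsSquare ((q * s : ℕ) : k)) {r : E} (hr : r ^ 2 = (q * s : ℕ))
    {m : ℕ} (hm : 4 * m + 1 = q * s) {θ : 𝓞 E} (hθ : θ ^ 2 = θ + m) (htop : k⟮(θ : E)⟯ = ⊤)
    (hfin : Module.finrank k E = 2) (c : ClassGroup (𝓞 E)) (hc : c ^ 2 = 1) : c = 1 := by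
  have : Fact q.Prime := ⟨hq⟩
  have hqs : ¬ q ∣ s := not_dvd_of_prime_ne hq hs (by rintro rfl; omega)
  have hB := comap_selmer_le_of_sq_eq_add htop hθ
  rw [hm] at hB
  have h3 := card_two_torsion_le_of_quadratic hfin
    (fun c hc => classGroup_sqrt_two_two_torsion hw hk not_isSquare_two_rat c hc)
    (placesAbove_finite k (mul_ne_zero hq.ne_zero hs.ne_zero)) hB (r := r)
    (d := ((q * s : ℕ) : k)) (by rw [hr]; simp) hsq
  have h4 : (squares kˣ).relIndex ((selmer (K := E) ∅).map (unitsNorm k E)) = 1 :=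
    Subgroup.relIndex_eq_one.2 fun y hy => norm_mem_squares hw hk not_isSquare_two_rat
      (legendreSym_neg_one_of_mod_four (by omega)) (by omega)
      (legendreSym_two_of_mod_eight hq8) hqs (not_isSquare_prime_mul_rat hq hqs) hsq hr hy
  have h5 := finrank_rat_of_sqrt_two hw hk
  have h6 := ncard_placesAbove_mul_le_add k q s
  have h7 := ncard_placesAbove_le (K := k) hq
  have h8 := ncard_placesAbove_le_of_inert hw hs (Or.inl hs8)
  rw [finrank_rat_of_quadratic hfin, h4, h5] at h3
  rw [h5] at h7 h8
  have h9 : 2 ^ (placesAbove k (q * s)).ncard ≤ 2 ^ 3 := Nat.pow_le_pow_right two_pos (by omega)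
  exact forall_sq_eq_one_imp_of_card_le_one (by omega) c hc

theorem card_two_torsion_le_two_of_inert {w : 𝓞 k} (hw : w ^ 2 = 2) (hk : ℚ⟮(w : k)⟯ = ⊤)
    {p s : ℕ} (hp : p.Prime) (hs : s.Prime) (hp8 : p % 8 = 5) (hs8 : s % 8 = 3)
    (hsq : ¬ IsSquare ((s * p : ℕ) : k)) {θ : 𝓞 E} (hθ : θ ^ 2 = (s * p : ℕ))
    (htop : k⟮(θ : E)⟯ = ⊤) :
    Nat.card (powMonoidHom 2 : ClassGroup (𝓞 E) →* ClassGroup (𝓞 E)).ker ≤ 2 := by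
  have : Fact s.Prime := ⟨hs⟩
  have hsp : ¬ s ∣ p := not_dvd_of_prime_ne hs hp (by rintro rfl; omega)
  have hr : (θ : E) ^ 2 = (s * p : ℕ) := coe_sq_eq_natCast hθ
  have hr' : (θ : E) ^ 2 = algebraMap k E ((s * p : ℕ) : k) := by rw [hr]; simp
  have hfin := finrank_of_sq_eq hr' hsq htop
  have h3 := card_two_torsion_le_of_quadratic hfin
    (fun c hc => classGroup_sqrt_two_two_torsion hw hk not_isSquare_two_rat c hc)
    (placesAbove_finite k (mul_ne_zero four_ne_zero (mul_ne_zero hs.ne_zero hp.ne_zero)))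
    (comap_selmer_le_of_sq htop hθ) hr' hsq
  have h4 : (squares kˣ).relIndex ((selmer (K := E) ∅).map (unitsNorm k E)) ≤ 2 :=
    relIndex_squares_le_two fun y hy => norm_mem_squares_or_neg hw hk not_isSquare_two_rat
      (legendreSym_neg_one_of_mod_four (by omega)) hsp (not_isSquare_prime_mul_rat hs hsp) hr hy
  have h5 := finrank_rat_of_sqrt_two hw hk
  have h6 := ncard_placesAbove_mul_le_add k s p
  have h6' := ncard_placesAbove_mul_le_add k 4 (s * p)
  rw [placesAbove_four] at h6'
  have h7 := ncard_placesAbove_le_of_inert hw hp (Or.inr hp8)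
  have h8 := ncard_placesAbove_le_of_inert hw hs (Or.inl hs8)
  have h8' := ncard_placesAbove_two_le hw
  rw [finrank_rat_of_quadratic hfin, h5] at h3
  rw [h5] at h7 h8 h8'
  have h9 : 2 ^ (placesAbove k (4 * (s * p))).ncard ≤ 2 ^ 3 :=
    Nat.pow_le_pow_right two_pos (by omega)
  have h10 := Nat.mul_le_mul (Nat.mul_le_mul h9 (le_refl (2 ^ 2))) h4
  omega

theorem card_two_torsion_le_two_of_split {w : 𝓞 k} (hw : w ^ 2 = 2) (hk : ℚ⟮(w : k)⟯ = ⊤)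
    {p q : ℕ} (hp : p.Prime) (hq : q.Prime) (hp8 : p % 8 = 5) (hq8 : q % 8 = 7)
    (hsq : ¬ IsSquare ((q * p : ℕ) : k)) {θ : 𝓞 E} (hθ : θ ^ 2 = (q * p : ℕ))
    (htop : k⟮(θ : E)⟯ = ⊤) :
    Nat.card (powMonoidHom 2 : ClassGroup (𝓞 E) →* ClassGroup (𝓞 E)).ker ≤ 2 := by
  have : Fact q.Prime := ⟨hq⟩
  have hqp : ¬ q ∣ p := not_dvd_of_prime_ne hq hp (by rintro rfl; omega)
  have hr : (θ : E) ^ 2 = (q * p : ℕ) := coe_sq_eq_natCast hθ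
  have hr' : (θ : E) ^ 2 = algebraMap k E ((q * p : ℕ) : k) := by rw [hr]; simp
  have hfin := finrank_of_sq_eq hr' hsq htop
  have h3 := card_two_torsion_le_of_quadratic hfin
    (fun c hc => classGroup_sqrt_two_two_torsion hw hk not_isSquare_two_rat c hc)
    (placesAbove_finite k (mul_ne_zero four_ne_zero (mul_ne_zero hq.ne_zero hp.ne_zero)))
    (comap_selmer_le_of_sq htop hθ) hr' hsq
  have h4 : (squares kˣ).relIndex ((selmer (K := E) ∅).map (unitsNorm k E)) = 1 :=
    Subgroup.relIndex_eq_one.2 fun y hy => norm_mem_squares hw hk not_isSquare_two_rat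
      (legendreSym_neg_one_of_mod_four (by omega)) (by omega)
      (legendreSym_two_of_mod_eight hq8) hqp (not_isSquare_prime_mul_rat hq hqp) hsq hr hy
  have h5 := finrank_rat_of_sqrt_two hw hk
  have h6 := ncard_placesAbove_mul_le_add k q p
  have h6' := ncard_placesAbove_mul_le_add k 4 (q * p)
  rw [placesAbove_four] at h6'
  have h7 := ncard_placesAbove_le_of_inert hw hp (Or.inr hp8)
  have h8 := ncard_placesAbove_le (K := k) hq
  have h8' := ncard_placesAbove_two_le hw
  rw [finrank_rat_of_quadratic hfin, h4, h5] at h3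
  rw [h5] at h7 h8 h8'
  have h9 : 2 ^ (placesAbove k (4 * (q * p))).ncard ≤ 2 ^ 4 :=
    Nat.pow_le_pow_right two_pos (by omega)
  omega

end biquadratic

theorem card_two_torsion_le_four {F K : Type*} [Field F] [NumberField F] [IsTotallyReal F]
    [Field K] [NumberField K] [IsTotallyReal K] [Algebra F K]
    (hF : ∀ c : ClassGroup (𝓞 F), c ^ 2 = 1 → c = 1) (hF4 : Module.finrank ℚ F = 4)
    {w : 𝓞 F} (hw : w ^ 2 = 2) {m : ℕ} (hm : Odd m) {θ : 𝓞 F} (hθ : θ ^ 2 = θ + m)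
    {p q s : ℕ} (hp : p.Prime) (hq : q.Prime) (hs : s.Prime) (hqs : q ≠ s) (hp8 : p % 8 = 5)
    {a b : 𝓞 K} (ha : a ^ 2 = (q * p : ℕ)) (hb : b ^ 2 = (s * p : ℕ))
    (hatop : F⟮(a : K)⟯ = ⊤) (hbtop : F⟮(b : K)⟯ = ⊤) (hsq : ¬ IsSquare ((q * p : ℕ) : F)) :
    Nat.card (powMonoidHom 2 : ClassGroup (𝓞 K) →* ClassGroup (𝓞 K)).ker ≤ 4 := by
  have hr : (a : K) ^ 2 = algebraMap F K ((q * p : ℕ) : F) := by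
    rw [coe_sq_eq_natCast ha]; simp
  have hfin := finrank_of_sq_eq hr hsq hatop
  have hB : (selmer (K := K) ∅).comap (unitsIncl F K) ≤ selmer (placesAbove F (2 * p)) := by
    intro x hx v hv
    by_cases hvq : v ∈ placesAbove F (4 * (q * p))
    · refine comap_selmer_le_of_sq hbtop hb hx v fun hvs => hv ?_
      simp only [placesAbove_mul, placesAbove_four, Set.mem_union] at hvq hvs ⊢
      have hcop : ¬ (v ∈ placesAbove F q ∧ v ∈ placesAbove F s) := by
        rintro ⟨h1, h2⟩
        have h3 : (Nat.gcd q s : ℤ) = 1 := by exact_mod_cast (Nat.coprime_primes hq hs).2 hqs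
        rw [Nat.gcd_eq_gcd_ab] at h3
        refine v.isPrime.ne_top ((Ideal.eq_top_iff_one _).2 ?_)
        have h4 := congrArg (Int.cast : ℤ → 𝓞 F) h3
        push_cast at h4
        rw [← h4]
        exact add_mem (Ideal.mul_mem_right _ _ h1) (Ideal.mul_mem_right _ _ h2)
      tauto
    · exact comap_selmer_le_of_sq hatop ha hx v hvq
  have h3 := card_two_torsion_le_of_quadratic hfin hF
    (placesAbove_finite F (mul_ne_zero two_ne_zero hp.ne_zero)) hB hr hsq
  have h4 : (squares Fˣ).relIndex ((selmer (K := K) ∅).map (unitsNorm F K)) ≤ 2 ^ 4 := by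
    have h5 := relIndex_squares_selmer_empty_le hF
    rw [hF4] at h5
    rw [← h5]
    exact Subgroup.relIndex_le_of_le_right (map_unitsNorm_selmer_le F K) (by rw [h5]; norm_num)
  have h6 := ncard_placesAbove_mul_le_add F 2 p
  have h7 := ncard_placesAbove_le_of_inert hw hp (Or.inr hp8)
  have h8 := ncard_placesAbove_two_le_of_inert hw hm hθ
  rw [finrank_rat_of_quadratic hfin, hF4] at h3
  rw [hF4] at h7 h8
  have h9 : 2 ^ (placesAbove F (2 * p)).ncard ≤ 2 ^ 3 :=
    Nat.pow_le_pow_right two_pos (by omega)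
  have h10 := Nat.mul_le_mul (Nat.mul_le_mul h9 (le_refl (2 ^ 4))) h4
  omega

theorem isKleinFour_sylow {G : Type*} [CommGroup G] [Finite G] {z g : G}
    (hcard : Nat.card (powMonoidHom 2 : G →* G).ker ≤ 4) (hz : z ^ 2 = 1)
    (hsq : ∀ c : G, (∃ n : ℕ, c ^ 2 ^ n = 1) → c ^ 2 = 1 ∨ c ^ 2 = z)
    (hz' : ¬ IsSquare z) (hg : ¬ IsSquare g) (hgz : ¬ IsSquare (g * z)) (P : Sylow 2 G) :
    IsKleinFour P.toSubgroup := by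
  have h1 : ∀ c : G, (∃ n : ℕ, c ^ 2 ^ n = 1) → c ^ 2 = 1 := fun c hc =>
    (hsq c hc).resolve_right fun h => hz' ⟨c, by rw [← h, sq]⟩
  have hP : P.toSubgroup = (powMonoidHom 2 : G →* G).ker := by
    refine (P.is_maximal' ?_ ?_).symm
    · rw [IsPGroup.iff_orderOf]
      rintro ⟨x, hx⟩
      have hx2 : x ^ 2 = 1 := hx
      have h2 : orderOf (⟨x, hx⟩ : (powMonoidHom 2 : G →* G).ker) ∣ 2 ^ 1 :=
        orderOf_dvd_of_pow_eq_one (Subtype.ext (by simpa using hx2))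
      obtain ⟨j, -, hj⟩ := (Nat.dvd_prime_pow Nat.prime_two).1 h2
      exact ⟨j, hj⟩
    · intro x hx
      obtain ⟨n, hn⟩ := P.isPGroup' ⟨x, hx⟩
      exact h1 x ⟨n, congrArg Subtype.val hn⟩
  have hmem : ∀ x : G, x ∈ P.toSubgroup ↔ x ^ 2 = 1 := fun x => by rw [hP]; rfl
  obtain ⟨a, m, hm, ham⟩ := Nat.exists_eq_two_pow_mul_odd (n := Nat.card G) Nat.card_pos.ne'
  obtain ⟨i, hi⟩ := hm
  have hj : (g ^ m) ^ 2 = 1 := h1 _ ⟨a, by rw [← pow_mul, mul_comm, ← ham, pow_card_eq_one']⟩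
  have hgm : g = g ^ m * ((g⁻¹) ^ i * (g⁻¹) ^ i) := by
    rw [hi, inv_pow, pow_succ, two_mul, pow_add]
    group
  set j := g ^ m
  have hz1 : z ≠ 1 := fun h => hz' ⟨1, by simp [h]⟩
  have hj1 : j ≠ 1 := fun h => hg ⟨(g⁻¹) ^ i, by rw [h, one_mul] at hgm; exact hgm⟩
  have hjz : j ≠ z := fun h => hgz ⟨z * (g⁻¹) ^ i, by
    calc g * z = j * ((g⁻¹) ^ i * (g⁻¹) ^ i) * z := congrArg (· * z) hgm
      _ = z * ((g⁻¹) ^ i * (g⁻¹) ^ i) * z := by rw [h]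
      _ = z * (g⁻¹) ^ i * (z * (g⁻¹) ^ i) := by
        generalize (g⁻¹) ^ i = v
        ac_rfl⟩
  have hzz : z * z = 1 := by rw [← sq, hz]
  have hjj : j * j = 1 := by rw [← sq, hj]
  have hle : 4 ≤ Nat.card P.toSubgroup := by
    classical
    have hfin : ({1, z, j, j * z} : Finset G).card = 4 := by
      have h3 : j * z ≠ 1 := fun h => hjz (by rw [← mul_one j, ← hzz, ← mul_assoc, h, one_mul])
      have h4 : j * z ≠ z := fun h => hj1 (by simpa using h)
      have h5 : j * z ≠ j := fun h => hz1 (by simpa using h)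
      rw [Finset.card_eq_succ_iff_cons.2 ⟨1, {z, j, j * z}, by simp [hz1.symm, hj1.symm, h3.symm],
        by simp, ?_⟩]
      rw [Finset.card_eq_three]
      exact ⟨z, j, j * z, hjz.symm, h4.symm, h5.symm, rfl⟩
    rw [← hfin, ← Set.ncard_coe_finset]
    refine Set.ncard_le_ncard (t := (P.toSubgroup : Set G)) ?_
    intro x hx
    simp only [Finset.coe_insert, Finset.coe_singleton, Set.mem_insert_iff,
      Set.mem_singleton_iff] at hx
    rw [SetLike.mem_coe, hmem]
    rcases hx with rfl | rfl | rfl | rfl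
    · simp
    · exact hz
    · exact hj
    · rw [mul_pow, hj, hz, one_mul]
  refine ⟨le_antisymm (by rw [hP]; exact hcard) hle, ?_⟩
  have h6 : Monoid.exponent P.toSubgroup ∣ 2 := Monoid.exponent_dvd_of_forall_pow_eq_one
    fun x => Subtype.ext ((hmem x).1 x.2)
  rcases (Nat.dvd_prime Nat.prime_two).1 h6 with h | h
  · rw [Monoid.exp_eq_one_iff] at h
    have := Finite.card_le_one_iff_subsingleton.2 h
    omega
  · exact h

theorem nonempty_mulEquiv_of_isKleinFour {G : Type*} [Group G] [IsKleinFour G] :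
    Nonempty (G ≃* Multiplicative (ZMod 2 × ZMod 2)) := IsKleinFour.nonempty_mulEquiv

theorem legendreSym_eq_one_of_mk0_eq_sq {E : Type*} [Field E] [NumberField E] {l d : ℕ}
    [Fact l.Prime] (h1 : legendreSym l (-1) = 1) (hld : ¬ l ∣ d) {r : E} (hr : r ^ 2 = (l * d : ℕ))
    {I : (Ideal (𝓞 E))⁰} {u t : ℕ} (hI : Ideal.absNorm (I : Ideal (𝓞 E)) = u * t ^ 2)
    (hlu : ¬ l ∣ u) (hc : IsSquare (ClassGroup.mk0 I)) : legendreSym l u = 1 := by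
  obtain ⟨c, hc⟩ := hc
  obtain ⟨J, rfl⟩ := ClassGroup.mk0_surjective c
  rw [← map_mul, ClassGroup.mk0_eq_mk0_iff] at hc
  obtain ⟨x, y, hx, hy, hxy⟩ := hc
  have h2 := congrArg Ideal.absNorm hxy
  simp only [map_mul, Submonoid.coe_mul, Ideal.absNorm_span_singleton, hI] at h2
  have hx0 : Algebra.norm ℤ x ≠ 0 := by rwa [Algebra.norm_ne_zero_iff]
  have hy0 : Algebra.norm ℤ y ≠ 0 := by rwa [Algebra.norm_ne_zero_iff]
  have hJ0 : Ideal.absNorm (J : Ideal (𝓞 E)) ≠ 0 := Ideal.absNorm_ne_zero_of_nonZeroDivisors J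
  set nJ := Ideal.absNorm (J : Ideal (𝓞 E))
  obtain ⟨ε, hε, h3⟩ : ∃ ε : ℤ, (ε = 1 ∨ ε = -1) ∧
      ε * Algebra.norm ℤ x * (u * t ^ 2) = Algebra.norm ℤ y * nJ ^ 2 := by
    have h4 : ((Algebra.norm ℤ x).natAbs : ℤ) * (u * t ^ 2) =
        ((Algebra.norm ℤ y).natAbs : ℤ) * nJ ^ 2 := by
      rw [sq (nJ : ℤ)]
      exact_mod_cast h2
    rcases Int.natAbs_eq (Algebra.norm ℤ x) with hx' | hx' <;>
    rcases Int.natAbs_eq (Algebra.norm ℤ y) with hy' | hy'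
    · exact ⟨1, Or.inl rfl, by rw [hx', hy']; linear_combination h4⟩
    · exact ⟨-1, Or.inr rfl, by rw [hx', hy']; linear_combination -h4⟩
    · exact ⟨-1, Or.inr rfl, by rw [hx', hy']; linear_combination h4⟩
    · exact ⟨1, Or.inl rfl, by rw [hx', hy']; linear_combination -h4⟩
  obtain ⟨a, b, hab⟩ := exists_norm_eq_sq_sub_mul_sq (k := ℚ) (K := E) (r := r)
    (d := ((l * d : ℕ) : ℚ)) (by rw [hr]; simp)
    (not_isSquare_prime_mul_rat (Fact.out : l.Prime) hld) ((x : E) * y)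
  have h5 : Algebra.norm ℚ ((x : E) * y) =
      ((Algebra.norm ℤ x : ℤ) : ℚ) * ((Algebra.norm ℤ y : ℤ) : ℚ) := by
    rw [map_mul, Algebra.coe_norm_int, Algebra.coe_norm_int]
  have hx0' : ((Algebra.norm ℤ x : ℤ) : ℚ) ≠ 0 := by exact_mod_cast hx0
  have hJ0' : (nJ : ℚ) ≠ 0 := by exact_mod_cast hJ0
  have ht0 : (t : ℚ) ≠ 0 := by
    intro h
    have : t = 0 := by exact_mod_cast h
    rw [this] at hI
    exact Ideal.absNorm_ne_zero_of_nonZeroDivisors I (by rw [hI]; simp)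
  have h6 : (ε : ℚ) * (Algebra.norm ℤ x : ℤ) * (u * t ^ 2) = (Algebra.norm ℤ y : ℤ) * nJ ^ 2 := by
    exact_mod_cast h3
  have hlε : legendreSym l ε = 1 := by
    rcases hε with rfl | rfl
    · simp
    · exact h1
  have hlZ : Prime (l : ℤ) := Nat.prime_iff_prime_int.1 Fact.out
  have h7 := legendreSym_eq_one_of_rat (p := l) (u := ε * u) (d := d)
    (y := (Algebra.norm ℤ x : ℤ) * t / nJ) (a := a) (b := b) (by
      intro h
      rcases hlZ.dvd_or_dvd h with h | h
      · rw [← ZMod.intCast_zmod_eq_zero_iff_dvd, ← legendreSym.eq_zero_iff, hlε] at h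
        exact one_ne_zero h
      · exact hlu (by exact_mod_cast h)) (by exact_mod_cast hld)
    (div_ne_zero (mul_ne_zero hx0' ht0) hJ0') (by
      have h8 : ((l * d : ℤ) : ℚ) = ((l * d : ℕ) : ℚ) := by push_cast; rfl
      rw [h8, ← hab, h5]
      push_cast
      field_simp
      linear_combination h6)
  rwa [legendreSym.mul, hlε, one_mul] at h7

theorem span_pair_sq_eq_span {R : Type*} [CommRing R] {w θ e : R} (hw : w ^ 2 = 2)
    (hθ : θ ^ 2 = w * θ + 2 * e - 1) :
    Ideal.span {w, θ - 1} ^ 2 = Ideal.span {w} := by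
  refine le_antisymm ?_ ?_
  · rw [sq, Ideal.span_pair_mul_span_pair, Ideal.span_le]
    rintro x (rfl | rfl | rfl | rfl) <;> rw [SetLike.mem_coe, Ideal.mem_span_singleton]
    · exact dvd_mul_right _ _
    · exact dvd_mul_right _ _
    · exact dvd_mul_left _ _
    · exact ⟨θ - w * θ + w * e, by linear_combination hθ + (θ - e) * hw⟩
  · rw [Ideal.span_singleton_le_iff_mem]
    have h1 : w ∈ Ideal.span {w, θ - 1} := Ideal.subset_span (by simp)
    have h2 : θ - 1 ∈ Ideal.span {w, θ - 1} := Ideal.subset_span (by simp)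
    have h3 : w = (θ - 1) * (θ - 1) + w * w * (θ - e) - w * (θ - 1) := by
      linear_combination (-1 : R) * hθ - (θ - e) * hw
    have h4 : (θ - 1) * (θ - 1) + w * w * (θ - e) - w * (θ - 1) ∈
        Ideal.span {w, θ - 1} * Ideal.span {w, θ - 1} :=
      sub_mem (add_mem (Ideal.mul_mem_mul h2 h2) (Ideal.mul_mem_right _ _ (Ideal.mul_mem_mul h1 h1)))
        (Ideal.mul_mem_mul h1 h2)
    rw [sq]
    rwa [← h3] at h4

/-- An inclusion of nonzero ideals of equal absolute norm is an equality. -/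
theorem eq_of_le_of_absNorm_eq {K : Type*} [Field K] [NumberField K] {I J : Ideal (𝓞 K)}
    (hJ : J ≠ ⊥) (hle : I ≤ J) (h : Ideal.absNorm I = Ideal.absNorm J) : I = J := by
  obtain ⟨M, rfl⟩ := Ideal.dvd_iff_le.mpr hle
  rw [map_mul] at h
  have h1 : Ideal.absNorm M = 1 :=
    Nat.eq_of_mul_eq_mul_left (Nat.pos_of_ne_zero (mt Ideal.absNorm_eq_zero_iff.mp hJ))
      (by rw [h, mul_one])
  rw [Ideal.absNorm_eq_one_iff.mp h1, Ideal.mul_top]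

theorem absNorm_map_mapRingEquiv {K : Type*} [Field K] [NumberField K] (e : K ≃+* K)
    (J : Ideal (𝓞 K)) :
    Ideal.absNorm (J.map (RingOfIntegers.mapRingEquiv e)) = Ideal.absNorm J := by
  rw [Ideal.absNorm_apply, Ideal.absNorm_apply, Submodule.cardQuot_apply, Submodule.cardQuot_apply]
  exact Nat.card_congr (Ideal.quotientEquiv J _ (RingOfIntegers.mapRingEquiv e) rfl).symm.toEquiv

/-- In a quadratic extension with nontrivial automorphism `e`, the extension of the relative
norm of an ideal is the product of its conjugates. -/
theorem map_relNorm_eq {D K : Type*} [Field D] [NumberField D] [Field K] [NumberField K]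
    [Algebra D K] (h2 : Module.finrank D K = 2) (e : K ≃+* K)
    (hN : ∀ x : K, algebraMap D K (Algebra.norm D x) = x * e x) (J : Ideal (𝓞 K)) :
    (Ideal.relNorm (𝓞 D) J).map (algebraMap (𝓞 D) (𝓞 K)) =
      J * J.map (RingOfIntegers.mapRingEquiv e) := by
  rcases eq_or_ne J ⊥ with rfl | hJ
  · rw [Ideal.relNorm_bot, Ideal.map_bot, Ideal.bot_mul]
  have hJ' : J.map (RingOfIntegers.mapRingEquiv e) ≠ ⊥ := by
    intro h
    apply hJ
    rw [← Ideal.absNorm_eq_zero_iff, ← absNorm_map_mapRingEquiv e, h, Ideal.absNorm_bot]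
  refine eq_of_le_of_absNorm_eq (mul_ne_zero hJ hJ') ?_ ?_
  · rw [Ideal.relNorm_apply, Ideal.map_span, Ideal.span_le]
    rintro _ ⟨_, ⟨x, hx, rfl⟩, rfl⟩
    have : algebraMap (𝓞 D) (𝓞 K) (Algebra.intNorm (𝓞 D) (𝓞 K) x) =
        x * RingOfIntegers.mapRingEquiv e x := by
      apply RingOfIntegers.ext
      change algebraMap D K (algebraMap (𝓞 D) D _) = (x : K) * e x
      rw [← hN]
      rw [Algebra.algebraMap_intNorm (A := 𝓞 D) (K := D) (L := K) (B := 𝓞 K)]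
    rw [SetLike.mem_coe, this]
    exact Ideal.mul_mem_mul hx (Ideal.mem_map_of_mem _ hx)
  · rw [Ideal.absNorm_algebraMap, Ideal.absNorm_relNorm, map_mul, absNorm_map_mapRingEquiv,
      ← IsFractionRing.finrank_eq (𝓞 D) D (𝓞 K) K, h2, sq]

theorem mk0_eq_mk0_of_map {R S : Type*} [CommRing R] [IsDedekindDomain R] [CommRing S]
    [IsDedekindDomain S] {f : R →+* S} (hf : Function.Injective f) {I I' : (Ideal R)⁰}
    {J J' : (Ideal S)⁰} (hJ : (J : Ideal S) = (I : Ideal R).map f)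
    (hJ' : (J' : Ideal S) = (I' : Ideal R).map f) (h : ClassGroup.mk0 I = ClassGroup.mk0 I') :
    ClassGroup.mk0 J = ClassGroup.mk0 J' := by
  rw [ClassGroup.mk0_eq_mk0_iff] at h ⊢
  obtain ⟨x, y, hx, hy, hxy⟩ := h
  refine ⟨f x, f y, (map_ne_zero_iff f hf).mpr hx, (map_ne_zero_iff f hf).mpr hy, ?_⟩
  have := congrArg (Ideal.map f) hxy
  rwa [Ideal.map_mul, Ideal.map_mul, Ideal.map_span, Ideal.map_span, Set.image_singleton,
    Set.image_singleton, ← hJ, ← hJ'] at this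

/-- In a finite commutative group with at most two elements of exponent two, a nonsquare `z` of
exponent two generates the `2`-primary part. -/
theorem eq_one_or_eq_of_card_le_two {G : Type*} [CommGroup G] [Finite G] {z : G}
    (hcard : Nat.card (powMonoidHom 2 : G →* G).ker ≤ 2) (hz : z ^ 2 = 1) (hz' : ¬ IsSquare z)
    {c : G} (hc : ∃ n : ℕ, c ^ 2 ^ n = 1) : c = 1 ∨ c = z := by
  have key : ∀ x : G, x ^ 2 = 1 → x = 1 ∨ x = z := by
    intro x hx
    by_contra! hne
    have hz1 : z ≠ 1 := fun h ↦ hz' (h ▸ IsSquare.one)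
    have h3 : ({1, z, x} : Set G).ncard = 3 :=
      Set.ncard_eq_three.mpr ⟨1, z, x, hz1.symm, hne.1.symm, hne.2.symm, rfl⟩
    have hsub : ({1, z, x} : Set G) ⊆ ((powMonoidHom 2 : G →* G).ker : Set G) := by
      rintro y (rfl | rfl | rfl)
      · exact one_mem _
      · simpa [MonoidHom.mem_ker] using hz
      · simpa [MonoidHom.mem_ker] using hx
    have := Set.ncard_le_ncard hsub (Set.toFinite _)
    rw [h3] at this
    have h4 : ((powMonoidHom 2 : G →* G).ker : Set G).ncard ≤ 2 := hcard
    omega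
  obtain ⟨n, hn⟩ := hc
  induction n generalizing c with
  | zero => left; simpa using hn
  | succ n ih =>
    rcases ih (c := c ^ 2) (by rw [← pow_mul, ← pow_succ', hn]) with h | h
    · exact key c h
    · exact (hz' ⟨c, by rw [← h, sq]⟩).elim

theorem mk0_mul_conj_mem {D K : Type*} [Field D] [NumberField D] [Field K] [NumberField K]
    [Algebra D K] (h2 : Module.finrank D K = 2) {e : K ≃+* K}
    (hN : ∀ x : K, algebraMap D K (Algebra.norm D x) = x * e x) {A : (Ideal (𝓞 D))⁰}
    {Q : (Ideal (𝓞 K))⁰} (hQ : (Q : Ideal (𝓞 K)) = (A : Ideal (𝓞 D)).map (algebraMap _ _))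
    (hA : ∀ c : ClassGroup (𝓞 D), (∃ n : ℕ, c ^ 2 ^ n = 1) → c = 1 ∨ c = ClassGroup.mk0 A)
    {J J' : (Ideal (𝓞 K))⁰}
    (hJ' : (J' : Ideal (𝓞 K)) = (J : Ideal (𝓞 K)).map (RingOfIntegers.mapRingEquiv e))
    (hJ : ∃ n : ℕ, ClassGroup.mk0 J ^ 2 ^ n = 1) :
    ClassGroup.mk0 J * ClassGroup.mk0 J' = 1 ∨
      ClassGroup.mk0 J * ClassGroup.mk0 J' = ClassGroup.mk0 Q := by
  have hJ0 : (J : Ideal (𝓞 K)) ≠ ⊥ := nonZeroDivisors.coe_ne_zero J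
  let B : (Ideal (𝓞 D))⁰ := ⟨Ideal.relNorm (𝓞 D) (J : Ideal (𝓞 K)),
    mem_nonZeroDivisors_of_ne_zero (mt Ideal.relNorm_eq_bot_iff.mp hJ0)⟩
  have hB : ∃ n : ℕ, ClassGroup.mk0 B ^ 2 ^ n = 1 := by
    obtain ⟨n, hn⟩ := hJ
    refine ⟨n, ?_⟩
    rw [← map_pow, ClassGroup.mk0_eq_one_iff] at hn ⊢
    obtain ⟨⟨x, hx⟩⟩ := hn
    refine ⟨⟨Algebra.intNorm (𝓞 D) (𝓞 K) x, ?_⟩⟩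
    have hx' : (J : Ideal (𝓞 K)) ^ 2 ^ n = Ideal.span {x} := hx
    have := congrArg (Ideal.relNorm (𝓞 D)) hx'
    rw [map_pow, Ideal.relNorm_singleton] at this
    exact this
  have hinj : Function.Injective (algebraMap (𝓞 D) (𝓞 K)) :=
    FaithfulSMul.algebraMap_injective _ _
  have hprod : ((J * J' : (Ideal (𝓞 K))⁰) : Ideal (𝓞 K)) =
      (B : Ideal (𝓞 D)).map (algebraMap (𝓞 D) (𝓞 K)) := by
    rw [map_relNorm_eq h2 e hN, ← hJ']; rfl
  rw [← map_mul]
  refine (hA _ hB).imp (fun h ↦ ?_) fun h ↦ mk0_eq_mk0_of_map hinj hprod hQ h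
  rw [← map_one ClassGroup.mk0] at h ⊢
  refine mk0_eq_mk0_of_map hinj hprod ?_ h
  change (1 : Ideal (𝓞 K)) = (1 : Ideal (𝓞 D)).map _
  rw [Ideal.one_eq_top, Ideal.one_eq_top, Ideal.map_top]

/-- If `K` is biquadratic over a common subfield of `F`, `D`, `D'`, the class group of `F` has no
`2`-torsion and the `2`-primary parts of those of `D` and `D'` are generated by ideals extending to
`Q`, then squares of `2`-primary classes of `K` are trivial or equal to the class of `Q`. -/
theorem sq_eq_one_or_eq_of_biquadratic {F D D' K : Type*} [Field F] [NumberField F] [Field D]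
    [NumberField D] [Field D'] [NumberField D'] [Field K] [NumberField K] [Algebra F K]
    [Algebra D K] [Algebra D' K] (hF2 : Module.finrank F K = 2) (hD2 : Module.finrank D K = 2)
    (hD2' : Module.finrank D' K = 2) {σ τ ρ : K ≃+* K}
    (hσ : ∀ x : K, algebraMap F K (Algebra.norm F x) = x * σ x)
    (hτ : ∀ x : K, algebraMap D K (Algebra.norm D x) = x * τ x)
    (hρ : ∀ x : K, algebraMap D' K (Algebra.norm D' x) = x * ρ x) (hτσ : ∀ x, τ (σ x) = ρ x)
    (hF : ∀ c : ClassGroup (𝓞 F), c ^ 2 = 1 → c = 1)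
    {A : (Ideal (𝓞 D))⁰} {A' : (Ideal (𝓞 D'))⁰} {Q : (Ideal (𝓞 K))⁰}
    (hQ : (Q : Ideal (𝓞 K)) = (A : Ideal (𝓞 D)).map (algebraMap _ _))
    (hQ' : (Q : Ideal (𝓞 K)) = (A' : Ideal (𝓞 D')).map (algebraMap _ _))
    (hA : ∀ c : ClassGroup (𝓞 D), (∃ n : ℕ, c ^ 2 ^ n = 1) → c = 1 ∨ c = ClassGroup.mk0 A)
    (hA' : ∀ c : ClassGroup (𝓞 D'), (∃ n : ℕ, c ^ 2 ^ n = 1) → c = 1 ∨ c = ClassGroup.mk0 A')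
    (hQ2 : ClassGroup.mk0 Q ^ 2 = 1) {c : ClassGroup (𝓞 K)} (hc : ∃ n : ℕ, c ^ 2 ^ n = 1) :
    c ^ 2 = 1 ∨ c ^ 2 = ClassGroup.mk0 Q := by
  obtain ⟨J, rfl⟩ := ClassGroup.mk0_surjective c
  have hinj (e : K ≃+* K) : Function.Injective (RingOfIntegers.mapRingEquiv e : 𝓞 K →+* 𝓞 K) :=
    (RingOfIntegers.mapRingEquiv e).injective
  have hconj (e : K ≃+* K) : ∃ J' : (Ideal (𝓞 K))⁰, (J' : Ideal (𝓞 K)) =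
      (J : Ideal (𝓞 K)).map (RingOfIntegers.mapRingEquiv e) :=
    ⟨⟨_, mem_nonZeroDivisors_of_ne_zero fun h ↦ nonZeroDivisors.coe_ne_zero J
      ((Ideal.map_eq_bot_iff_of_injective (hinj e)).mp h)⟩, rfl⟩
  obtain ⟨Jσ, hJσ⟩ := hconj σ
  obtain ⟨Jτ, hJτ⟩ := hconj τ
  obtain ⟨Jρ, hJρ⟩ := hconj ρ
  have h1 : ClassGroup.mk0 J * ClassGroup.mk0 Jσ = 1 := by
    have hF' : ∀ c : ClassGroup (𝓞 F), (∃ n : ℕ, c ^ 2 ^ n = 1) →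
        c = 1 ∨ c = ClassGroup.mk0 1 := by
      rintro c ⟨n, hn⟩
      left
      induction n generalizing c with
      | zero => simpa using hn
      | succ n ih => exact hF _ (ih _ (by rw [← pow_mul, ← pow_succ', hn]))
    have := mk0_mul_conj_mem hF2 hσ (A := 1) (Q := 1)
      (by change (1 : Ideal (𝓞 K)) = (1 : Ideal (𝓞 F)).map _
          rw [Ideal.one_eq_top, Ideal.one_eq_top, Ideal.map_top]) hF' hJσ hc
    simpa using this
  have h2 := mk0_mul_conj_mem hD2 hτ hQ hA hJτ hc
  have h3 := mk0_mul_conj_mem hD2' hρ hQ' hA' hJρ hc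
  have h4 : ClassGroup.mk0 Jτ * ClassGroup.mk0 Jρ = 1 := by
    rw [← map_mul, ← map_one ClassGroup.mk0] at h1 ⊢
    refine mk0_eq_mk0_of_map (hinj τ) ?_ ?_ h1
    · rw [Submonoid.coe_mul, Submonoid.coe_mul, Ideal.map_mul, hJτ, hJρ, hJσ]
      congr 1
      refine Eq.trans ?_ (Ideal.map_map (RingOfIntegers.mapRingEquiv σ : 𝓞 K →+* 𝓞 K)
        (RingOfIntegers.mapRingEquiv τ : 𝓞 K →+* 𝓞 K)).symm
      change Ideal.map (RingOfIntegers.mapRingEquiv ρ : 𝓞 K →+* 𝓞 K) _ = _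
      congr 1
      ext x
      exact (hτσ x).symm
    · change (1 : Ideal (𝓞 K)) = (1 : Ideal (𝓞 K)).map _
      rw [Ideal.one_eq_top, Ideal.map_top]
  have h5 : ClassGroup.mk0 J ^ 2 =
      (ClassGroup.mk0 J * ClassGroup.mk0 Jτ) * (ClassGroup.mk0 J * ClassGroup.mk0 Jρ) := by
    rw [mul_mul_mul_comm, h4, mul_one, sq]
  rw [h5]
  rcases h2 with h2 | h2 <;> rcases h3 with h3 | h3 <;> rw [h2, h3]
  · simp
  · simp
  · simp
  · left; rw [← sq, hQ2]

theorem exists_conj_of_finrank_eq_two {E K : Type*} [Field E] [Field K] [CharZero E] [Algebra E K]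
    (h2 : Module.finrank E K = 2) : ∃ e : K ≃+* K,
      (∀ x : K, algebraMap E K (Algebra.norm E x) = x * e x) ∧
      (∀ x : E, e (algebraMap E K x) = algebraMap E K x) ∧
      ∀ (r : K) (d : E), r ^ 2 = algebraMap E K d → ¬ IsSquare d → e r = -r := by
  have : Algebra.IsQuadraticExtension E K := { finrank_eq_two' := h2 }
  have hfin : FiniteDimensional E K := Module.finite_of_finrank_pos (by omega)
  have : IsGalois E K := inferInstance
  classical
  have hcard : Nat.card Gal(K/E) = 2 := by rw [IsGalois.card_aut_eq_finrank, h2]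
  obtain ⟨x, y, hxy, huniv⟩ := Nat.card_eq_two_iff.mp hcard
  obtain ⟨e, he⟩ : ∃ e : Gal(K/E), e ≠ 1 := by
    by_cases hx : x = 1
    · exact ⟨y, fun h ↦ hxy (hx.trans h.symm)⟩
    · exact ⟨x, hx⟩
  have hall : ∀ f : Gal(K/E), f = 1 ∨ f = e := by
    have key : ∀ f : Gal(K/E), f = x ∨ f = y := fun f ↦ by
      have : f ∈ ({x, y} : Set _) := huniv ▸ Set.mem_univ f
      simpa using this
    intro f
    rcases key f with rfl | rfl <;> rcases key e with h | h <;> rcases key 1 with h' | h' <;> grind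
  have huniv' : (Finset.univ : Finset Gal(K/E)) = {1, e} := by
    ext f
    simp only [Finset.mem_univ, Finset.mem_insert, Finset.mem_singleton, true_iff]
    exact hall f
  refine ⟨e.toRingEquiv, fun z ↦ ?_, fun z ↦ e.commutes z, fun r d hr hd ↦ ?_⟩
  · rw [Algebra.norm_eq_prod_automorphisms, huniv', Finset.prod_pair he.symm]
    rfl
  · have h1 : (e r) ^ 2 = r ^ 2 := by rw [← map_pow, hr, e.commutes]
    rcases sq_eq_sq_iff_eq_or_eq_neg.mp h1 with h | h
    · exfalso
      obtain ⟨t, ht⟩ := (IsGalois.mem_range_algebraMap_iff_fixed r).mpr fun f ↦ by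
        rcases hall f with rfl | rfl
        · rfl
        · exact h
      apply hd
      refine ⟨t, (algebraMap E K).injective ?_⟩
      rw [← hr, ← ht, map_mul, sq]
    · exact h

theorem ringHom_ext_of_adjoin_eq_top {K E : Type*} [Field K] [CharZero K] [Field E] [CharZero E]
    {S : Set K} (htop : IntermediateField.adjoin ℚ S = ⊤) {f g : K →+* E}
    (h : ∀ x ∈ S, f x = g x) : f = g := by
  ext x
  have hx : x ∈ IntermediateField.adjoin ℚ S := htop ▸ IntermediateField.mem_top
  induction hx using IntermediateField.adjoin_induction with
  | mem x hx => exact h x hx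
  | algebraMap x => rw [eq_ratCast, map_ratCast, map_ratCast]
  | add x y _ _ hx hy => rw [map_add, map_add, hx, hy]
  | inv x _ hx => rw [map_inv₀, map_inv₀, hx]
  | mul x y _ _ hx hy => rw [map_mul, map_mul, hx, hy]

section SqrtTwo

variable {E : Type*} [Field E] [NumberField E] {w : 𝓞 E}

theorem exists_ideal_sq_eq_span_sqrt_two (hw : w ^ 2 = 2) {r : 𝓞 E} {d : ℕ} (hd : d % 4 = 3)
    (hr : r ^ 2 = d) : ∃ A : (Ideal (𝓞 E))⁰, (A : Ideal (𝓞 E)) ^ 2 = Ideal.span {w} := by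
  have hwK : (w : E) ^ 2 = 2 := by
    simpa using coe_sq_eq_natCast (n := 2) (by simpa using hw)
  have hw0 : (w : E) ≠ 0 := fun h ↦ by rw [h] at hwK; norm_num at hwK
  have hw0' : w ≠ 0 := fun h ↦ hw0 (by rw [h]; exact map_zero _)
  have hrK := coe_sq_eq_natCast hr
  obtain ⟨m, rfl⟩ : ∃ m, d = 4 * m + 3 := ⟨d / 4, by omega⟩
  have hθint : IsIntegral ℤ ((1 + (r : E)) / w) := by
    have : IsIntegral ℤ (((1 + (r : E)) / w) ^ 2) := by
      have h : ((1 + (r : E)) / w) ^ 2 = ((2 * (m + 1) + r : 𝓞 E) : E) := by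
        rw [div_pow, hwK]
        push_cast at hrK ⊢
        simp only [map_ofNat]
        linear_combination hrK / 2
      rw [h]
      exact RingOfIntegers.isIntegral_coe _
    exact IsIntegral.of_pow two_pos this
  obtain ⟨θ, hθ⟩ : ∃ θ : 𝓞 E, (θ : E) = (1 + (r : E)) / w := ⟨⟨_, hθint⟩, rfl⟩
  have hθ2 : θ ^ 2 = w * θ + 2 * (m + 1) - 1 := by
    apply RingOfIntegers.ext
    push_cast at hrK
    simp only [map_add, map_mul, map_ofNat, map_natCast, map_one, map_pow, map_sub, hθ]
    rw [div_pow, hwK, mul_div_cancel₀ _ hw0]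
    linear_combination hrK / 2
  have hA := span_pair_sq_eq_span hw hθ2
  refine ⟨⟨_, mem_nonZeroDivisors_of_ne_zero ?_⟩, hA⟩
  intro h
  replace h : Ideal.span {w, θ - 1} = 0 := h
  rw [h] at hA
  apply hw0'
  rw [← Ideal.span_singleton_eq_bot, ← hA]
  rw [sq, Ideal.zero_eq_bot, Ideal.bot_mul]

theorem absNorm_pow_four_of_sq_eq_span (hw : w ^ 2 = 2) {A : Ideal (𝓞 E)}
    (hA : A ^ 2 = Ideal.span {w}) : Ideal.absNorm A ^ 4 = 2 ^ Module.finrank ℚ E := by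
  have h : A ^ 4 = Ideal.span {((2 : ℕ) : 𝓞 E)} := by
    rw [show 4 = 2 * 2 from rfl, pow_mul, hA, Ideal.span_singleton_pow, hw]; norm_num
  rw [← map_pow, h, Ideal.absNorm_span_natCast, RingOfIntegers.rank]

theorem mk0_sq_eq_one_of_sq_eq_span {A : (Ideal (𝓞 E))⁰} (hw : w ^ 2 = 2)
    (hA : (A : Ideal (𝓞 E)) ^ 2 = Ideal.span {w}) : ClassGroup.mk0 A ^ 2 = 1 := by
  refine (mk0_sq_eq_one_iff A).mpr ⟨w, ?_, hA.symm⟩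
  rintro rfl
  norm_num at hw

theorem eq_one_or_eq_mk0_of_sqrt_two {p d : ℕ} (hp : p.Prime) (hp8 : p % 8 = 5) (hd : ¬ p ∣ d)
    (hE : Module.finrank ℚ E = 4) (hw : w ^ 2 = 2) {r : E} (hr : r ^ 2 = ((p * d : ℕ) : E))
    (hcard : Nat.card (powMonoidHom 2 : ClassGroup (𝓞 E) →* ClassGroup (𝓞 E)).ker ≤ 2)
    {A : (Ideal (𝓞 E))⁰} (hA : (A : Ideal (𝓞 E)) ^ 2 = Ideal.span {w})
    (c : ClassGroup (𝓞 E)) (hc : ∃ n : ℕ, c ^ 2 ^ n = 1) : c = 1 ∨ c = ClassGroup.mk0 A := by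
  have : Fact p.Prime := ⟨hp⟩
  refine eq_one_or_eq_of_card_le_two hcard (mk0_sq_eq_one_of_sq_eq_span hw hA) (fun hsq ↦ ?_) hc
  have hN : Ideal.absNorm (A : Ideal (𝓞 E)) = 2 * 1 ^ 2 := by
    have := absNorm_pow_four_of_sq_eq_span hw hA
    rw [hE] at this
    simpa using Nat.pow_left_injective (by norm_num : 4 ≠ 0) this
  have h1 := legendreSym_eq_one_of_mk0_eq_sq
    (legendreSym_neg_one_of_mod_four_eq_one (by omega)) hd hr hN
    (fun h ↦ by have := Nat.le_of_dvd two_pos h; have := hp.two_le; interval_cases p; omega) hsq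
  have h2 := legendreSym_two_of_mod_eight_eq_five hp8
  push_cast at h1
  omega

end SqrtTwo

theorem legendreSym_natCast_eq_one {p n : ℕ} [Fact p.Prime] (hn : n ≠ 0)
    (h : ∀ l : ℕ, l.Prime → l ∣ n → legendreSym p l = 1) : legendreSym p n = 1 := by
  induction n using induction_on_primes with
  | zero => exact (hn rfl).elim
  | one => simp
  | prime_mul l m hl ih =>
    rw [Nat.cast_mul, legendreSym.mul, h l hl (dvd_mul_right l m),
      ih (right_ne_zero_of_mul hn) fun r hr hrm ↦ h r hr (hrm.mul_left l), one_mul]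

/-- Singular elements of `ℚ(√(qs))`, `q ≡ 3 mod 4`, are rational up to squares, with
ramified support. -/
theorem exists_squarefree_of_mem_selmer_sqrt {M : Type*} [Field M] [NumberField M] {q d m : ℕ}
    [Fact q.Prime] (hq : legendreSym q (-1) = -1) (hqd : ¬ q ∣ d) (hM : Module.finrank ℚ M = 2)
    {r : M} (hr : r ^ 2 = ((q * d : ℕ) : M)) (hsq : ¬ IsSquare ((q * d : ℕ) : ℚ)) {θ : 𝓞 M}
    (hθ : ℚ⟮(θ : M)⟯ = ⊤) (hθ2 : θ ^ 2 = θ + m) (hm : 4 * m + 1 = q * d) {x : Mˣ}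
    (hx : x ∈ selmer (K := M) ∅) :
    ∃ (n : ℕ) (t : M), Squarefree n ∧ (∀ l : ℕ, l.Prime → l ∣ n → l ∣ q * d) ∧
      ((x : M) = n * t ^ 2 ∨ (x : M) = -(n * t ^ 2)) := by
  have hnorm : unitsNorm ℚ M x ∈ squares ℚˣ := by
    obtain ⟨y, hy⟩ := norm_eq_of_mem_selmer_empty hx
    have hy0 : y ≠ 0 := by
      rintro rfl
      rcases hy with h | h <;> simp at h
    rcases hy with h | h
    · exact mem_squares.mpr ⟨Units.mk0 y hy0, Units.ext h.symm⟩
    · exfalso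
      obtain ⟨a, b, hab⟩ := exists_norm_eq_sq_sub_mul_sq (k := ℚ) (d := ((q * d : ℕ) : ℚ))
        (by rw [hr, map_natCast]) hsq (x : M)
      have := legendreSym_eq_one_of_rat (p := q) (u := -1) (d := d) (a := a) (b := b) (y := y)
        (by rw [Int.dvd_neg]; exact_mod_cast (Fact.out : q.Prime).one_lt.ne' ∘ Nat.dvd_one.mp)
        (by exact_mod_cast hqd) hy0 (by rw [h] at hab; push_cast at hab ⊢; linear_combination hab)
      omega
  obtain ⟨b, y, rfl⟩ := mem_range_sup_squares_of_norm hM hnorm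
  have hb : unitsIncl ℚ M b ∈ selmer (K := M) ∅ := by
    rwa [Subgroup.mul_mem_cancel_right _ (squares_le_selmer _ (mem_squares.mpr ⟨y, rfl⟩))] at hx
  obtain ⟨n, t, hn, hdvd, h⟩ := exists_squarefree_of_sq_eq_add hθ hθ2 hb
  refine ⟨n, algebraMap ℚ M t * y, hn, fun l hl hln ↦ hm ▸ hdvd l hl hln, ?_⟩
  have hbM : ((unitsIncl ℚ M b : Mˣ) : M) = algebraMap ℚ M b := rfl
  rcases h with h | h
  · left
    rw [Units.val_mul, hbM, h, Units.val_pow_eq_pow_val, map_mul, map_pow, map_natCast]; ring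
  · right
    rw [Units.val_mul, hbM, h, Units.val_pow_eq_pow_val, map_neg, map_mul, map_pow, map_natCast]
    ring

/-- The ideal above `√2` with square `(√2)` is not a square class in a quartic extension of
`ℚ(√(qs))` containing `√(pq)`. -/
theorem not_isSquare_mk0_of_sq_eq_span {M K : Type*} [Field M] [NumberField M] [Field K]
    [NumberField K] [Algebra M K] {p q s m : ℕ} (hp : p.Prime) (hq : q.Prime) (hs : s.Prime)
    (hpq : p ≠ q) (hqs : q ≠ s) (hp8 : p % 8 = 5) (hq8 : q % 8 = 7)
    (hlq : ∀ _ : Fact p.Prime, legendreSym p q = 1) (hls : ∀ _ : Fact p.Prime, legendreSym p s = 1)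
    (hM : Module.finrank ℚ M = 2) (hK : Module.finrank M K = 4) {r : M}
    (hr : r ^ 2 = ((q * s : ℕ) : M)) (hrtop : ℚ⟮r⟯ = ⊤)
    {θ : 𝓞 M} (hθ : ℚ⟮(θ : M)⟯ = ⊤) (hθ2 : θ ^ 2 = θ + m) (hm : 4 * m + 1 = q * s)
    {a : K} (ha : a ^ 2 = ((p * q : ℕ) : K)) (hsq : ¬ IsSquare ((p * q : ℕ) : M))
    {w : 𝓞 K} (hw : w ^ 2 = 2) {Q : (Ideal (𝓞 K))⁰}
    (hQ : (Q : Ideal (𝓞 K)) ^ 2 = Ideal.span {w}) : ¬ IsSquare (ClassGroup.mk0 Q) := by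
  have hpF : Fact p.Prime := ⟨hp⟩
  have hqF : Fact q.Prime := ⟨hq⟩
  rintro ⟨c, hc⟩
  obtain ⟨J, rfl⟩ := ClassGroup.mk0_surjective c
  rw [← map_mul, ClassGroup.mk0_eq_mk0_iff] at hc
  obtain ⟨x, y, hx, hy, hxy⟩ := hc
  have hNQ : Ideal.relNorm (𝓞 M) (Q : Ideal (𝓞 K)) = Ideal.span {2} := by
    refine pow_left_injective (n := 4) (by norm_num) ?_
    have hQ4 : (Q : Ideal (𝓞 K)) ^ 4 = (Ideal.span {(2 : 𝓞 M)}).map (algebraMap (𝓞 M) (𝓞 K)) := by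
      rw [show 4 = 2 * 2 from rfl, pow_mul, hQ, Ideal.span_singleton_pow, hw, Ideal.map_span,
        Set.image_singleton, map_ofNat]
    change _ ^ 4 = _ ^ 4
    rw [← map_pow, hQ4, Ideal.relNorm_algebraMap, ← IsFractionRing.finrank_eq (𝓞 M) M (𝓞 K) K, hK]
  let X : 𝓞 M := 2 * Algebra.intNorm (𝓞 M) (𝓞 K) (x * y)
  have hX0 : X ≠ 0 := mul_ne_zero two_ne_zero (Algebra.intNorm_ne_zero.mpr (mul_ne_zero hx hy))
  have hspan : Ideal.span {X} = (Ideal.span {Algebra.intNorm (𝓞 M) (𝓞 K) y} *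
      Ideal.relNorm (𝓞 M) (J : Ideal (𝓞 K))) ^ 2 := by
    have h := congrArg (Ideal.relNorm (𝓞 M)) hxy
    rw [Submonoid.coe_mul, map_mul, map_mul, map_mul, Ideal.relNorm_singleton,
      Ideal.relNorm_singleton, hNQ] at h
    rw [show X = Algebra.intNorm (𝓞 M) (𝓞 K) x * 2 * Algebra.intNorm (𝓞 M) (𝓞 K) y by
      simp only [X, map_mul]; ring, ← Ideal.span_singleton_mul_span_singleton,
      ← Ideal.span_singleton_mul_span_singleton, h]
    ring
  have hXM : (X : M) = 2 * Algebra.norm M ((x * y : 𝓞 K) : K) := by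
    rw [← Algebra.algebraMap_intNorm (A := 𝓞 M) (K := M) (L := K) (B := 𝓞 K)]
    simp only [X, map_mul]; rfl
  have hXM0 : (X : M) ≠ 0 := RingOfIntegers.coe_ne_zero_iff.mpr hX0
  have hsel := mem_selmer_empty_of_span_eq_sq (x := Units.mk0 (X : M) hXM0) hX0 hspan rfl
  have hqs' : ¬ q ∣ s := not_dvd_of_prime_ne hq hs hqs
  obtain ⟨n, t, hn, hdvd, hnt⟩ := exists_squarefree_of_mem_selmer_sqrt
    (legendreSym_neg_one_of_mod_four (by omega)) hqs' hM hr
    (not_isSquare_prime_mul_rat hq hqs') hθ hθ2 hm hsel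
  rw [Units.val_mk0] at hnt
  have hlegn : ∀ l : ℕ, l.Prime → l ∣ n → legendreSym p l = 1 := by
    intro l hl hln
    rcases (Nat.Prime.dvd_mul hl).mp (hdvd l hl hln) with h | h
    · rw [(Nat.prime_dvd_prime_iff_eq hl hq).mp h]; exact hlq hpF
    · rw [(Nat.prime_dvd_prime_iff_eq hl hs).mp h]; exact hls hpF
  have hln : legendreSym p n = 1 := legendreSym_natCast_eq_one hn.ne_zero hlegn
  obtain ⟨α, β, hαβ⟩ := exists_norm_eq_sq_sub_mul_sq (k := M) (d := ((p * q : ℕ) : M))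
    (by rw [ha, map_natCast]) hsq ((x * y : 𝓞 K) : K)
  obtain ⟨f⟩ : Nonempty (M →+* ℚ_[p]) := by
    refine nonempty_ringHom_of_adjoin_eq_top hrtop ?_
    rintro _ rfl
    refine ⟨(q * s : ℕ), by exact_mod_cast hr, ?_⟩
    obtain ⟨t, ht⟩ := exists_padic_sqrt (p := p) (u := (q * s : ℕ)) (by omega)
      (by rw [Nat.cast_mul, legendreSym.mul, hlq hpF, hls hpF, one_mul])
    exact ⟨t, by exact_mod_cast congrArg (fun z : ℤ_[p] ↦ (z : ℚ_[p])) ht⟩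
  have ht0 : f t ≠ 0 := by
    rw [map_ne_zero]
    rintro rfl
    apply hXM0
    rcases hnt with h | h <;> simpa using h
  have hpn : ¬ p ∣ n := fun h ↦ by
    have := hlegn p hp h
    rw [(legendreSym.eq_zero_iff p p).mpr (by simp)] at this
    exact zero_ne_one this
  have hp2 : ¬ p ∣ 2 := fun h ↦ by
    have := (Nat.prime_dvd_prime_iff_eq hp Nat.prime_two).mp h
    omega
  have hp2n : ¬ (p : ℤ) ∣ 2 * n := by
    exact_mod_cast fun h ↦ ((Nat.Prime.dvd_mul hp).mp h).elim hp2 hpn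
  have hpq' : ¬ (p : ℤ) ∣ q := by exact_mod_cast not_dvd_of_prime_ne hp hq hpq
  rw [hαβ] at hXM
  have h2 := legendreSym_two_of_mod_eight_eq_five hp8
  have hneg := legendreSym_neg_one_of_mod_four_eq_one (l := p) (by omega)
  rcases hnt with h | h
  · have h1 : legendreSym p (2 * n) = 1 := by
      refine legendreSym_eq_one_of_padic (d := q) (a := f (2 * α)) (b := f (2 * β)) hp2n hpq' ht0 ?_
      have := congrArg f (h.symm.trans hXM)
      simp only [map_mul, map_pow, map_sub, map_natCast, map_ofNat] at this ⊢
      push_cast at this ⊢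
      linear_combination 2 * this
    rw [legendreSym.mul, h2, hln] at h1
    omega
  · have h1 : legendreSym p (-1 * (2 * n)) = 1 := by
      refine legendreSym_eq_one_of_padic (d := q) (a := f (2 * α)) (b := f (2 * β))
        (by rwa [neg_one_mul, Int.dvd_neg]) hpq' ht0 ?_
      have := congrArg f (h.symm.trans hXM)
      simp only [map_mul, map_pow, map_sub, map_natCast, map_ofNat, map_neg] at this ⊢
      push_cast at this ⊢
      linear_combination 2 * this
    rw [legendreSym.mul, legendreSym.mul, h2, hln, hneg] at h1
    omega

theorem exists_legendreSym_eq_neg_one {p : ℕ} [Fact p.Prime] (hp : p ≠ 2) :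
    ∃ a : ℕ, legendreSym p a = -1 := by
  obtain ⟨a, ha⟩ := FiniteField.exists_nonsquare (F := ZMod p) (by rwa [ZMod.ringChar_zmod_n])
  refine ⟨a.val, (legendreSym.eq_neg_one_iff p).mpr ?_⟩
  simpa using ha

theorem legendreSym_congr {p a b : ℕ} [Fact p.Prime] (h : a ≡ b [MOD p]) :
    legendreSym p a = legendreSym p b := by
  have : (a : ZMod p) = b := (ZMod.natCast_eq_natCast_iff a b p).mpr h
  simp only [legendreSym, Int.cast_natCast, this]

theorem coprime_of_legendreSym_eq_neg_one {p a : ℕ} [hp : Fact p.Prime]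
    (h : legendreSym p a = -1) : Nat.Coprime a p := by
  rw [Nat.coprime_comm, Nat.Prime.coprime_iff_not_dvd hp.out]
  intro hd
  have h0 : ((a : ℤ) : ZMod p) = 0 := by
    rw [Int.cast_natCast]; exact (ZMod.natCast_eq_zero_iff a p).mpr hd
  rw [(legendreSym.eq_zero_iff p a).mpr h0] at h
  norm_num at h

theorem exists_prime_legendreSym_eq_neg_one {p q s : ℕ} [hp : Fact p.Prime] [hq : Fact q.Prime]
    [hs : Fact s.Prime] (hp2 : p ≠ 2) (hq2 : q ≠ 2) (hs2 : s ≠ 2) (hpq : p ≠ q) (hps : p ≠ s)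
    (hqs : q ≠ s) : ∃ l : ℕ, l.Prime ∧ l % 8 = 1 ∧ legendreSym p l = -1 ∧ legendreSym q l = -1 ∧
      legendreSym s l = -1 := by
  obtain ⟨a, ha⟩ := exists_legendreSym_eq_neg_one hp2
  obtain ⟨b, hb⟩ := exists_legendreSym_eq_neg_one hq2
  obtain ⟨c, hc⟩ := exists_legendreSym_eq_neg_one hs2
  have h8 : ∀ r : ℕ, r.Prime → r ≠ 2 → Nat.Coprime r 8 := fun r hr hr2 ↦
    Nat.Coprime.pow_right 3 ((Nat.coprime_primes hr Nat.prime_two).mpr hr2)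
  have hcpq := (Nat.coprime_primes hp.out hq.out).mpr hpq
  have hcps := (Nat.coprime_primes hp.out hs.out).mpr hps
  have hcqs := (Nat.coprime_primes hq.out hs.out).mpr hqs
  obtain ⟨x, hxa, hxb⟩ := Nat.chineseRemainder hcpq a b
  obtain ⟨y, hyc, hy1⟩ := Nat.chineseRemainder (h8 s hs.out hs2) c 1
  have hcop : Nat.Coprime (p * q) (s * 8) :=
    (hcps.mul_right (h8 p hp.out hp2)).mul_left (hcqs.mul_right (h8 q hq.out hq2))
  obtain ⟨z, hzx, hzy⟩ := Nat.chineseRemainder hcop x y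
  have hzp : legendreSym p z = -1 :=
    (legendreSym_congr ((hzx.of_dvd (dvd_mul_right p q)).trans hxa)).trans ha
  have hzq : legendreSym q z = -1 :=
    (legendreSym_congr ((hzx.of_dvd (dvd_mul_left q p)).trans hxb)).trans hb
  have hzs : legendreSym s z = -1 :=
    (legendreSym_congr ((hzy.of_dvd (dvd_mul_right s 8)).trans hyc)).trans hc
  have hz8 : z ≡ 1 [MOD 8] := (hzy.of_dvd (dvd_mul_left 8 s)).trans hy1
  have hz8' : Nat.Coprime z 8 := by
    rw [Nat.Coprime, hz8.gcd_eq, Nat.gcd_one_left]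
  have hz : Nat.Coprime z (p * q * (s * 8)) :=
    ((coprime_of_legendreSym_eq_neg_one hzp).mul_right
      (coprime_of_legendreSym_eq_neg_one hzq)).mul_right
      ((coprime_of_legendreSym_eq_neg_one hzs).mul_right hz8')
  obtain ⟨l, -, hl, hlz⟩ := Nat.forall_exists_prime_gt_and_modEq 0
    (by have := hp.out.ne_zero; have := hq.out.ne_zero; have := hs.out.ne_zero; positivity) hz
  have hl1 := hlz.of_dvd (dvd_mul_right (p * q) (s * 8))
  have hl2 := hlz.of_dvd (dvd_mul_left (s * 8) (p * q))
  exact ⟨l, hl, (hl2.of_dvd (dvd_mul_left 8 s)).trans hz8,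
    (legendreSym_congr (hl1.of_dvd (dvd_mul_right p q))).trans hzp,
    (legendreSym_congr (hl1.of_dvd (dvd_mul_left q p))).trans hzq,
    (legendreSym_congr (hl2.of_dvd (dvd_mul_right s 8))).trans hzs⟩

theorem exists_ideal_absNorm_eq_of_padic {K : Type*} [Field K] [NumberField K] {l : ℕ}
    [hl : Fact l.Prime] (f : K →+* ℚ_[l]) :
    ∃ J : (Ideal (𝓞 K))⁰, Ideal.absNorm (J : Ideal (𝓞 K)) = l := by
  have hint (x : 𝓞 K) : f x ∈ PadicInt.subring l := by
    have h1 : IsIntegral ℤ (f x) := (RingOfIntegers.isIntegral_coe x).map f.toIntAlgHom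
    have h2 : IsIntegral ℤ_[l] (f x) := h1.tower_top
    obtain ⟨y, hy⟩ := IsIntegrallyClosed.isIntegral_iff.mp h2
    rw [← hy]
    exact y.2
  let φ : 𝓞 K →+* ℤ_[l] := (f.comp (algebraMap (𝓞 K) K)).codRestrict (PadicInt.subring l) hint
  let ψ : 𝓞 K →+* ZMod l := PadicInt.toZMod.comp φ
  have hcard : Ideal.absNorm (RingHom.ker ψ) = l := by
    rw [Ideal.absNorm_apply, Submodule.cardQuot_apply, Nat.card_congr
      (RingHom.quotientKerEquivOfSurjective (ZMod.ringHom_surjective ψ)).toEquiv, Nat.card_zmod]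
  refine ⟨⟨RingHom.ker ψ, mem_nonZeroDivisors_of_ne_zero fun h ↦ ?_⟩, hcard⟩
  rw [h, Ideal.zero_eq_bot, Ideal.absNorm_bot] at hcard
  exact hl.out.ne_zero hcard.symm

theorem legendreSym_swap_of_mod_four {l p : ℕ} [Fact l.Prime] [Fact p.Prime] (hl : l % 4 = 1)
    (hp : p ≠ 2) : legendreSym l p = legendreSym p l :=
  (legendreSym.quadratic_reciprocity_one_mod_four hl hp).symm

/-- Existence of a class whose products with squares of norm-four classes are not squares. -/
theorem exists_class_not_isSquare {K : Type*} [Field K] [NumberField K] {p q s : ℕ} (hp : p.Prime)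
    (hq : q.Prime) (hs : s.Prime) (hpq : p ≠ q) (hps : p ≠ s) (hqs : q ≠ s) (hp4 : p % 4 = 1)
    (hq2 : q ≠ 2) (hs2 : s ≠ 2) {w a b : K} (hw : w ^ 2 = 2) (ha : a ^ 2 = ((p * q : ℕ) : K))
    (hb : b ^ 2 = ((p * s : ℕ) : K)) (htop : adjoin ℚ {w, a, b} = ⊤) {Q : (Ideal (𝓞 K))⁰}
    (hQ : Ideal.absNorm (Q : Ideal (𝓞 K)) = 4) :
    ∃ g : ClassGroup (𝓞 K), ¬ IsSquare g ∧ ¬ IsSquare (g * ClassGroup.mk0 Q) := by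
  have hpF : Fact p.Prime := ⟨hp⟩
  have hqF : Fact q.Prime := ⟨hq⟩
  have hsF : Fact s.Prime := ⟨hs⟩
  have hp2 : p ≠ 2 := by omega
  obtain ⟨l, hl, hl8, hlp, hlq, hls⟩ := exists_prime_legendreSym_eq_neg_one hp2 hq2 hs2 hpq hps hqs
  have hlF : Fact l.Prime := ⟨hl⟩
  have hl2 : l ≠ 2 := by omega
  have hl2' : legendreSym l 2 = 1 := by
    rw [legendreSym.at_two hl2, ZMod.χ₈_nat_mod_eight, hl8]; rfl
  have hsqrt {d : ℤ} (hd : legendreSym l d = 1) : ∃ t : ℚ_[l], t ^ 2 = d := by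
    obtain ⟨t, ht⟩ := exists_padic_sqrt hl2 hd
    exact ⟨t, by exact_mod_cast congrArg (fun z : ℤ_[l] ↦ (z : ℚ_[l])) ht⟩
  obtain ⟨f⟩ : Nonempty (K →+* ℚ_[l]) := by
    refine nonempty_ringHom_of_adjoin_eq_top htop ?_
    rintro _ (rfl | rfl | rfl)
    · exact ⟨2, by exact_mod_cast hw, hsqrt hl2'⟩
    · refine ⟨(p * q : ℕ), by exact_mod_cast ha, hsqrt ?_⟩
      rw [Nat.cast_mul, legendreSym.mul, legendreSym_swap_of_mod_four (by omega) hp2,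
        legendreSym_swap_of_mod_four (by omega) hq2, hlp, hlq]
      rfl
    · refine ⟨(p * s : ℕ), by exact_mod_cast hb, hsqrt ?_⟩
      rw [Nat.cast_mul, legendreSym.mul, legendreSym_swap_of_mod_four (by omega) hp2,
        legendreSym_swap_of_mod_four (by omega) hs2, hlp, hls]
      rfl
  obtain ⟨J, hJ⟩ := exists_ideal_absNorm_eq_of_padic f
  have hpl : ¬ p ∣ l := (Nat.Prime.coprime_iff_not_dvd hp).mp
    (coprime_of_legendreSym_eq_neg_one hlp).symm
  have hneg := legendreSym_neg_one_of_mod_four_eq_one hp4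
  have hpq' := not_dvd_of_prime_ne hp hq hpq
  refine ⟨ClassGroup.mk0 J, fun h ↦ ?_, fun h ↦ ?_⟩
  · have := legendreSym_eq_one_of_mk0_eq_sq (u := l) (t := 1) hneg hpq' ha (by rw [hJ]; ring) hpl h
    omega
  · rw [← map_mul] at h
    have := legendreSym_eq_one_of_mk0_eq_sq (u := l) (t := 2) hneg hpq' ha
      (by rw [Submonoid.coe_mul, map_mul, hJ, hQ]; norm_num) hpl h
    omega

theorem exists_integer_of_sq_eq {K : Type*} [Field K] [NumberField K] {x : K} {n : ℕ}
    (h : x ^ 2 = n) : ∃ y : 𝓞 K, (y : K) = x ∧ y ^ 2 = n := by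
  have hx : IsIntegral ℤ x := IsIntegral.of_pow two_pos (h ▸ isIntegral_natCast n)
  refine ⟨⟨x, hx⟩, rfl, RingOfIntegers.ext ?_⟩
  change x ^ 2 = algebraMap (𝓞 K) K n
  rw [h, map_natCast]

theorem exists_integer_half_of_sq_eq {K : Type*} [Field K] [NumberField K] {x : K} {m : ℕ}
    (h : x ^ 2 = (4 * m + 1 : ℕ)) : ∃ y : 𝓞 K, (y : K) = (1 + x) / 2 ∧ y ^ 2 = y + m := by
  have hy2 : ((1 + x) / 2) ^ 2 = (1 + x) / 2 + m := by
    push_cast at h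
    linear_combination h / 4
  have hx : IsIntegral ℤ ((1 + x) / 2) := by
    refine ⟨Polynomial.X ^ 2 - Polynomial.X - Polynomial.C (m : ℤ), ?_, ?_⟩
    · monicity!
    · simp [hy2]
  refine ⟨⟨(1 + x) / 2, hx⟩, rfl, RingOfIntegers.ext ?_⟩
  change ((1 + x) / 2) ^ 2 = (1 + x) / 2 + algebraMap (𝓞 K) K m
  rw [hy2, map_natCast]

theorem adjoin_half_eq_top {k K : Type*} [Field k] [Field K] [CharZero K] [Algebra k K] {x y : K}
    (hy : y = (1 + x) / 2) (htop : k⟮x⟯ = ⊤) : k⟮y⟯ = ⊤ := by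
  rw [eq_top_iff, ← htop, IntermediateField.adjoin_simple_le_iff]
  have hy' : y ∈ k⟮y⟯ := IntermediateField.mem_adjoin_simple_self k y
  rw [show x = y + y - 1 by rw [hy]; ring]
  exact sub_mem (add_mem hy' hy') (one_mem _)

theorem eq_top_of_adjoin_rat_eq_top {L K : Type*} [Field L] [CharZero L] [Field K] [CharZero K]
    [Algebra L K] {S : Set K} (htop : adjoin ℚ S = ⊤) {T : IntermediateField L K}
    (h : ∀ x ∈ S, x ∈ T) : T = ⊤ := by
  refine eq_top_iff.mpr fun x _ ↦ ?_
  have hx : x ∈ IntermediateField.adjoin ℚ S := htop ▸ IntermediateField.mem_top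
  induction hx using IntermediateField.adjoin_induction with
  | mem x hx => exact h x hx
  | algebraMap x => rw [eq_ratCast]; exact SubfieldClass.ratCast_mem T x
  | add x y _ _ hx hy => exact add_mem (hx trivial) (hy trivial)
  | inv x _ hx => exact inv_mem (hx trivial)
  | mul x y _ _ hx hy => exact mul_mem (hx trivial) (hy trivial)

theorem not_isSquare_prime_mul_of_sqrt {k E : Type*} [Field k] [CharZero k] [Field E] [Algebra k E]
    (hk : ∀ {l d : ℕ}, l.Prime → l ≠ 2 → ¬ l ∣ d → ¬ IsSquare ((l * d : ℕ) : k)) {n : ℕ} {r : E}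
    (hr : r ^ 2 = (n : E)) (hn : ¬ IsSquare (n : k)) (htop : k⟮r⟯ = ⊤) {l d : ℕ} (hl : l.Prime)
    (hl2 : l ≠ 2) (hld : ¬ l ∣ d) (hln : ¬ l ∣ n) : ¬ IsSquare ((l * d : ℕ) : E) := by
  intro h
  rw [← map_natCast (algebraMap k E)] at h
  rcases isSquare_or_isSquare_mul (by rw [hr, map_natCast]) hn htop h with h | h
  · exact hk hl hl2 hld h
  · rw [← Nat.cast_mul, mul_assoc] at h
    exact hk hl hl2 (fun h' ↦ ((Nat.Prime.dvd_mul hl).mp h').elim hld hln) h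

theorem not_isSquare_prime_mul_of_sqrt_two {k : Type*} [Field k] [CharZero k] {w : k}
    (hw : w ^ 2 = 2) (htop : ℚ⟮w⟯ = ⊤) {l d : ℕ} (hl : l.Prime) (hl2 : l ≠ 2) (hld : ¬ l ∣ d) :
    ¬ IsSquare ((l * d : ℕ) : k) :=
  not_isSquare_prime_mul_of_sqrt (fun hl _ hld ↦ not_isSquare_prime_mul_rat hl hld) (n := 2)
    (by simpa using hw) (by simpa using not_isSquare_two_rat) htop hl hl2 hld
    fun h ↦ hl2 ((Nat.prime_dvd_prime_iff_eq hl Nat.prime_two).mp h)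

/-- The `2`-part of the class group of `K = ℚ(√2, √(pq), √(ps))`, given the subfields
`k = ℚ(√2)`, `F = k(√(qs))`, `D = k(√(ps))`, `D' = k(√(pq))` and `M = ℚ(√(qs))`. -/
theorem isKleinFour_sylow_of_subfields {k F D D' M K : Type*} [Field k] [NumberField k] [Field F]
    [NumberField F] [Field D] [NumberField D] [Field D'] [NumberField D'] [Field M] [NumberField M]
    [Field K] [NumberField K] [IsTotallyReal K] [Algebra k F] [Algebra k D] [Algebra k D']
    [Algebra F K] [Algebra D K] [Algebra D' K] [Algebra M K] {p q s : ℕ} (hp : p.Prime)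
    (hq : q.Prime) (hs : s.Prime) (hpq : p ≠ q) (hps : p ≠ s) (hqs : q ≠ s) (hp8 : p % 8 = 5)
    (hs8 : s % 8 = 3) (hq8 : q % 8 = 7) (hlq : ∀ _ : Fact p.Prime, legendreSym p q = 1)
    (hls : ∀ _ : Fact p.Prime, legendreSym p s = 1) {w : k} (hw : w ^ 2 = 2) (hk : ℚ⟮w⟯ = ⊤)
    {c : F} (hc : c ^ 2 = (q * s : ℕ)) (hF : k⟮c⟯ = ⊤) {b : D} (hb : b ^ 2 = (s * p : ℕ))
    (hD : k⟮b⟯ = ⊤) {a : D'} (ha : a ^ 2 = (q * p : ℕ)) (hD' : k⟮a⟯ = ⊤) {c' : M}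
    (hc' : c' ^ 2 = (q * s : ℕ)) (hM : ℚ⟮c'⟯ = ⊤) {wK aK bK : K}
    (htop : adjoin ℚ {wK, aK, bK} = ⊤) (hwF : algebraMap F K (algebraMap k F w) = wK)
    (hwD : algebraMap D K (algebraMap k D w) = wK)
    (hwD' : algebraMap D' K (algebraMap k D' w) = wK)
    (hcF : algebraMap F K c * p = aK * bK) (hbD : algebraMap D K b = bK)
    (haD' : algebraMap D' K a = aK) (P : Sylow 2 (ClassGroup (𝓞 K))) :
    IsKleinFour P.toSubgroup := by
  have : IsTotallyReal F := IsTotallyReal.of_algebra F K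
  have : IsTotallyReal D := IsTotallyReal.of_algebra D K
  have : IsTotallyReal D' := IsTotallyReal.of_algebra D' K
  have : IsTotallyReal k := IsTotallyReal.of_algebra k F
  have hp2 : p ≠ 2 := by omega
  have hq2 : q ≠ 2 := by omega
  have hs2 : s ≠ 2 := by omega
  have hprime {l₁ l₂ l₃ : ℕ} (h₁ : l₁.Prime) (h₂ : l₂.Prime) (h₃ : l₃.Prime) (h : l₁ ≠ l₂)
      (h' : l₁ ≠ l₃) : ¬ l₁ ∣ l₂ * l₃ := fun hd ↦ ((Nat.Prime.dvd_mul h₁).mp hd).elim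
    (not_dvd_of_prime_ne h₁ h₂ h) (not_dvd_of_prime_ne h₁ h₃ h')
  -- nonsquares
  have hnk {l d : ℕ} : l.Prime → l ≠ 2 → ¬ l ∣ d → ¬ IsSquare ((l * d : ℕ) : k) :=
    not_isSquare_prime_mul_of_sqrt_two hw hk
  have hqsk := hnk hq hq2 (not_dvd_of_prime_ne hq hs hqs)
  have hspk := hnk hs hs2 (not_dvd_of_prime_ne hs hp hps.symm)
  have hqpk := hnk hq hq2 (not_dvd_of_prime_ne hq hp hpq.symm)
  have hpqF : ¬ IsSquare ((p * q : ℕ) : F) := not_isSquare_prime_mul_of_sqrt hnk hc hqsk hF hp hp2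
    (not_dvd_of_prime_ne hp hq hpq) (hprime hp hq hs hpq hps)
  have hpsF : ¬ IsSquare ((p * s : ℕ) : F) := not_isSquare_prime_mul_of_sqrt hnk hc hqsk hF hp hp2
    (not_dvd_of_prime_ne hp hs hps) (hprime hp hq hs hpq hps)
  have hqpD : ¬ IsSquare ((q * p : ℕ) : D) := not_isSquare_prime_mul_of_sqrt hnk hb hspk hD hq hq2
    (not_dvd_of_prime_ne hq hp hpq.symm) (hprime hq hs hp hqs hpq.symm)
  have hspD' : ¬ IsSquare ((s * p : ℕ) : D') := not_isSquare_prime_mul_of_sqrt hnk ha hqpk hD' hs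
    hs2 (not_dvd_of_prime_ne hs hp hps.symm) (hprime hs hq hp hqs.symm hps.symm)
  have hqsQ := not_isSquare_prime_mul_rat hq (not_dvd_of_prime_ne hq hs hqs)
  have hpqM : ¬ IsSquare ((p * q : ℕ) : M) := not_isSquare_prime_mul_of_sqrt
    (fun hl _ hld ↦ not_isSquare_prime_mul_rat hl hld) hc' hqsQ hM hp hp2
    (not_dvd_of_prime_ne hp hq hpq) (hprime hp hq hs hpq hps)
  have hwK : wK ^ 2 = 2 := by rw [← hwF, ← map_pow, ← map_pow, hw, map_ofNat, map_ofNat]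
  have haK : aK ^ 2 = (q * p : ℕ) := by rw [← haD', ← map_pow, ha, map_natCast]
  have hbK : bK ^ 2 = (s * p : ℕ) := by rw [← hbD, ← map_pow, hb, map_natCast]
  have hpK : (p : K) ≠ 0 := Nat.cast_ne_zero.mpr hp.ne_zero
  have haK0 : aK ≠ 0 := by
    rintro rfl
    have h0 : ((q * p : ℕ) : K) ≠ 0 := Nat.cast_ne_zero.mpr (mul_ne_zero hq.ne_zero hp.ne_zero)
    exact h0 (by rw [← haK]; ring)
  have hbK0 : bK ≠ 0 := by
    rintro rfl
    have h0 : ((s * p : ℕ) : K) ≠ 0 := Nat.cast_ne_zero.mpr (mul_ne_zero hs.ne_zero hp.ne_zero)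
    exact h0 (by rw [← hbK]; ring)
  -- generators
  have hFa : F⟮aK⟯ = ⊤ := by
    have h : aK ∈ F⟮aK⟯ := mem_adjoin_simple_self F aK
    refine eq_top_of_adjoin_rat_eq_top htop ?_
    rintro _ (rfl | rfl | rfl)
    · rw [← hwF]; exact IntermediateField.algebraMap_mem _ _
    · exact h
    · rw [eq_div_of_mul_eq haK0 ((mul_comm _ _).trans hcF.symm)]
      exact div_mem (mul_mem (IntermediateField.algebraMap_mem _ _) (_root_.natCast_mem _ p)) h
  have hFb : F⟮bK⟯ = ⊤ := by
    have h : bK ∈ F⟮bK⟯ := mem_adjoin_simple_self F bK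
    refine eq_top_of_adjoin_rat_eq_top htop ?_
    rintro _ (rfl | rfl | rfl)
    · rw [← hwF]; exact IntermediateField.algebraMap_mem _ _
    · rw [eq_div_of_mul_eq hbK0 hcF.symm]
      exact div_mem (mul_mem (IntermediateField.algebraMap_mem _ _) (_root_.natCast_mem _ p)) h
    · exact h
  have hDa : D⟮aK⟯ = ⊤ := by
    refine eq_top_of_adjoin_rat_eq_top htop ?_
    rintro _ (rfl | rfl | rfl)
    · rw [← hwD]; exact IntermediateField.algebraMap_mem _ _
    · exact mem_adjoin_simple_self D _
    · rw [← hbD]; exact IntermediateField.algebraMap_mem _ _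
  have hDb' : D'⟮bK⟯ = ⊤ := by
    refine eq_top_of_adjoin_rat_eq_top htop ?_
    rintro _ (rfl | rfl | rfl)
    · rw [← hwD']; exact IntermediateField.algebraMap_mem _ _
    · rw [← haD']; exact IntermediateField.algebraMap_mem _ _
    · exact mem_adjoin_simple_self D' _
  -- degrees
  have hkF : Module.finrank k F = 2 := finrank_of_sq_eq (by rw [hc, map_natCast]) hqsk hF
  have hkD : Module.finrank k D = 2 := finrank_of_sq_eq (by rw [hb, map_natCast]) hspk hD
  have hkD' : Module.finrank k D' = 2 := finrank_of_sq_eq (by rw [ha, map_natCast]) hqpk hD'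
  have hFK : Module.finrank F K = 2 :=
    finrank_of_sq_eq (by rw [haK, map_natCast]) (mul_comm p q ▸ hpqF) hFa
  have hDK : Module.finrank D K = 2 := finrank_of_sq_eq (by rw [haK, map_natCast]) hqpD hDa
  have hDK' : Module.finrank D' K = 2 := finrank_of_sq_eq (by rw [hbK, map_natCast]) hspD' hDb'
  obtain ⟨wk, hwk, hwk2⟩ := exists_integer_of_sq_eq (n := 2) (x := w) (by simpa using hw)
  obtain rfl := hwk
  rw [Nat.cast_ofNat] at hwk2
  have hQk := finrank_rat_of_sqrt_two hwk2 hk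
  have hQF : Module.finrank ℚ F = 4 := by rw [finrank_rat_of_quadratic hkF, hQk]
  have hQD : Module.finrank ℚ D = 4 := by rw [finrank_rat_of_quadratic hkD, hQk]
  have hQD' : Module.finrank ℚ D' = 4 := by rw [finrank_rat_of_quadratic hkD', hQk]
  have hQK : Module.finrank ℚ K = 8 := by rw [finrank_rat_of_quadratic hFK, hQF]
  have hQM : Module.finrank ℚ M = 2 := finrank_of_sq_eq (by rw [hc', map_natCast]) hqsQ hM
  have hMK : Module.finrank M K = 4 := by
    have := Module.finrank_mul_finrank ℚ M K
    rw [hQM, hQK] at this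
    omega
  -- automorphisms
  obtain ⟨σ, hσN, hσ, hσneg⟩ := exists_conj_of_finrank_eq_two hFK
  obtain ⟨τ, hτN, hτ, hτneg⟩ := exists_conj_of_finrank_eq_two hDK
  obtain ⟨ρ, hρN, hρ, hρneg⟩ := exists_conj_of_finrank_eq_two hDK'
  have hσa := hσneg aK _ (by rw [haK, map_natCast]) (mul_comm p q ▸ hpqF)
  have hσb := hσneg bK _ (by rw [hbK, map_natCast]) (mul_comm p s ▸ hpsF)
  have hτa := hτneg aK _ (by rw [haK, map_natCast]) hqpD
  have hρb := hρneg bK _ (by rw [hbK, map_natCast]) hspD'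
  have hτσ (x : K) : τ (σ x) = ρ x := by
    have : (τ : K →+* K).comp (σ : K →+* K) = (ρ : K →+* K) := by
      refine ringHom_ext_of_adjoin_eq_top htop ?_
      rintro x (rfl | rfl | rfl)
      · change τ (σ _) = ρ _
        rw [← hwF, hσ, hwF, ← hwD, hτ, hwD, ← hwD', hρ]
      · change τ (σ _) = ρ _
        rw [hσa, map_neg, hτa, neg_neg, ← haD', hρ]
      · change τ (σ _) = ρ _
        rw [hσb, map_neg, hρb, ← hbD, hτ]
    exact RingHom.congr_fun this x
  -- class groups of the subfields
  obtain ⟨m, hm⟩ : ∃ m, q * s = 8 * m + 5 := ⟨q * s / 8, by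
    have : q * s % 8 = 5 := by rw [Nat.mul_mod, hq8, hs8]
    omega⟩
  obtain ⟨θF, hθF, hθF2⟩ := exists_integer_half_of_sq_eq (m := 2 * m + 1)
    (hc.trans (by congr 1; omega))
  obtain ⟨θM, hθM, hθM2⟩ := exists_integer_half_of_sq_eq (m := 2 * m + 1)
    (hc'.trans (by congr 1; omega))
  have hClF := classGroup_two_torsion_of_sqrt_mul hwk2 hk hq hs hq8 hs8 hqsk hc
    (m := 2 * m + 1) (by omega) hθF2 (adjoin_half_eq_top hθF hF) hkF
  obtain ⟨bD, hbD', hbD2⟩ := exists_integer_of_sq_eq hb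
  obtain ⟨aD, haD, haD2⟩ := exists_integer_of_sq_eq ha
  obtain ⟨aO, haO, haO2⟩ := exists_integer_of_sq_eq haK
  obtain ⟨bO, hbO, hbO2⟩ := exists_integer_of_sq_eq hbK
  have hcardD := card_two_torsion_le_two_of_inert hwk2 hk hp hs hp8 hs8 hspk hbD2 (hbD' ▸ hD)
  have hcardD' := card_two_torsion_le_two_of_split hwk2 hk hp hq hp8 hq8 hqpk haD2 (haD ▸ hD')
  have hcard := card_two_torsion_le_four hClF hQF (w := algebraMap (𝓞 k) (𝓞 F) wk)
    (by rw [← map_pow, hwk2, map_ofNat]) ⟨m, rfl⟩ hθF2 hp hq hs hqs hp8 haO2 hbO2 (haO ▸ hFa)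
    (hbO ▸ hFb) (mul_comm p q ▸ hpqF)
  have hwD2 : (algebraMap (𝓞 k) (𝓞 D) wk) ^ 2 = 2 := by rw [← map_pow, hwk2, map_ofNat]
  have hwD2' : (algebraMap (𝓞 k) (𝓞 D') wk) ^ 2 = 2 := by rw [← map_pow, hwk2, map_ofNat]
  obtain ⟨A, hA⟩ := exists_ideal_sq_eq_span_sqrt_two hwD2
    (by have : s * p % 8 = 7 := by rw [Nat.mul_mod, hs8, hp8]
        omega) hbD2
  obtain ⟨A', hA'⟩ := exists_ideal_sq_eq_span_sqrt_two hwD2'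
    (by have : q * p % 8 = 3 := by rw [Nat.mul_mod, hq8, hp8]
        omega) haD2
  have hAgen := eq_one_or_eq_mk0_of_sqrt_two hp hp8 (not_dvd_of_prime_ne hp hs hps) hQD hwD2
    (mul_comm s p ▸ hb) hcardD hA
  have hAgen' := eq_one_or_eq_mk0_of_sqrt_two hp hp8 (not_dvd_of_prime_ne hp hq hpq) hQD' hwD2'
    (mul_comm q p ▸ ha) hcardD' hA'
  -- the ideal `Q`
  let wO : 𝓞 K := algebraMap (𝓞 D) (𝓞 K) (algebraMap (𝓞 k) (𝓞 D) wk)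
  have hwO : wO ^ 2 = 2 := by rw [← map_pow, hwD2, map_ofNat]
  have hwO' : algebraMap (𝓞 D') (𝓞 K) (algebraMap (𝓞 k) (𝓞 D') wk) = wO :=
    RingOfIntegers.ext (hwD'.trans hwD.symm)
  let Q : (Ideal (𝓞 K))⁰ := ⟨(A : Ideal (𝓞 D)).map (algebraMap (𝓞 D) (𝓞 K)),
    mem_nonZeroDivisors_of_ne_zero fun h ↦ nonZeroDivisors.coe_ne_zero A
      ((Ideal.map_eq_bot_iff_of_injective (FaithfulSMul.algebraMap_injective _ _)).mp h)⟩
  have hQ2 : (Q : Ideal (𝓞 K)) ^ 2 = Ideal.span {wO} := by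
    change Ideal.map _ _ ^ 2 = _
    rw [← Ideal.map_pow, hA, Ideal.map_span, Set.image_singleton]
  have hQA' : (Q : Ideal (𝓞 K)) = (A' : Ideal (𝓞 D')).map (algebraMap (𝓞 D') (𝓞 K)) := by
    refine pow_left_injective (n := 2) two_ne_zero ?_
    change _ ^ 2 = _ ^ 2
    rw [hQ2, ← Ideal.map_pow, hA', Ideal.map_span, Set.image_singleton, hwO']
  have hQN : Ideal.absNorm (Q : Ideal (𝓞 K)) = 4 := by
    have := absNorm_pow_four_of_sq_eq_span hwO hQ2
    rw [hQK] at this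
    exact Nat.pow_left_injective (by norm_num : 4 ≠ 0) (this.trans (by norm_num))
  have hQcl := mk0_sq_eq_one_of_sq_eq_span hwO hQ2
  obtain ⟨g, hg, hgQ⟩ := exists_class_not_isSquare hp hq hs hpq hps hqs (by omega) hq2 hs2 hwK
    (mul_comm q p ▸ haK) (mul_comm s p ▸ hbK) htop hQN
  refine isKleinFour_sylow hcard hQcl (fun c hc ↦ ?_) ?_ hg hgQ P
  · exact sq_eq_one_or_eq_of_biquadratic hFK hDK hDK' hσN hτN hρN hτσ hClF rfl hQA' hAgen hAgen'
      hQcl hc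
  · exact not_isSquare_mk0_of_sq_eq_span hp hq hs hpq hqs hp8 hq8 hlq hls hQM hMK hc' hM
      (adjoin_half_eq_top hθM hM) hθM2 (by omega) (mul_comm q p ▸ haK) hpqM hwO hQ2

theorem isTotallyReal_of_adjoin_eq_top {K : Type*} [Field K] [NumberField K] {S : Set K}
    (htop : adjoin ℚ S = ⊤) (hS : ∀ r ∈ S, ∃ d : ℕ, r ^ 2 = d) : IsTotallyReal K := by
  refine ⟨fun v ↦ ?_⟩
  rw [← InfinitePlace.mk_embedding v, InfinitePlace.isReal_mk_iff,
    ComplexEmbedding.isReal_iff]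
  refine ringHom_ext_of_adjoin_eq_top htop fun r hr ↦ ?_
  obtain ⟨d, hd⟩ := hS r hr
  rw [ComplexEmbedding.conjugate_coe_eq]
  have h : (v.embedding r) ^ 2 = ((√(d : ℝ) : ℝ) : ℂ) ^ 2 := by
    rw [← map_pow, hd, map_natCast, ← Complex.ofReal_pow, Real.sq_sqrt (Nat.cast_nonneg d),
      Complex.ofReal_natCast]
  rcases sq_eq_sq_iff_eq_or_eq_neg.mp h with h | h <;> rw [h]
  · exact Complex.conj_ofReal _
  · rw [map_neg, Complex.conj_ofReal]

theorem adjoin_gen_eq_top (k : Type*) {K : Type*} [Field k] [Field K] [Algebra k K] (x : K) :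
    k⟮AdjoinSimple.gen k x⟯ = ⊤ := by
  apply IntermediateField.lift_injective
  rw [IntermediateField.lift_adjoin_simple, IntermediateField.lift_top]
  rfl

theorem gen_sq_eq {k K : Type*} [Field k] [Field K] [Algebra k K] {x : K} {n : ℕ}
    (h : x ^ 2 = n) : AdjoinSimple.gen k x ^ 2 = n :=
  Subtype.ext (by simpa using h)

theorem isKleinFour_sylow_of_adjoin_eq_top {K : Type*} [Field K] [NumberField K] {p q s : ℕ}
    (hp : p.Prime) (hq : q.Prime) (hs : s.Prime) (hpq : p ≠ q) (hps : p ≠ s) (hqs : q ≠ s)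
    (hp8 : p % 8 = 5) (hs8 : s % 8 = 3) (hq8 : q % 8 = 7)
    (hlq : ∀ _ : Fact p.Prime, legendreSym p q = 1) (hls : ∀ _ : Fact p.Prime, legendreSym p s = 1)
    {w a b : K} (hw : w ^ 2 = (2 : ℕ)) (ha : a ^ 2 = (q * p : ℕ)) (hb : b ^ 2 = (s * p : ℕ))
    (htop : adjoin ℚ {w, a, b} = ⊤) (P : Sylow 2 (ClassGroup (𝓞 K))) :
    IsKleinFour P.toSubgroup := by
  have : IsTotallyReal K := isTotallyReal_of_adjoin_eq_top htop (by
    rintro r (rfl | rfl | rfl)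
    exacts [⟨_, hw⟩, ⟨_, ha⟩, ⟨_, hb⟩])
  have hp0 : (p : K) ≠ 0 := Nat.cast_ne_zero.mpr hp.ne_zero
  have hc : (a * b / p) ^ 2 = (q * s : ℕ) := by
    rw [div_pow, mul_pow, ha, hb]
    push_cast
    field_simp
  have hw' : AdjoinSimple.gen ℚ w ^ 2 = 2 := by simpa using gen_sq_eq (k := ℚ) hw
  exact isKleinFour_sylow_of_subfields (k := ℚ⟮w⟯) (F := ℚ⟮w⟯⟮a * b / p⟯) (D := ℚ⟮w⟯⟮b⟯)
    (D' := ℚ⟮w⟯⟮a⟯) (M := ℚ⟮a * b / p⟯) hp hq hs hpq hps hqs hp8 hs8 hq8 hlq hls hw'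
    (adjoin_gen_eq_top ℚ w) (gen_sq_eq hc) (adjoin_gen_eq_top _ _) (gen_sq_eq hb)
    (adjoin_gen_eq_top _ _) (gen_sq_eq ha) (adjoin_gen_eq_top _ _) (gen_sq_eq hc)
    (adjoin_gen_eq_top _ _) htop rfl rfl rfl (div_mul_cancel₀ _ hp0) rfl rfl P

theorem finiteDimensional_Lplus (p q s : ℕ) : FiniteDimensional ℚ (Lplus p q s) := by
  have hint {d : ℝ} (hd : IsIntegral ℚ d) (h0 : 0 ≤ d) : IsIntegral ℚ (√d) :=
    IsIntegral.of_pow two_pos ((Real.sq_sqrt h0).symm ▸ hd)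
  refine IntermediateField.finiteDimensional_adjoin ?_
  rintro x (rfl | rfl | rfl)
  · exact hint (by exact_mod_cast isIntegral_natCast 2) (by norm_num)
  · exact hint (by exact_mod_cast isIntegral_natCast (p * q)) (by positivity)
  · exact hint (by exact_mod_cast isIntegral_natCast (p * s)) (by positivity)

/-- Let `p, q, s` be distinct primes with `p ≡ 5 (mod 8)`, `s ≡ 3 (mod 8)`,
`q ≡ 7 (mod 8)` and `(p/q) = (p/s) = (s/q) = 1`.  Then the 2-Sylow subgroup of the
class group of the ring of integers of `L⁺ = ℚ(√2, √(pq), √(ps))` is isomorphic to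
`ℤ/2ℤ × ℤ/2ℤ`; in particular the 2-class number of `L⁺` is `4`. -/
theorem statement_6 (p q s : ℕ) (hp : p.Prime) (hq : q.Prime) (hs : s.Prime)
    (hpq : p ≠ q) (hps : p ≠ s) (hqs : q ≠ s)
    (hp8 : p % 8 = 5) (hs8 : s % 8 = 3) (hq8 : q % 8 = 7)
    (hleg1 : @legendreSym q ⟨hq⟩ (p : ℤ) = 1)
    (hleg2 : @legendreSym s ⟨hs⟩ (p : ℤ) = 1)
    (hleg3 : @legendreSym q ⟨hq⟩ (s : ℤ) = 1) :
    ∀ P : Sylow 2 (ClassGroup (𝓞 ↥(Lplus p q s))),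
      Nonempty (↥P.toSubgroup ≃* Multiplicative (ZMod 2 × ZMod 2)) ∧
        Nat.card ↥P.toSubgroup = 4 := by
  intro P
  have hpF : Fact p.Prime := ⟨hp⟩
  have hqF : Fact q.Prime := ⟨hq⟩
  have hsF : Fact s.Prime := ⟨hs⟩
  have := finiteDimensional_Lplus p q s
  have : NumberField (Lplus p q s) := { }
  have hmem {x : ℝ} (hx : x ∈ ({√2, √(p * q), √(p * s)} : Set ℝ)) : x ∈ Lplus p q s :=
    IntermediateField.subset_adjoin ℚ _ hx
  let w : Lplus p q s := ⟨√2, hmem (by simp)⟩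
  let a : Lplus p q s := ⟨√(p * q), hmem (by simp)⟩
  let b : Lplus p q s := ⟨√(p * s), hmem (by simp)⟩
  have hw : w ^ 2 = (2 : ℕ) := Subtype.ext (by
    change √2 ^ 2 = ((2 : ℕ) : ℝ)
    rw [Real.sq_sqrt (by norm_num), Nat.cast_ofNat])
  have ha : a ^ 2 = (q * p : ℕ) := Subtype.ext (by
    change √(p * q) ^ 2 = ((q * p : ℕ) : ℝ)
    rw [Real.sq_sqrt (by positivity), Nat.cast_mul, mul_comm])
  have hb : b ^ 2 = (s * p : ℕ) := Subtype.ext (by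
    change √(p * s) ^ 2 = ((s * p : ℕ) : ℝ)
    rw [Real.sq_sqrt (by positivity), Nat.cast_mul, mul_comm])
  have htop (inst : Algebra ℚ (Lplus p q s)) : adjoin ℚ {w, a, b} = ⊤ := by
    obtain rfl : inst = (Lplus p q s).algebra' := Subsingleton.elim _ _
    apply IntermediateField.lift_injective
    rw [IntermediateField.lift_adjoin, IntermediateField.lift_top, Set.image_insert_eq,
      Set.image_pair]
    rfl
  have hlq : ∀ _ : Fact p.Prime, legendreSym p q = 1 := fun _ ↦ by
    rw [← legendreSym.quadratic_reciprocity_one_mod_four (by omega) (by omega), hleg1]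
  have hls : ∀ _ : Fact p.Prime, legendreSym p s = 1 := fun _ ↦ by
    rw [← legendreSym.quadratic_reciprocity_one_mod_four (by omega) (by omega), hleg2]
  have hP := isKleinFour_sylow_of_adjoin_eq_top hp hq hs hpq hps hqs hp8 hs8 hq8 hlq hls hw ha hb
    (htop _) P
  exact ⟨nonempty_mulEquiv_of_isKleinFour, hP.card_four⟩
end
end

section
/- Let p, q, s be distinct primes with p ≡ 5 (mod 8), s ≡ 3 (mod 8), q ≡ 7 (mod 8), and Legendre symbols (p/q) = (p/s) = (s/q) = 1. Then each of the products ε_{pq}·ε_{ps}, ε_{pq}·ε_{qs}, and ε_{ps}·ε_{qs} is a square in L⁺ (viewing the fundamental units as real numbers and L⁺ as a subfield of ℝ). -/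
open Real NumberField IntermediateField

noncomputable section

/-- `e : ℝ` is a unit greater than `1` of the ring of integers of the real quadratic
field `ℚ(√d)`: it can be written as `(x + y√d)/2` with `x, y ≥ 1` integers satisfying
`x² - d·y² = ±4`. -/
def IsQuadUnit (d : ℕ) (e : ℝ) : Prop :=
  ∃ x y : ℤ, 1 ≤ x ∧ 1 ≤ y ∧
    (x ^ 2 - (d : ℤ) * y ^ 2 = 4 ∨ x ^ 2 - (d : ℤ) * y ^ 2 = -4) ∧
    2 * e = (x : ℝ) + (y : ℝ) * Real.sqrt d

/-- `e` is the fundamental unit of the real quadratic field `ℚ(√d)` (for `d > 1`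
squarefree), i.e. the smallest unit `> 1` of its ring of integers. -/
def IsFundamentalUnit (d : ℕ) (e : ℝ) : Prop :=
  IsQuadUnit d e ∧ ∀ e' : ℝ, IsQuadUnit d e' → e ≤ e'


lemma Nat.dvd_of_sq_dvd_squarefree_mul_sq {d k y : ℕ} (hd : Squarefree d) (hy : 0 < y)
    (h : k ^ 2 ∣ d * y ^ 2) : k ∣ y := by
  obtain ⟨g, a, b, hg, hab, rfl, rfl⟩ := Nat.exists_coprime' (Nat.gcd_pos_of_pos_right k hy)
  have h' : a ^ 2 ∣ d * b ^ 2 := by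
    refine Nat.dvd_of_mul_dvd_mul_right (pow_pos hg 2) ?_
    rwa [mul_pow, mul_pow, ← mul_assoc] at h
  have ha : a * a ∣ d := by
    rw [← sq]
    exact (Nat.Coprime.pow 2 2 hab).dvd_of_dvd_mul_right h'
  rw [Nat.isUnit_iff.mp (hd a ha), one_mul]
  exact dvd_mul_left g b

/-- If `(n + 4) n = d y²` with `d` squarefree, the squarefree part of `n + 4` divides `2d`. -/
lemma exists_squarefree_part_dvd {d n y : ℕ} (hd : Squarefree d) (hy : 0 < y)
    (h : (n + 4) * n = d * y ^ 2) :
    ∃ m k z : ℕ, m ∣ 2 * d ∧ n + 4 = m * k ^ 2 ∧ m * n = d * z ^ 2 ∧ y = k * z := by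
  obtain ⟨m, k, hm, hk, hmk, hsq⟩ := Nat.sq_mul_squarefree_of_pos (Nat.succ_pos (n + 3))
  replace hmk : n + 4 = m * k ^ 2 := by rw [mul_comm]; exact hmk.symm
  obtain ⟨z, rfl⟩ : k ∣ y :=
    Nat.dvd_of_sq_dvd_squarefree_mul_sq hd hy ⟨m * n, by rw [← h, hmk]; ring⟩
  have hz : m * n = d * z ^ 2 := by
    refine Nat.eq_of_mul_eq_mul_left (pow_pos hk 2) ?_
    calc k ^ 2 * (m * n) = (n + 4) * n := by rw [hmk]; ring
      _ = k ^ 2 * (d * z ^ 2) := by rw [h]; ring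
  refine ⟨m, k, z, ?_, hmk, hz, rfl⟩
  rw [← Nat.prod_primeFactors_of_squarefree hsq]
  refine Finset.prod_primes_dvd _ (fun r hr => (Nat.prime_of_mem_primeFactors hr).prime) ?_
  intro r hr
  have hrp := Nat.prime_of_mem_primeFactors hr
  obtain ⟨t, rfl⟩ := Nat.dvd_of_mem_primeFactors hr
  rcases hrp.dvd_mul.mp (⟨t * n, by rw [← hz]; ring⟩ : r ∣ d * z ^ 2) with hrd | hrz
  · exact dvd_mul_of_dvd_right hrd 2
  obtain ⟨w, rfl⟩ := hrp.dvd_of_dvd_pow hrz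
  have htn : r ∣ t * n := by
    refine ⟨d * w ^ 2, Nat.eq_of_mul_eq_mul_left hrp.pos ?_⟩
    linear_combination hz
  have hrn : r ∣ n := by
    refine (hrp.dvd_mul.mp htn).resolve_left fun ⟨c, hc⟩ => ?_
    exact hrp.one_lt.ne' (Nat.isUnit_iff.mp (hsq r ⟨c, by rw [hc]; ring⟩))
  have hr4 : r ∣ 2 ^ 2 :=
    (Nat.dvd_add_right hrn).mp ⟨t * k ^ 2, by rw [← mul_assoc]; exact hmk⟩
  exact dvd_mul_of_dvd_left (hrp.dvd_of_dvd_pow hr4) d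

lemma not_dvd_sq_sub_four_mul {r : ℕ} [Fact r.Prime] (hr : r ≠ 2) {c : ℤ}
    (hc : ¬ IsSquare (c : ZMod r)) (a : ℤ) : ¬ (r : ℤ) ∣ a ^ 2 - 4 * c := by
  intro h
  have h2 : (2 : ZMod r) ≠ 0 := by
    intro h2
    have : r ∣ 2 := (ZMod.natCast_eq_zero_iff 2 r).mp (by exact_mod_cast h2)
    exact hr ((Nat.prime_dvd_prime_iff_eq Fact.out Nat.prime_two).mp this)
  have h0 := (ZMod.intCast_zmod_eq_zero_iff_dvd _ r).mpr h
  push_cast at h0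
  refine hc ⟨(a : ZMod r) / 2, ?_⟩
  field_simp
  linear_combination -h0

lemma not_dvd_sq_add_four {r : ℕ} (hr : r.Prime) (h : r % 4 = 3) (a : ℤ) :
    ¬ (r : ℤ) ∣ a ^ 2 + 4 := by
  have := Fact.mk hr
  have := not_dvd_sq_sub_four_mul (r := r) (by rintro rfl; omega) (c := -1)
    (by push_cast; rw [ZMod.exists_sq_eq_neg_one_iff]; simpa using h) a
  simpa using this

lemma not_dvd_sq_sub_eight {r : ℕ} (hr : r.Prime) (h : r % 8 = 3 ∨ r % 8 = 5) (a : ℤ) :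
    ¬ (r : ℤ) ∣ a ^ 2 - 8 := by
  have := Fact.mk hr
  have hr2 : r ≠ 2 := by rintro rfl; omega
  have := not_dvd_sq_sub_four_mul hr2 (c := 2)
    (by push_cast; rw [ZMod.exists_sq_eq_two_iff hr2]; omega) a
  simpa using this

lemma not_dvd_sq_add_eight {r : ℕ} (hr : r.Prime) (h : r % 8 = 5 ∨ r % 8 = 7) (a : ℤ) :
    ¬ (r : ℤ) ∣ a ^ 2 + 8 := by
  have := Fact.mk hr
  have hr2 : r ≠ 2 := by rintro rfl; omega
  have := not_dvd_sq_sub_four_mul hr2 (c := -2)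
    (by push_cast; rw [ZMod.exists_sq_eq_neg_two_iff hr2]; omega) a
  simpa using this

/-- If none of `-1`, `2`, `-2` is a square modulo `uv`, then the trace `x` of the fundamental
unit of `ℚ(√(uv))` is such that `x + 2` is a square times one of `u`, `v`, `2u`, `2v`. -/
lemma IsFundamentalUnit.exists_trace_add_two {u v : ℕ} (hu : u.Prime) (hv : v.Prime)
    (huv : u ≠ v) (h4 : ∀ a : ℤ, ¬ ((u * v : ℕ) : ℤ) ∣ a ^ 2 + 4)
    (h8 : ∀ a : ℤ, ¬ ((u * v : ℕ) : ℤ) ∣ a ^ 2 - 8)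
    (h8' : ∀ a : ℤ, ¬ ((u * v : ℕ) : ℤ) ∣ a ^ 2 + 8)
    {e : ℝ} (he : IsFundamentalUnit (u * v) e) :
    ∃ x y k r c : ℕ, x ^ 2 = u * v * y ^ 2 + 4 ∧ 2 * e = x + y * √((u * v : ℕ) : ℝ) ∧
      x + 2 = c * r * k ^ 2 ∧ (r = u ∨ r = v) ∧ (c = 1 ∨ c = 2) := by
  obtain ⟨⟨x, y, hx, hy, hxy, hexy⟩, hmin⟩ := he
  replace hxy := hxy.resolve_right fun h => h4 x ⟨y ^ 2, by linear_combination h⟩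
  have hd : 0 < u * v := Nat.mul_pos hu.pos hv.pos
  have hx2 : 2 < x := by
    have : (0 : ℤ) < ((u * v : ℕ) : ℤ) * y ^ 2 := by positivity
    nlinarith
  obtain ⟨n, rfl⟩ : ∃ n : ℕ, x = n + 2 := ⟨(x - 2).toNat, by omega⟩
  lift y to ℕ using by omega
  have hn : 0 < n := by omega
  have hy0 : 0 < y := by omega
  have hnorm : (n + 4) * n = u * v * y ^ 2 := by
    zify; push_cast at hxy; linear_combination hxy
  have hsq : Squarefree (u * v) :=
    (Nat.squarefree_mul ((Nat.coprime_primes hu hv).mpr huv)).mpr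
      ⟨hu.prime.squarefree, hv.prime.squarefree⟩
  obtain ⟨m, k, z, hm, hk, hz, rfl⟩ := exists_squarefree_part_dvd hsq hy0 hnorm
  have hconcl : ∀ r c : ℕ, m = c * r → (r = u ∨ r = v) → (c = 1 ∨ c = 2) →
      ∃ x y k r c : ℕ, x ^ 2 = u * v * y ^ 2 + 4 ∧ 2 * e = x + y * √((u * v : ℕ) : ℝ) ∧
      x + 2 = c * r * k ^ 2 ∧ (r = u ∨ r = v) ∧ (c = 1 ∨ c = 2) := by
    rintro r c rfl hr hc
    refine ⟨n + 2, k * z, k, r, c, ?_, ?_, hk, hr, hc⟩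
    · linear_combination hnorm
    · rw [hexy]; push_cast; ring
  obtain ⟨c, w, hc, hw, rfl⟩ := (Nat.dvd_mul).mp hm
  obtain ⟨a, b, ha, hb, rfl⟩ := (Nat.dvd_mul).mp hw
  zify at hk hz
  rcases (Nat.dvd_prime hu).mp ha with rfl | rfl <;>
    rcases (Nat.dvd_prime hv).mp hb with rfl | rfl
  · rcases (Nat.dvd_prime Nat.prime_two).mp hc with rfl | rfl
    · exfalso
      have hkz : 0 < k ∧ 0 < z := by
        constructor <;> refine Nat.pos_of_ne_zero ?_ <;> rintro rfl <;> simp at hy0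
      have hunit : IsQuadUnit (u * v) ((k + z * √((u * v : ℕ) : ℝ)) / 2) := by
        refine ⟨k, z, by omega, by omega, Or.inl ?_, by push_cast; ring⟩
        push_cast at hk hz ⊢
        linear_combination hz - hk
      have hle := hmin _ hunit
      have hkn : k < n + 2 := by
        zify; push_cast at hk; nlinarith
      have hkn' : (k : ℝ) < n + 2 := by exact_mod_cast hkn
      have hzk : (z : ℝ) ≤ k * z := by
        exact_mod_cast Nat.le_mul_of_pos_left z hkz.1
      have := mul_le_mul_of_nonneg_right hzk (Real.sqrt_nonneg ((u * v : ℕ) : ℝ))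
      push_cast at hexy hle this
      linarith
    · refine absurd ⟨(z : ℤ) ^ 2, ?_⟩ (h8 (2 * k))
      push_cast at hk hz ⊢
      linear_combination hz - 2 * hk
  · exact hconcl b c (by ring) (Or.inr rfl) ((Nat.dvd_prime Nat.prime_two).mp hc)
  · exact hconcl a c (by ring) (Or.inl rfl) ((Nat.dvd_prime Nat.prime_two).mp hc)
  · have hd0 : ((a * b : ℕ) : ℤ) ≠ 0 := by exact_mod_cast hd.ne'
    rcases (Nat.dvd_prime Nat.prime_two).mp hc with rfl | rfl
    · refine absurd ⟨(k : ℤ) ^ 2, ?_⟩ (h4 z)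
      have : (n : ℤ) = z ^ 2 := mul_left_cancel₀ hd0 (by push_cast at hz ⊢; linear_combination hz)
      push_cast at hk ⊢
      linear_combination hk - this
    · refine absurd ⟨4 * (k : ℤ) ^ 2, ?_⟩ (h8' z)
      have : 2 * (n : ℤ) = z ^ 2 :=
        mul_left_cancel₀ hd0 (by push_cast at hz ⊢; linear_combination hz)
      push_cast at hk ⊢
      linear_combination 2 * hk - this

/-- Over a real field containing `√2` and `√(uv)`, the fundamental unit of `ℚ(√(uv))` is a square
times `u` or `v`, provided none of `-1`, `2`, `-2` is a square modulo `uv`. -/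
lemma IsFundamentalUnit.exists_mul_eq_sq {u v : ℕ} (hu : u.Prime) (hv : v.Prime)
    (huv : u ≠ v) (h4 : ∀ a : ℤ, ¬ ((u * v : ℕ) : ℤ) ∣ a ^ 2 + 4)
    (h8 : ∀ a : ℤ, ¬ ((u * v : ℕ) : ℤ) ∣ a ^ 2 - 8)
    (h8' : ∀ a : ℤ, ¬ ((u * v : ℕ) : ℤ) ∣ a ^ 2 + 8)
    {e : ℝ} (he : IsFundamentalUnit (u * v) e) {K : IntermediateField ℚ ℝ}
    (h2K : √2 ∈ K) (huvK : √((u * v : ℕ) : ℝ) ∈ K) :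
    ∃ A ∈ K, e * u = A ^ 2 ∨ e * v = A ^ 2 := by
  obtain ⟨x, y, k, r, c, hxy, he2, hxk, hr, hc⟩ :=
    he.exists_trace_add_two hu hv huv h4 h8 h8'
  have hcK : √(c : ℝ) ∈ K := by
    rcases hc with rfl | rfl
    · simp
    · exact_mod_cast h2K
  have hc0 : √(c : ℝ) ≠ 0 := by rcases hc with rfl | rfl <;> simp
  have hk0 : (k : ℝ) ≠ 0 := by
    rintro h
    rw [Nat.cast_eq_zero.mp h] at hxk
    simp at hxk
  have hcs : √(c : ℝ) ^ 2 = c := Real.sq_sqrt (Nat.cast_nonneg c)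
  have hds : √((u * v : ℕ) : ℝ) ^ 2 = ((u * v : ℕ) : ℝ) := Real.sq_sqrt (Nat.cast_nonneg _)
  have hxy' : (x : ℝ) ^ 2 = ((u * v : ℕ) : ℝ) * y ^ 2 + 4 := by exact_mod_cast hxy
  have hxk' : (x : ℝ) + 2 = c * r * k ^ 2 := by exact_mod_cast hxk
  set D := √((u * v : ℕ) : ℝ)
  set C := √(c : ℝ)
  have key : e * r = ((x + 2 + y * D) / (2 * C * k)) ^ 2 := by
    rw [div_pow, eq_div_iff (by positivity)]
    have h1 : e = (x + y * D) / 2 := by linarith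
    calc e * r * (2 * C * k) ^ 2 = 4 * e * (C ^ 2 * r * k ^ 2) := by ring
      _ = 2 * (x + y * D) * (x + 2) := by rw [hcs, ← hxk', h1]; ring
      _ = (x + 2 + y * D) ^ 2 := by linear_combination hxy' - y ^ 2 * hds
  have hmem : (x + 2 + y * D) / (2 * C * k) ∈ K :=
    div_mem
      (add_mem (add_mem (IntermediateField.natCast_mem K x) (ofNat_mem K 2))
        (mul_mem (IntermediateField.natCast_mem K y) huvK))
      (mul_mem (mul_mem (ofNat_mem K 2) hcK) (IntermediateField.natCast_mem K k))
  refine ⟨_, hmem, ?_⟩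
  rcases hr with rfl | rfl
  · exact Or.inl key
  · exact Or.inr key

/-- In a field where `√(pr)` exists, a square divided by `r` is a square times `p`. -/
lemma exists_eq_sq_mul_of_sqrt_mem {p r : ℕ} (hp : p ≠ 0) (hr : r ≠ 0)
    {K : IntermediateField ℚ ℝ} (h : √((p : ℝ) * r) ∈ K) {e A : ℝ} (hA : A ∈ K)
    (he : e * r = A ^ 2) : ∃ B ∈ K, e = B ^ 2 * p := by
  refine ⟨A / √((p : ℝ) * r), div_mem hA h, ?_⟩
  have hp0 : (p : ℝ) ≠ 0 := by exact_mod_cast hp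
  have hr0 : (r : ℝ) ≠ 0 := by exact_mod_cast hr
  rw [div_pow, Real.sq_sqrt (by positivity), ← he]
  field_simp

/-- Let `p, q, s` be distinct primes with `p ≡ 5 (mod 8)`, `s ≡ 3 (mod 8)`,
`q ≡ 7 (mod 8)` and `(p/q) = (p/s) = (s/q) = 1`.  Then each of the products
`ε_{pq}·ε_{ps}`, `ε_{pq}·ε_{qs}` and `ε_{ps}·ε_{qs}` of fundamental units is a
square in `L⁺ = ℚ(√2, √(pq), √(ps))` (viewed inside `ℝ`). -/
theorem statement_8 (p q s : ℕ) (hp : p.Prime) (hq : q.Prime) (hs : s.Prime)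
    (hpq : p ≠ q) (hps : p ≠ s) (hqs : q ≠ s)
    (hp8 : p % 8 = 5) (hs8 : s % 8 = 3) (hq8 : q % 8 = 7)
    (hleg1 : @legendreSym q ⟨hq⟩ (p : ℤ) = 1)
    (hleg2 : @legendreSym s ⟨hs⟩ (p : ℤ) = 1)
    (hleg3 : @legendreSym q ⟨hq⟩ (s : ℤ) = 1)
    (epq eps eqs : ℝ)
    (hepq : IsFundamentalUnit (p * q) epq)
    (heps : IsFundamentalUnit (p * s) eps)
    (heqs : IsFundamentalUnit (q * s) eqs) :
    (∃ ξ : ℝ, ξ ∈ Lplus p q s ∧ ξ ^ 2 = epq * eps) ∧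
    (∃ ξ : ℝ, ξ ∈ Lplus p q s ∧ ξ ^ 2 = epq * eqs) ∧
    (∃ ξ : ℝ, ξ ∈ Lplus p q s ∧ ξ ^ 2 = eps * eqs) := by
  have h2K : √2 ∈ Lplus p q s := subset_adjoin _ _ (by simp)
  have hpqK : √((p : ℝ) * q) ∈ Lplus p q s := subset_adjoin _ _ (by simp)
  have hpsK : √((p : ℝ) * s) ∈ Lplus p q s := subset_adjoin _ _ (by simp)
  have hppK : √((p : ℝ) * p) ∈ Lplus p q s := by
    rw [Real.sqrt_mul_self (Nat.cast_nonneg p)]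
    exact IntermediateField.natCast_mem _ p
  have hqsK : √((q : ℝ) * s) ∈ Lplus p q s := by
    have hp0 : (p : ℝ) ≠ 0 := by exact_mod_cast hp.ne_zero
    have : √((q : ℝ) * s) = √((p : ℝ) * q) * √((p : ℝ) * s) / p := by
      rw [eq_div_iff hp0, ← Real.sqrt_mul (by positivity),
        show (p : ℝ) * q * (p * s) = q * s * (p * p) by ring,
        Real.sqrt_mul (x := (q : ℝ) * s) (by positivity), Real.sqrt_mul_self (Nat.cast_nonneg p)]
    rw [this]
    exact div_mem (mul_mem hpqK hpsK) (IntermediateField.natCast_mem _ p)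
  have left {u v : ℕ} {t : ℤ} (h : ¬ (u : ℤ) ∣ t) : ¬ ((u * v : ℕ) : ℤ) ∣ t := fun h' =>
    h ((Int.natCast_dvd_natCast.mpr (dvd_mul_right u v)).trans h')
  have right {u v : ℕ} {t : ℤ} (h : ¬ (v : ℤ) ∣ t) : ¬ ((u * v : ℕ) : ℤ) ∣ t := fun h' =>
    h ((Int.natCast_dvd_natCast.mpr (dvd_mul_left v u)).trans h')
  obtain ⟨B₁, hB₁, h₁⟩ : ∃ B ∈ Lplus p q s, epq = B ^ 2 * p := by
    obtain ⟨A, hA, h | h⟩ := hepq.exists_mul_eq_sq hp hq hpq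
      (fun a => right (not_dvd_sq_add_four hq (by omega) a))
      (fun a => left (not_dvd_sq_sub_eight hp (by omega) a))
      (fun a => left (not_dvd_sq_add_eight hp (by omega) a)) h2K (by exact_mod_cast hpqK)
    · exact exists_eq_sq_mul_of_sqrt_mem hp.ne_zero hp.ne_zero hppK hA h
    · exact exists_eq_sq_mul_of_sqrt_mem hp.ne_zero hq.ne_zero hpqK hA h
  obtain ⟨B₂, hB₂, h₂⟩ : ∃ B ∈ Lplus p q s, eps = B ^ 2 * p := by
    obtain ⟨A, hA, h | h⟩ := heps.exists_mul_eq_sq hp hs hps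
      (fun a => right (not_dvd_sq_add_four hs (by omega) a))
      (fun a => left (not_dvd_sq_sub_eight hp (by omega) a))
      (fun a => left (not_dvd_sq_add_eight hp (by omega) a)) h2K (by exact_mod_cast hpsK)
    · exact exists_eq_sq_mul_of_sqrt_mem hp.ne_zero hp.ne_zero hppK hA h
    · exact exists_eq_sq_mul_of_sqrt_mem hp.ne_zero hs.ne_zero hpsK hA h
  obtain ⟨B₃, hB₃, h₃⟩ : ∃ B ∈ Lplus p q s, eqs = B ^ 2 * p := by
    obtain ⟨A, hA, h | h⟩ := heqs.exists_mul_eq_sq hq hs hqs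
      (fun a => left (not_dvd_sq_add_four hq (by omega) a))
      (fun a => right (not_dvd_sq_sub_eight hs (by omega) a))
      (fun a => left (not_dvd_sq_add_eight hq (by omega) a)) h2K (by exact_mod_cast hqsK)
    · exact exists_eq_sq_mul_of_sqrt_mem hp.ne_zero hq.ne_zero hpqK hA h
    · exact exists_eq_sq_mul_of_sqrt_mem hp.ne_zero hs.ne_zero hpsK hA h
  have hpK : (p : ℝ) ∈ Lplus p q s := IntermediateField.natCast_mem _ p
  exact ⟨⟨B₁ * B₂ * p, mul_mem (mul_mem hB₁ hB₂) hpK, by rw [h₁, h₂]; ring⟩,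
    ⟨B₁ * B₃ * p, mul_mem (mul_mem hB₁ hB₃) hpK, by rw [h₁, h₃]; ring⟩,
    ⟨B₂ * B₃ * p, mul_mem (mul_mem hB₂ hB₃) hpK, by rw [h₂, h₃]; ring⟩⟩
end
end
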